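/- arXiv:2107.12015 — 5 statements merged into one kernel-verified Lean document; each statement's English description precedes it below -/
import Mathlib

section
/- Let V : I → ℝ be continuous with liminf_{x→+∞} V(x) > 0, and let w : I → ℝ be continuous with w(x)/V(x) → 0 as x → +∞. Then: (i) for every solution u of −u″ + Vu = w on I, the limit of u(x) as x → +∞ exists in ℝ ∪ {+∞, −∞} and is one of +∞, −∞, 0; (ii) solutions with each of these three limits exist; (iii) there exist a solution u₀ with u₀(x) → 0 as x → +∞ and a nonzero solution v₀ of the homogeneous equation −v″ + Vv = 0 with v₀(x) → 0 as x → +∞ such that the set of solutions of −u″ + Vu = w tending to 0 at +∞ is exactly {u₀ + c·v₀ : c ∈ ℝ} (a one-dimensional affine subspace of C²(I;ℝ)). -/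
open Filter

/-- `u` is a `C²` solution of `−u″ + V·u = w` on the interval `I`, with first and second
derivative functions `u'` and `u''` (derivatives within `I`). -/
def SolOn (I : Set ℝ) (V w u u' u'' : ℝ → ℝ) : Prop :=
  (∀ x ∈ I, HasDerivWithinAt u (u' x) I x) ∧
  (∀ x ∈ I, HasDerivWithinAt u' (u'' x) I x) ∧
  ContinuousOn u'' I ∧
  ∀ x ∈ I, -u'' x + V x * u x = w x

section LinearODE

variable {E : Type*} [NormedAddCommGroup E] [NormedSpace ℝ E]

/-- The terms of the Picard (Dyson) series for `y' = A y + f`, `y t₀ = y₀`. -/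
noncomputable def dysonTerm (A : ℝ → E →L[ℝ] E) (f : ℝ → E) (t₀ : ℝ) (y₀ : E) : ℕ → ℝ → E
  | 0 => fun t => y₀ + ∫ s in t₀..t, f s
  | n + 1 => fun t => ∫ s in t₀..t, A s (dysonTerm A f t₀ y₀ n s)

/-- The derivatives of the terms `dysonTerm`. -/
noncomputable def dysonTermDeriv (A : ℝ → E →L[ℝ] E) (f : ℝ → E) (t₀ : ℝ) (y₀ : E) :
    ℕ → ℝ → E
  | 0 => f
  | n + 1 => fun t => A t (dysonTerm A f t₀ y₀ n t)

variable {J : Set ℝ} {A : ℝ → E →L[ℝ] E} {f : ℝ → E} {t₀ : ℝ} {y₀ : E}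

theorem hasDerivAt_integral_of_continuousOn_isOpen [CompleteSpace E] (hJo : IsOpen J)
    (hJ : J.OrdConnected) (ht₀ : t₀ ∈ J) (hf : ContinuousOn f J) {t : ℝ} (ht : t ∈ J) :
    HasDerivAt (fun x => ∫ s in t₀..x, f s) (f t) t :=
  intervalIntegral.integral_hasDerivAt_right
    ((hf.mono (hJ.uIcc_subset ht₀ ht)).intervalIntegrable)
    (hf.stronglyMeasurableAtFilter hJo t ht) (hf.continuousAt (hJo.mem_nhds ht))

theorem hasDerivAt_dysonTerm [CompleteSpace E] (hJo : IsOpen J) (hJ : J.OrdConnected)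
    (ht₀ : t₀ ∈ J) (hA : ContinuousOn A J) (hf : ContinuousOn f J) (n : ℕ) :
    ∀ t ∈ J, HasDerivAt (dysonTerm A f t₀ y₀ n) (dysonTermDeriv A f t₀ y₀ n t) t := by
  induction n with
  | zero =>
    intro t ht
    exact (hasDerivAt_integral_of_continuousOn_isOpen hJo hJ ht₀ hf ht).const_add y₀
  | succ n ih =>
    intro t ht
    have hc : ContinuousOn (dysonTerm A f t₀ y₀ n) J :=
      fun s hs => (ih s hs).continuousAt.continuousWithinAt
    exact hasDerivAt_integral_of_continuousOn_isOpen hJo hJ ht₀ (hA.clm_apply hc) ht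

theorem norm_dysonTerm_le {α β C M : ℝ} (h₀ : t₀ ∈ Set.Icc α β)
    (hC : ∀ t ∈ Set.Icc α β, ‖dysonTerm A f t₀ y₀ 0 t‖ ≤ C)
    (hM : ∀ t ∈ Set.Icc α β, ‖A t‖ ≤ M) (n : ℕ) :
    ∀ t ∈ Set.Icc α β, ‖dysonTerm A f t₀ y₀ n t‖ ≤ C * (M ^ n * |t - t₀| ^ n / n.factorial) := by
  have hM0 : 0 ≤ M := (norm_nonneg _).trans (hM t₀ h₀)
  have hC0 : 0 ≤ C := (norm_nonneg _).trans (hC t₀ h₀)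
  induction n with
  | zero => simpa using hC
  | succ n ih =>
    intro t ht
    have hsub : Set.uIoc t₀ t ⊆ Set.Icc α β :=
      Set.uIoc_subset_uIcc.trans (Set.ordConnected_Icc.uIcc_subset h₀ ht)
    calc ‖∫ s in t₀..t, A s (dysonTerm A f t₀ y₀ n s)‖
        = ‖∫ s in Set.uIoc t₀ t, A s (dysonTerm A f t₀ y₀ n s)‖ :=
          intervalIntegral.norm_intervalIntegral_eq _ _ _ _
      _ ≤ ∫ s in Set.uIoc t₀ t, M * (C * (M ^ n / n.factorial)) * |s - t₀| ^ n := by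
          refine MeasureTheory.norm_integral_le_of_norm_le ?_ ?_
          · refine Continuous.integrableOn_uIoc ?_
            fun_prop
          · refine (MeasureTheory.ae_restrict_iff' measurableSet_uIoc).2
              (Filter.Eventually.of_forall ?_)
            intro s hs
            calc ‖A s (dysonTerm A f t₀ y₀ n s)‖
                ≤ ‖A s‖ * ‖dysonTerm A f t₀ y₀ n s‖ := (A s).le_opNorm _
              _ ≤ M * (C * (M ^ n * |s - t₀| ^ n / n.factorial)) := by
                  gcongr
                  exacts [hM s (hsub hs), ih s (hsub hs)]
              _ = _ := by ring
      _ = C * (M ^ (n + 1) * |t - t₀| ^ (n + 1) / (n + 1).factorial) := by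
          rw [MeasureTheory.integral_const_mul, integral_pow_abs_sub_uIoc, Nat.factorial_succ]
          push_cast
          field_simp
          ring

/-- Global existence for linear differential equations on an open interval. -/
theorem exists_hasDerivAt_linear_ode [CompleteSpace E] (hJo : IsOpen J) (hJ : J.OrdConnected)
    (ht₀ : t₀ ∈ J) (hA : ContinuousOn A J) (hf : ContinuousOn f J) (y₀ : E) :
    ∃ y : ℝ → E, y t₀ = y₀ ∧ ∀ t ∈ J, HasDerivAt y (A t (y t) + f t) t := by
  refine ⟨fun t => ∑' n, dysonTerm A f t₀ y₀ n t, ?_, fun t ht => ?_⟩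
  · change ∑' n, dysonTerm A f t₀ y₀ n t₀ = y₀
    rw [tsum_eq_single 0]
    · simp [dysonTerm]
    · rintro (_ | n) hn
      · exact absurd rfl hn
      · simp [dysonTerm]
  have hder := hasDerivAt_dysonTerm (y₀ := y₀) hJo hJ ht₀ hA hf
  have hmin : min t t₀ ∈ J := by rcases min_choice t t₀ with h | h <;> rwa [h]
  have hmax : max t t₀ ∈ J := by rcases max_choice t t₀ with h | h <;> rwa [h]
  obtain ⟨α, hαJ, hα⟩ := Filter.nonempty_of_mem (inter_mem (mem_nhdsWithin_of_mem_nhds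
    (hJo.mem_nhds hmin)) (self_mem_nhdsWithin (s := Set.Iio (min t t₀))))
  obtain ⟨β, hβJ, hβ⟩ := Filter.nonempty_of_mem (inter_mem (mem_nhdsWithin_of_mem_nhds
    (hJo.mem_nhds hmax)) (self_mem_nhdsWithin (s := Set.Ioi (max t t₀))))
  obtain ⟨hαt, hαt₀⟩ := lt_min_iff.1 (Set.mem_Iio.1 hα)
  obtain ⟨htβ, ht₀β⟩ := max_lt_iff.1 (Set.mem_Ioi.1 hβ)
  have hsub : Set.Icc α β ⊆ J := hJ.out hαJ hβJ
  obtain ⟨M, hM⟩ := isCompact_Icc.exists_bound_of_continuousOn (hA.mono hsub)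
  obtain ⟨F, hF⟩ := isCompact_Icc.exists_bound_of_continuousOn (hf.mono hsub)
  have hc : ContinuousOn (dysonTerm A f t₀ y₀ 0) J :=
    fun s hs => (hder 0 s hs).continuousAt.continuousWithinAt
  obtain ⟨C, hC⟩ := isCompact_Icc.exists_bound_of_continuousOn (hc.mono hsub)
  have h₀ : t₀ ∈ Set.Icc α β := ⟨hαt₀.le, ht₀β.le⟩
  have hM0 : 0 ≤ M := (norm_nonneg _).trans (hM t₀ h₀)
  have hC0 : 0 ≤ C := (norm_nonneg _).trans (hC t₀ h₀)
  have hbound : ∀ n, ∀ s ∈ Set.Icc α β,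
      ‖dysonTerm A f t₀ y₀ n s‖ ≤ C * ((M * (β - α)) ^ n / n.factorial) := by
    intro n s hs
    refine (norm_dysonTerm_le h₀ hC hM n s hs).trans ?_
    have hst : |s - t₀| ≤ β - α := abs_sub_le_iff.2
      ⟨by linarith [hs.2, h₀.1], by linarith [hs.1, h₀.2]⟩
    rw [mul_pow]
    gcongr
  have hsum : Summable fun n : ℕ => C * ((M * (β - α)) ^ n / n.factorial) :=
    (Real.summable_pow_div_factorial _).mul_left C
  let b : ℕ → ℝ := fun n =>
    Nat.casesOn n F fun n => M * (C * ((M * (β - α)) ^ n / n.factorial))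
  have hb : Summable b := (summable_nat_add_iff 1).1 (hsum.mul_left M)
  have hderb : ∀ n, ∀ s ∈ Set.Ioo α β, ‖dysonTermDeriv A f t₀ y₀ n s‖ ≤ b n := by
    rintro (_ | n) s hs
    · exact hF s (Set.Ioo_subset_Icc_self hs)
    · refine ((A s).le_opNorm _).trans ?_
      have h1 := hM s (Set.Ioo_subset_Icc_self hs)
      have h2 := hbound n s (Set.Ioo_subset_Icc_self hs)
      exact mul_le_mul h1 h2 (norm_nonneg _) hM0
  have hst : Summable fun n => dysonTerm A f t₀ y₀ n t :=
    Summable.of_norm_bounded hsum fun n => hbound n t ⟨hαt.le, htβ.le⟩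
  have key := hasDerivAt_tsum_of_isPreconnected hb isOpen_Ioo isPreconnected_Ioo
    (fun n s hs => hder n s (hsub (Set.Ioo_subset_Icc_self hs))) hderb ⟨hαt, htβ⟩ hst
    ⟨hαt, htβ⟩
  have hsd : Summable fun n => dysonTermDeriv A f t₀ y₀ n t :=
    Summable.of_norm_bounded hb fun n => hderb n t ⟨hαt, htβ⟩
  rw [hsd.tsum_eq_zero_add] at key
  simp only [dysonTermDeriv] at key
  rwa [← (A t).map_tsum hst, add_comm] at key

end LinearODE

section Schrodinger

variable {I : Set ℝ} {V w : ℝ → ℝ}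

theorem exists_solOn_of_isOpen (hIo : IsOpen I) (hI : I.OrdConnected) (hV : ContinuousOn V I)
    (hw : ContinuousOn w I) {x₀ : ℝ} (hx₀ : x₀ ∈ I) (a b : ℝ) :
    ∃ u u' u'', SolOn I V w u u' u'' ∧ u x₀ = a ∧ u' x₀ = b := by
  obtain ⟨y, hy₀, hy⟩ := exists_hasDerivAt_linear_ode (E := ℝ × ℝ) hIo hI hx₀
    (A := fun x => (ContinuousLinearMap.inl ℝ ℝ ℝ).comp (ContinuousLinearMap.snd ℝ ℝ ℝ) +
      V x • (ContinuousLinearMap.inr ℝ ℝ ℝ).comp (ContinuousLinearMap.fst ℝ ℝ ℝ))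
    (f := fun x => ((0 : ℝ), -w x)) (by fun_prop) (by fun_prop) (a, b)
  have h1 : ∀ x ∈ I, HasDerivAt (fun x => (y x).1) (y x).2 x := fun x hx => by
    refine (hasFDerivAt_fst.comp_hasDerivAt x (hy x hx)).congr_deriv ?_
    simp
  have h2 : ∀ x ∈ I, HasDerivAt (fun x => (y x).2) (V x * (y x).1 - w x) x := fun x hx => by
    refine (hasFDerivAt_snd.comp_hasDerivAt x (hy x hx)).congr_deriv ?_
    simp [sub_eq_add_neg]
  have hc : ContinuousOn (fun x => (y x).1) I :=
    fun x hx => (h1 x hx).continuousAt.continuousWithinAt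
  refine ⟨fun x => (y x).1, fun x => (y x).2, fun x => V x * (y x).1 - w x,
    ⟨fun x hx => (h1 x hx).hasDerivWithinAt, fun x hx => (h2 x hx).hasDerivWithinAt,
      (hV.mul hc).sub hw, fun x _ => by ring⟩, by simp [hy₀], by simp [hy₀]⟩

theorem SolOn.mono {J : Set ℝ} {V₁ w₁ u u' u'' : ℝ → ℝ} (h : SolOn J V₁ w₁ u u' u'')
    (hIJ : I ⊆ J) (hV : Set.EqOn V₁ V I) (hw : Set.EqOn w₁ w I) : SolOn I V w u u' u'' :=
  ⟨fun x hx => (h.1 x (hIJ hx)).mono hIJ, fun x hx => (h.2.1 x (hIJ hx)).mono hIJ,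
    h.2.2.1.mono hIJ, fun x hx => by rw [← hV hx, ← hw hx]; exact h.2.2.2 x (hIJ hx)⟩

/-- Global existence for the initial value problem on an interval unbounded above. -/
theorem exists_solOn (hI : I.OrdConnected) (hub : ∀ M : ℝ, ∃ x ∈ I, M < x)
    (hV : ContinuousOn V I) (hw : ContinuousOn w I) {x₀ : ℝ} (hx₀ : x₀ ∈ I) (a b : ℝ) :
    ∃ u u' u'', SolOn I V w u u' u'' ∧ u x₀ = a ∧ u' x₀ = b := by
  by_cases hmin : ∃ m ∈ I, ∀ x ∈ I, m ≤ x
  · obtain ⟨m, hm, hle⟩ := hmin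
    have hmem : ∀ x, max m x ∈ I := fun x => by
      obtain ⟨z, hz, hxz⟩ := hub (max m x)
      exact hI.out hm hz ⟨le_max_left _ _, hxz.le⟩
    have hext : ∀ g : ℝ → ℝ, ContinuousOn g I → Continuous fun x => g (max m x) := fun g hg =>
      hg.comp_continuous (by fun_prop) hmem
    obtain ⟨u, u', u'', hu, h0⟩ := exists_solOn_of_isOpen isOpen_univ Set.ordConnected_univ
      (hext V hV).continuousOn (hext w hw).continuousOn (Set.mem_univ x₀) a b
    exact ⟨u, u', u'', hu.mono (Set.subset_univ _) (fun x hx => by simp [hle x hx])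
      (fun x hx => by simp [hle x hx]), h0⟩
  · push Not at hmin
    refine exists_solOn_of_isOpen (isOpen_iff_mem_nhds.2 fun x hx => ?_) hI hV hw hx₀ a b
    obtain ⟨y, hy, hyx⟩ := hmin x hx
    obtain ⟨z, hz, hxz⟩ := hub x
    exact mem_of_superset (Icc_mem_nhds hyx hxz) (hI.out hy hz)

theorem SolOn.add_const_mul {w₁ w₂ u u' u'' v v' v'' : ℝ → ℝ} (hu : SolOn I V w₁ u u' u'')
    (hv : SolOn I V w₂ v v' v'') (c : ℝ) :
    SolOn I V (fun x => w₁ x + c * w₂ x) (fun x => u x + c * v x) (fun x => u' x + c * v' x)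
      (fun x => u'' x + c * v'' x) :=
  ⟨fun x hx => (hu.1 x hx).add ((hv.1 x hx).const_mul c),
    fun x hx => (hu.2.1 x hx).add ((hv.2.1 x hx).const_mul c),
    hu.2.2.1.add (hv.2.2.1.const_smul c),
    fun x hx => by linear_combination hu.2.2.2 x hx + c * hv.2.2.2 x hx⟩

theorem SolOn.add_const_mul_homogeneous {u u' u'' v v' v'' : ℝ → ℝ} (hu : SolOn I V w u u' u'')
    (hv : SolOn I V (fun _ => 0) v v' v'') (c : ℝ) :
    SolOn I V w (fun x => u x + c * v x) (fun x => u' x + c * v' x)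
      (fun x => u'' x + c * v'' x) := by
  simpa using hu.add_const_mul hv c

theorem SolOn.neg {u u' u'' : ℝ → ℝ} (hu : SolOn I V w u u' u'') :
    SolOn I V (fun x => -w x) (fun x => -u x) (fun x => -u' x) (fun x => -u'' x) :=
  ⟨fun x hx => (hu.1 x hx).neg, fun x hx => (hu.2.1 x hx).neg, hu.2.2.1.neg,
    fun x hx => by linear_combination -hu.2.2.2 x hx⟩

/-- A homogeneous solution with vanishing Cauchy data vanishes, because its Wronskian with every
other solution is constant. -/
theorem SolOn.eq_zero_of_initial (hI : I.OrdConnected) (hub : ∀ M : ℝ, ∃ x ∈ I, M < x)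
    (hV : ContinuousOn V I) {e e' e'' : ℝ → ℝ} (he : SolOn I V (fun _ => 0) e e' e'') {x₀ : ℝ}
    (hx₀ : x₀ ∈ I) (h0 : e x₀ = 0) (h1 : e' x₀ = 0) : ∀ x ∈ I, e x = 0 := by
  intro x hx
  obtain ⟨z, z', z'', hz, hz0, hz1⟩ := exists_solOn (w := fun _ => 0) hI hub hV
    continuousOn_const hx 0 1
  have hW : ∀ t ∈ I, HasDerivWithinAt (fun t => e t * z' t - e' t * z t) 0 I t := fun t ht => by
    have h := ((he.1 t ht).mul (hz.2.1 t ht)).sub ((he.2.1 t ht).mul (hz.1 t ht))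
    refine h.congr_deriv ?_
    linear_combination e t * -hz.2.2.2 t ht + z t * he.2.2.2 t ht
  have := hI.convex.norm_image_sub_le_of_norm_hasDerivWithin_le hW (C := 0) (by simp) hx₀ hx
  simpa [hz0, hz1, h0, h1] using this

end Schrodinger

section Asymptotics

theorem mul_sub_le_image_sub_of_le_hasDerivWithinAt {f f' : ℝ → ℝ} {a b C : ℝ} (hab : a ≤ b)
    (hf : ∀ x ∈ Set.Icc a b, HasDerivWithinAt f (f' x) (Set.Icc a b) x)
    (hC : ∀ x ∈ Set.Icc a b, C ≤ f' x) : C * (b - a) ≤ f b - f a := by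
  have hat : ∀ x ∈ Set.Ioo a b, HasDerivAt f (f' x) x := fun x hx =>
    (hf x (Set.Ioo_subset_Icc_self hx)).hasDerivAt (Icc_mem_nhds hx.1 hx.2)
  refine (convex_Icc a b).mul_sub_le_image_sub_of_le_deriv
    (fun x hx => (hf x hx).continuousWithinAt) ?_ ?_ a (Set.left_mem_Icc.2 hab) b
    (Set.right_mem_Icc.2 hab) hab
  · rw [interior_Icc]
    exact fun x hx => (hat x hx).differentiableAt.differentiableWithinAt
  · rw [interior_Icc]
    exact fun x hx => (hat x hx).deriv ▸ hC x (Set.Ioo_subset_Icc_self hx)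

/-- A function that rises above the level `c` is increasing at some point above that level. -/
theorem exists_lt_image_and_deriv_pos {f f' : ℝ → ℝ} {a b c : ℝ} (hab : a ≤ b)
    (hf : ∀ x ∈ Set.Icc a b, HasDerivWithinAt f (f' x) (Set.Icc a b) x)
    (ha : f a ≤ c) (hb : c < f b) : ∃ x ∈ Set.Icc a b, c < f x ∧ 0 < f' x := by
  by_contra! hcon
  obtain ⟨η, hη, hηb⟩ : ∃ η > 0, c + η * (1 + (b - a)) < f b := by
    have hfc : 0 < f b - c := sub_pos.2 hb
    have hba : 0 ≤ b - a := sub_nonneg.2 hab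
    refine ⟨(f b - c) / 2 / (1 + (b - a)), by positivity, ?_⟩
    rw [div_mul_cancel₀ _ (by linarith)]
    linarith
  have := image_le_of_deriv_right_lt_deriv_boundary (f := f) (f' := f') (a := a) (b := b)
    (B := fun x => c + η * (1 + (x - a))) (B' := fun _ => η)
    (fun x hx => (hf x hx).continuousWithinAt)
    (fun x hx => (hf x (Set.Ico_subset_Icc_self hx)).mono_of_mem_nhdsWithin
      (Icc_mem_nhdsGE_of_mem hx)) (by simp; linarith)
    (fun x => by
      simpa using ((((hasDerivAt_id x).sub_const a).const_add 1).const_mul η).const_add c)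
    (fun x hx hx' => (hcon x (Set.Ico_subset_Icc_self hx) (by
      have : 0 < η * (1 + (x - a)) := mul_pos hη (by linarith [hx.1])
      linarith)).trans_lt hη) (Set.right_mem_Icc.2 hab)
  linarith

variable {V w u u' u'' : ℝ → ℝ} {R δ : ℝ}

theorem SolOn.le_of_initial_pos (h : SolOn (Set.Ici R) V w u u' u'')
    (hV : ∀ x ∈ Set.Ici R, 0 < V x) (hw : ∀ x ∈ Set.Ici R, w x ≤ δ * V x)
    (h0 : δ < u R) (h1 : 0 < u' R) : ∀ x ∈ Set.Ici R, u R ≤ u x ∧ u' R ≤ u' x := by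
  intro X hX
  have hcu : ContinuousOn u (Set.Ici R) := fun x hx => (h.1 x hx).continuousWithinAt
  have hcu' : ContinuousOn u' (Set.Ici R) := fun x hx => (h.2.1 x hx).continuousWithinAt
  have hclosed : IsClosed ({x | u R ≤ u x ∧ u' R ≤ u' x} ∩ Set.Icc R X) := by
    have h2 := ((hcu.mono Set.Icc_subset_Ici_self).preimage_isClosed_of_isClosed
      (isClosed_Icc (a := R) (b := X)) (isClosed_Ici (a := u R))).inter
      ((hcu'.mono Set.Icc_subset_Ici_self).preimage_isClosed_of_isClosed
      (isClosed_Icc (a := R) (b := X)) (isClosed_Ici (a := u' R)))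
    convert h2 using 1
    ext x
    simp only [Set.mem_inter_iff, Set.mem_ofPred_eq, Set.mem_preimage, Set.mem_Ici]
    tauto
  refine hclosed.Icc_subset_of_forall_exists_gt ⟨le_rfl, le_rfl⟩ ?_ (Set.right_mem_Icc.2 hX)
  rintro x ⟨⟨hx0, hx1⟩, hxR, -⟩ y (hy : x < y)
  have hev : ∀ᶠ t in nhdsWithin x (Set.Ici x), δ < u t :=
    ((hcu x hxR).mono (Set.Ici_subset_Ici.2 hxR)).eventually (lt_mem_nhds (h0.trans_le hx0))
  obtain ⟨z, hz, hzsub⟩ := mem_nhdsGE_iff_exists_Icc_subset.1 hev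
  have hxm : x < min z y := lt_min hz hy
  have hsub : ∀ {t}, Set.Icc x t ⊆ Set.Ici R := @fun _ _ hs => hxR.trans hs.1
  have hu'mono : ∀ t ∈ Set.Icc x (min z y), u' x ≤ u' t := by
    intro t ht
    have := mul_sub_le_image_sub_of_le_hasDerivWithinAt (C := 0) ht.1
      (fun s hs => (h.2.1 s (hsub hs)).mono hsub) (fun s hs => by
        have hδ : δ < u s := hzsub ⟨hs.1, hs.2.trans (ht.2.trans (min_le_left _ _))⟩
        have := mul_pos (hV s (hsub hs)) (sub_pos.2 hδ)
        linarith [h.2.2.2 s (hsub hs), hw s (hsub hs)])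
    linarith
  refine ⟨min z y, ⟨?_, hx1.trans (hu'mono _ (Set.right_mem_Icc.2 hxm.le))⟩, hxm,
    min_le_right _ _⟩
  have := mul_sub_le_image_sub_of_le_hasDerivWithinAt (C := 0) hxm.le
      (fun s hs => (h.1 s (hsub hs)).mono hsub) (fun s hs => by linarith [hu'mono s hs])
  linarith

/-- A solution that is increasing at a point where it exceeds every later value of `w / V` tends
to `+∞`. -/
theorem SolOn.tendsto_atTop_of_pos (h : SolOn (Set.Ici R) V w u u' u'')
    (hV : ∀ x ∈ Set.Ici R, 0 < V x) (hw : ∀ x ∈ Set.Ici R, w x ≤ δ * V x)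
    {x₁ : ℝ} (hx₁ : R ≤ x₁) (h0 : δ < u x₁) (h1 : 0 < u' x₁) : Tendsto u atTop atTop := by
  have hsub := Set.Ici_subset_Ici.2 hx₁
  have hle := (h.mono hsub (fun _ _ => rfl) (fun _ _ => rfl)).le_of_initial_pos
    (fun x hx => hV x (hsub hx)) (fun x hx => hw x (hsub hx)) h0 h1
  have hlin : Tendsto (fun x => u x₁ + u' x₁ * (x - x₁)) atTop atTop :=
    tendsto_atTop_add_const_left _ _
      ((tendsto_atTop_add_const_right _ (-x₁) tendsto_id).const_mul_atTop h1)
  refine tendsto_atTop_mono' _ ?_ hlin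
  filter_upwards [eventually_ge_atTop x₁] with x hx
  have hIcc : Set.Icc x₁ x ⊆ Set.Ici R := fun s hs => hx₁.trans hs.1
  have := mul_sub_le_image_sub_of_le_hasDerivWithinAt hx
    (fun s hs => (h.1 s (hIcc hs)).mono hIcc) (fun s hs => (hle s hs.1).2)
  linarith

theorem SolOn.exists_forall_le {ε : ℝ} (hε : 0 < ε) (hδ : 0 < δ)
    (h : SolOn (Set.Ici R) V w u u' u'') (hV : ∀ x ∈ Set.Ici R, ε ≤ V x)
    (hw : ∀ x ∈ Set.Ici R, w x ≤ δ * V x) (hu : ¬ Tendsto u atTop atTop) :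
    ∃ X, ∀ x ≥ X, u x ≤ 2 * δ := by
  have hno : ∀ x ≥ R, δ < u x → u' x ≤ 0 := fun x hx h0 => not_lt.1 fun h1 =>
    hu (h.tendsto_atTop_of_pos (fun x hx => hε.trans_le (hV x hx)) hw hx h0 h1)
  by_cases hex : ∃ x₁ ≥ R, u x₁ ≤ 2 * δ
  · obtain ⟨x₁, hx₁, hux₁⟩ := hex
    refine ⟨x₁, fun x hx => not_lt.1 fun hlt => ?_⟩
    have hIcc : Set.Icc x₁ x ⊆ Set.Ici R := fun s hs => hx₁.trans hs.1
    obtain ⟨y, hy, h0, h1⟩ := exists_lt_image_and_deriv_pos hx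
      (fun s hs => (h.1 s (hIcc hs)).mono hIcc) hux₁ hlt
    linarith [hno y (hIcc hy) (by linarith)]
  · push Not at hex
    exfalso
    have hεδ : 0 < ε * δ := mul_pos hε hδ
    have hR : R ≤ R + (|u' R| + 1) / (ε * δ) := by
      have : 0 ≤ (|u' R| + 1) / (ε * δ) := by positivity
      linarith
    have hIcc : Set.Icc R (R + (|u' R| + 1) / (ε * δ)) ⊆ Set.Ici R := Set.Icc_subset_Ici_self
    have := mul_sub_le_image_sub_of_le_hasDerivWithinAt (C := ε * δ) hR
      (fun s hs => (h.2.1 s (hIcc hs)).mono hIcc) (fun s hs => by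
        have h1 : ε * δ ≤ V s * (u s - δ) :=
          mul_le_mul (hV s hs.1) (by linarith [hex s hs.1]) hδ.le (hε.le.trans (hV s hs.1))
        linarith [h.2.2.2 s hs.1, hw s hs.1])
    rw [add_sub_cancel_left, mul_div_cancel₀ _ hεδ.ne'] at this
    linarith [hno _ hR (by linarith [hex _ hR]), neg_abs_le (u' R)]

theorem SolOn.nonpos_of_tendsto_zero (h : SolOn (Set.Ici R) V (fun _ => 0) u u' u'')
    (hV : ∀ x ∈ Set.Ici R, 0 < V x) (h0 : u R = 0) (hu : Tendsto u atTop (nhds 0)) :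
    ∀ x ∈ Set.Ici R, u x ≤ 0 := by
  refine fun x hx => not_lt.1 fun hlt => ?_
  obtain ⟨y, hy, h0, h1⟩ := exists_lt_image_and_deriv_pos (Set.mem_Ici.1 hx)
    (fun s hs => (h.1 s hs.1).mono Set.Icc_subset_Ici_self) h0.le hlt
  exact not_tendsto_nhds_of_tendsto_atTop
    (h.tendsto_atTop_of_pos (δ := 0) hV (by simp) hy.1 h0 h1) 0 hu

theorem SolOn.eq_zero_of_tendsto_zero (h : SolOn (Set.Ici R) V (fun _ => 0) u u' u'')
    (hV : ∀ x ∈ Set.Ici R, 0 < V x) (h0 : u R = 0) (hu : Tendsto u atTop (nhds 0)) :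
    ∀ x ∈ Set.Ici R, u x = 0 := fun x hx =>
  le_antisymm (h.nonpos_of_tendsto_zero hV h0 hu x hx) <| by
    have hneg := h.neg
    simp only [neg_zero] at hneg
    simpa using hneg.nonpos_of_tendsto_zero hV (by simp [h0]) (by simpa using hu.neg) x hx

theorem SolOn.deriv_eq_zero_of_tendsto_zero (h : SolOn (Set.Ici R) V (fun _ => 0) u u' u'')
    (hV : ∀ x ∈ Set.Ici R, 0 < V x) (h0 : u R = 0) (hu : Tendsto u atTop (nhds 0)) :
    u' R = 0 := by
  have hz := h.eq_zero_of_tendsto_zero hV h0 hu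
  have hd : HasDerivWithinAt u 0 (Set.Ici R) R :=
    (hasDerivWithinAt_const R (Set.Ici R) 0).congr hz h0
  exact (uniqueDiffWithinAt_Ici R).eq_deriv _ (h.1 R Set.self_mem_Ici) hd

variable {I : Set ℝ}

theorem exists_Ici_subset_and_bounds (hI : I.OrdConnected) (hub : ∀ M : ℝ, ∃ x ∈ I, M < x)
    {ε : ℝ} (hε : 0 < ε) (hV : ∀ᶠ x in atTop, ε ≤ V x)
    (hw : Tendsto (fun x => w x / V x) atTop (nhds 0)) (hδ : 0 < δ) :
    ∃ R, Set.Ici R ⊆ I ∧ (∀ x ∈ Set.Ici R, ε ≤ V x) ∧ (∀ x ∈ Set.Ici R, w x ≤ δ * V x) ∧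
      ∀ x ∈ Set.Ici R, -w x ≤ δ * V x := by
  obtain ⟨M, hM⟩ := eventually_atTop.1 (hV.and (hw.eventually (Metric.closedBall_mem_nhds 0 hδ)))
  obtain ⟨R, hR, hMR⟩ := hub M
  have habs : ∀ x ∈ Set.Ici R, |w x| ≤ δ * V x := fun x hx => by
    obtain ⟨h1, h2⟩ := hM x (hMR.le.trans hx)
    have hVx : 0 < V x := hε.trans_le h1
    rwa [dist_zero_right, Real.norm_eq_abs, abs_div, abs_of_pos hVx,
      div_le_iff₀ hVx] at h2
  refine ⟨R, fun x hx => ?_, fun x hx => (hM x (hMR.le.trans hx)).1,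
    fun x hx => (le_abs_self _).trans (habs x hx), fun x hx => (neg_le_abs _).trans (habs x hx)⟩
  obtain ⟨z, hz, hxz⟩ := hub x
  exact hI.out hR hz ⟨hx, hxz.le⟩

theorem SolOn.tendsto_trichotomy (hI : I.OrdConnected) (hub : ∀ M : ℝ, ∃ x ∈ I, M < x)
    {ε : ℝ} (hε : 0 < ε) (hV : ∀ᶠ x in atTop, ε ≤ V x)
    (hw : Tendsto (fun x => w x / V x) atTop (nhds 0)) (h : SolOn I V w u u' u'') :
    Tendsto u atTop atTop ∨ Tendsto u atTop atBot ∨ Tendsto u atTop (nhds 0) := by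
  by_contra! hcon
  obtain ⟨htop, hbot, hzero⟩ := hcon
  refine hzero (Metric.tendsto_atTop.2 fun η hη => ?_)
  have hδ : 0 < η / 3 := by positivity
  obtain ⟨R, hRI, hVR, hw1, hw2⟩ := exists_Ici_subset_and_bounds hI hub hε hV hw hδ
  have hR := h.mono hRI (fun _ _ => rfl) (fun _ _ => rfl)
  obtain ⟨X, hX⟩ := hR.exists_forall_le hε hδ hVR hw1 htop
  obtain ⟨Y, hY⟩ := hR.neg.exists_forall_le hε hδ hVR hw2
    fun ht => hbot (tendsto_neg_atTop_iff.1 ht)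
  refine ⟨max X Y, fun x hx => ?_⟩
  have h1 := hX x ((le_max_left _ _).trans hx)
  have h2 := hY x ((le_max_right _ _).trans hx)
  rw [dist_zero_right, Real.norm_eq_abs, abs_lt]
  constructor <;> linarith

theorem SolOn.exists_lt_and_deriv_pos (h : SolOn (Set.Ici R) V w u u' u'')
    (hu : Tendsto u atTop atTop) (c : ℝ) : ∃ x ≥ R, c < u x ∧ 0 < u' x := by
  obtain ⟨b, hb, hRb⟩ := ((hu.eventually_gt_atTop (max c (u R))).and
    (eventually_ge_atTop R)).exists
  obtain ⟨x, hx, h0, h1⟩ := exists_lt_image_and_deriv_pos hRb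
    (fun s hs => (h.1 s hs.1).mono Set.Icc_subset_Ici_self) (le_max_right c (u R)) hb
  exact ⟨x, hx.1, (le_max_left _ _).trans_lt h0, h1⟩

/-- Shooting along a homogeneous solution that is positive and increasing at `R`. -/
theorem SolOn.exists_tendsto_zero_add_mul (hI : I.OrdConnected)
    (hub : ∀ M : ℝ, ∃ x ∈ I, M < x) {ε : ℝ} (hε : 0 < ε) (hVε : ∀ᶠ x in atTop, ε ≤ V x)
    (hwV : Tendsto (fun x => w x / V x) atTop (nhds 0)) (h : SolOn I V w u u' u'')
    {z z' z'' : ℝ → ℝ} (hz : SolOn I V (fun _ => 0) z z' z'') (hRI : Set.Ici R ⊆ I)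
    (hV : ∀ x ∈ Set.Ici R, 0 < V x) (hw₁ : ∀ x ∈ Set.Ici R, w x ≤ δ * V x)
    (hw₂ : ∀ x ∈ Set.Ici R, -w x ≤ δ * V x) (hz0 : z R = 1) (hz1 : z' R = 1) :
    ∃ s : ℝ, Tendsto (fun x => u x + s * z x) atTop (nhds 0) := by
  by_contra! hcon
  have hsol := fun s => (h.add_const_mul_homogeneous hz s).mono hRI (fun _ _ => rfl)
    (fun _ _ => rfl)
  have htop : ∀ s, (∃ x ≥ R, δ < u x + s * z x ∧ 0 < u' x + s * z' x) →
      Tendsto (fun x => u x + s * z x) atTop atTop := fun s ⟨x, hx, h0, h1⟩ =>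
    (hsol s).tendsto_atTop_of_pos hV hw₁ hx h0 h1
  have hbot : ∀ s, (∃ x ≥ R, δ < -(u x + s * z x) ∧ 0 < -(u' x + s * z' x)) →
      Tendsto (fun x => u x + s * z x) atTop atBot := fun s ⟨x, hx, h0, h1⟩ =>
    tendsto_neg_atTop_iff.1 ((hsol s).neg.tendsto_atTop_of_pos hV hw₂ hx h0 h1)
  have hmeet : (Set.univ ∩ ({s | ∃ x ≥ R, δ < u x + s * z x ∧ 0 < u' x + s * z' x} ∩
      {s | ∃ x ≥ R, δ < -(u x + s * z x) ∧ 0 < -(u' x + s * z' x)})).Nonempty := by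
    refine isPreconnected_univ _ _ ?_ ?_ ?_ ?_ ?_
    · simp only [Set.ofPred_exists, Set.ofPred_and]
      exact isOpen_iUnion fun x => isOpen_const.inter <|
        (isOpen_lt (by fun_prop) (by fun_prop)).inter (isOpen_lt (by fun_prop) (by fun_prop))
    · simp only [Set.ofPred_exists, Set.ofPred_and]
      exact isOpen_iUnion fun x => isOpen_const.inter <|
        (isOpen_lt (by fun_prop) (by fun_prop)).inter (isOpen_lt (by fun_prop) (by fun_prop))
    · intro s _
      rcases (h.add_const_mul_homogeneous hz s).tendsto_trichotomy hI hub hε hVε hwV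
        with ht | ht | ht
      · exact Or.inl ((hsol s).exists_lt_and_deriv_pos ht δ)
      · exact Or.inr ((hsol s).neg.exists_lt_and_deriv_pos (tendsto_neg_atTop_iff.2 ht) δ)
      · exact absurd ht (hcon s)
    · refine ⟨|δ| + |u R| + |u' R| + 1, Set.mem_univ _, R, le_rfl, ?_, ?_⟩
      · rw [hz0]
        linarith [le_abs_self δ, neg_abs_le (u R), abs_nonneg (u' R)]
      · rw [hz1]
        linarith [abs_nonneg δ, abs_nonneg (u R), neg_abs_le (u' R)]
    · refine ⟨-(|δ| + |u R| + |u' R| + 1), Set.mem_univ _, R, le_rfl, ?_, ?_⟩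
      · rw [hz0]
        linarith [le_abs_self δ, le_abs_self (u R), abs_nonneg (u' R)]
      · rw [hz1]
        linarith [abs_nonneg δ, abs_nonneg (u R), le_abs_self (u' R)]
  obtain ⟨s, -, hs1, hs2⟩ := hmeet
  exact (htop s hs1).not_tendsto disjoint_atTop_atBot (hbot s hs2)

end Asymptotics

/-- Let `I ⊆ ℝ` be an interval with `sup I = +∞`, `V : I → ℝ` continuous with
`liminf_{x→+∞} V > 0`, and `w : I → ℝ` continuous with `w/V → 0` at `+∞`.  Then (i) every
solution of `−u″ + Vu = w` on `I` tends to `+∞`, `−∞` or `0` at `+∞`; (ii) solutions with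
each of these limits exist; (iii) the solutions tending to `0` form a one-dimensional affine
subspace `{u₀ + c·v₀ : c ∈ ℝ}`, where `u₀` is a solution tending to `0` and `v₀` is a nonzero
solution of the homogeneous equation tending to `0`. -/
theorem recessive_solutions_exist
    (I : Set ℝ) (hI : I.OrdConnected) (hne : I.Nonempty)
    (hub : ∀ M : ℝ, ∃ x ∈ I, M < x)
    (V w : ℝ → ℝ) (hV : ContinuousOn V I) (hw : ContinuousOn w I)
    (hVpos : ∃ ε : ℝ, 0 < ε ∧ ∀ᶠ x in atTop, ε ≤ V x)
    (hwV : Tendsto (fun x => w x / V x) atTop (nhds 0)) :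
    (∀ u u' u'', SolOn I V w u u' u'' →
        Tendsto u atTop atTop ∨ Tendsto u atTop atBot ∨ Tendsto u atTop (nhds 0)) ∧
    (∃ u u' u'', SolOn I V w u u' u'' ∧ Tendsto u atTop atTop) ∧
    (∃ u u' u'', SolOn I V w u u' u'' ∧ Tendsto u atTop atBot) ∧
    (∃ u u' u'', SolOn I V w u u' u'' ∧ Tendsto u atTop (nhds 0)) ∧
    (∃ u₀ u₀' u₀'' v₀ v₀' v₀'' : ℝ → ℝ,
      SolOn I V w u₀ u₀' u₀'' ∧ Tendsto u₀ atTop (nhds 0) ∧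
      SolOn I V (fun _ => 0) v₀ v₀' v₀'' ∧ (∃ x ∈ I, v₀ x ≠ 0) ∧ Tendsto v₀ atTop (nhds 0) ∧
      (∀ u u' u'', SolOn I V w u u' u'' → Tendsto u atTop (nhds 0) →
        ∃ c : ℝ, ∀ x ∈ I, u x = u₀ x + c * v₀ x) ∧
      (∀ c : ℝ, SolOn I V w (fun x => u₀ x + c * v₀ x) (fun x => u₀' x + c * v₀' x)
          (fun x => u₀'' x + c * v₀'' x) ∧
        Tendsto (fun x => u₀ x + c * v₀ x) atTop (nhds 0))) := by
  obtain ⟨ε, hε, hVε⟩ := hVpos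
  obtain ⟨R, hRI, hVR, hw₁, hw₂⟩ :=
    exists_Ici_subset_and_bounds hI hub hε hVε hwV (zero_lt_one' ℝ)
  have hVR0 : ∀ x ∈ Set.Ici R, 0 < V x := fun x hx => hε.trans_le (hVR x hx)
  have hR : R ∈ I := hRI Set.self_mem_Ici
  have restrict : ∀ {g u u' u'' : ℝ → ℝ}, SolOn I V g u u' u'' →
      SolOn (Set.Ici R) V g u u' u'' := fun h => h.mono hRI (fun _ _ => rfl) (fun _ _ => rfl)
  have hcz : ContinuousOn (fun _ : ℝ => (0 : ℝ)) I := continuousOn_const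
  obtain ⟨z, z', z'', hz, hz0, hz1⟩ := exists_solOn hI hub hV hcz hR 1 1
  obtain ⟨p, p', p'', hp, hp0, hp1⟩ := exists_solOn hI hub hV hcz hR 1 0
  obtain ⟨q, q', q'', hq, hq0, hq1⟩ := exists_solOn hI hub hV hw hR 2 1
  obtain ⟨r, r', r'', hr, hr0, hr1⟩ := exists_solOn hI hub hV hw hR (-2) (-1)
  obtain ⟨s, hs⟩ := hq.exists_tendsto_zero_add_mul hI hub hε hVε hwV hz hRI hVR0 hw₁ hw₂ hz0 hz1
  obtain ⟨k, hk⟩ := hp.exists_tendsto_zero_add_mul (δ := 0) hI hub hε hVε (by simp) hz hRI hVR0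
    (by simp) (by simp) hz0 hz1
  have hu₀ := hq.add_const_mul_homogeneous hz s
  have hv₀ := hp.add_const_mul_homogeneous hz k
  have hne₀ : p R + k * z R ≠ 0 := fun h0 => by
    have h1 := (restrict hv₀).deriv_eq_zero_of_tendsto_zero hVR0 h0 hk
    rw [hp0, hz0] at h0
    simp only [hp1, hz1] at h1
    linarith
  refine ⟨fun u u' u'' hu => hu.tendsto_trichotomy hI hub hε hVε hwV,
    ⟨q, q', q'', hq, (restrict hq).tendsto_atTop_of_pos hVR0 hw₁ le_rfl (by norm_num [hq0])
      (by norm_num [hq1])⟩,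
    ⟨r, r', r'', hr, tendsto_neg_atTop_iff.1 <| (restrict hr).neg.tendsto_atTop_of_pos hVR0 hw₂
      le_rfl (by norm_num [hr0]) (by norm_num [hr1])⟩,
    ⟨_, _, _, hu₀, hs⟩, _, _, _, _, _, _, hu₀, hs, hv₀, ⟨R, hR, hne₀⟩, hk, ?_,
    fun c => ⟨hu₀.add_const_mul_homogeneous hv₀ c, by simpa using hs.add (hk.const_mul c)⟩⟩
  intro u u' u'' hu hu0
  obtain ⟨c, hc⟩ : ∃ c, u R - (q R + s * z R) = c * (p R + k * z R) :=
    ⟨_, (div_mul_cancel₀ _ hne₀).symm⟩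
  have he := (hu.add_const_mul hu₀ (-1)).add_const_mul_homogeneous hv₀ (-c)
  simp only [neg_one_mul, add_neg_cancel] at he
  have heR : u R + -(q R + s * z R) + -c * (p R + k * z R) = 0 := by linear_combination hc
  have helim : Tendsto (fun x => u x + -(q x + s * z x) + -c * (p x + k * z x)) atTop
      (nhds 0) := by
    simpa using (hu0.add hs.neg).add (hk.const_mul (-c))
  refine ⟨c, fun x hx => ?_⟩
  have := he.eq_zero_of_initial hI hub hV hR heR
    ((restrict he).deriv_eq_zero_of_tendsto_zero hVR0 heR helim) x hx
  linear_combination this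
end

section
/- Let V : (0,∞) → ℝ be continuous and let ρ : (0,∞) → ℝ be Lipschitz with ρ′(x)² ≤ max{V(x),0} for almost every x > 0. Let w : (0,∞) → ℝ be continuous and let u ∈ C²((0,∞);ℝ) satisfy −u″ + Vu = w on (0,∞) and limsup_{x→+∞}|u(x)| < +∞. Then for every γ ∈ [0,1) there exists a constant C = C(γ), independent of V, ρ, w, u, such that for all 0 < a < b with V > 0 on (a,∞): ∫_b^∞ e^{2γρ} V u² ≤ C ( ∫_a^∞ e^{2γρ} w²/V + (b−a)^{−2} ∫_a^b e^{2γρ} u² ), where the integrals take values in [0,+∞]. -/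
open MeasureTheory Filter Set

/-- The exponential `y ↦ exp (k y)`, `k ≥ 0`, is Lipschitz on every left half-line. -/
lemma exists_lipschitzOnWith_exp_mul_Iic {k : ℝ} (hk : 0 ≤ k) (c : ℝ) :
    ∃ K : NNReal, LipschitzOnWith K (fun y => Real.exp (k * y)) (Iic c) := by
  refine ⟨(Real.exp (k * c) * k).toNNReal,
    (convex_Iic c).lipschitzOnWith_of_nnnorm_hasDerivWithin_le
    (f' := fun x => Real.exp (k * x) * k) (fun x _ => ?_) fun x hx => ?_⟩
  · simpa using ((hasDerivAt_id x).const_mul k).exp.hasDerivWithinAt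
  · rw [← NNReal.coe_le_coe, coe_nnnorm, Real.norm_eq_abs, abs_of_nonneg (by positivity),
      Real.coe_toNNReal _ (by positivity)]
    have : x ≤ c := hx
    gcongr

/-- A continuously differentiable function on `(0, ∞)` is absolutely continuous on compact
subintervals. -/
lemma absolutelyContinuousOnInterval_of_hasDerivAt {f f' : ℝ → ℝ} {a R : ℝ} (ha : 0 < a)
    (haR : a ≤ R) (hf : ∀ x ∈ Ioi (0 : ℝ), HasDerivAt f (f' x) x)
    (hf' : ContinuousOn f' (Ioi 0)) : AbsolutelyContinuousOnInterval f a R := by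
  have hsub : Icc a R ⊆ Ioi 0 := fun x hx => ha.trans_le hx.1
  obtain ⟨M, hM⟩ := isCompact_Icc.exists_bound_of_continuousOn (hf'.mono hsub)
  refine LipschitzOnWith.absolutelyContinuousOnInterval (K := M.toNNReal) ?_
  rw [uIcc_of_le haR]
  refine (convex_Icc a R).lipschitzOnWith_of_nnnorm_hasDerivWithin_le
    (fun x hx => (hf x (hsub hx)).hasDerivWithinAt) fun x hx => ?_
  rw [← NNReal.coe_le_coe, coe_nnnorm]
  exact (hM x hx).trans (Real.le_coe_toNNReal M)

/-- A differentiable function that is bounded near `+∞` has `u u'` arbitrarily small, from above,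
at arbitrarily large points. -/
lemma exists_ge_mul_deriv_le {u u' : ℝ → ℝ} (hu : ∀ x ∈ Ioi (0 : ℝ), HasDerivAt u (u' x) x)
    (hbd : ∃ M : ℝ, ∀ᶠ x in atTop, |u x| ≤ M) {δ : ℝ} (hδ : 0 < δ) (n : ℝ) :
    ∃ R, n ≤ R ∧ u R * u' R ≤ δ := by
  by_contra! h
  obtain ⟨M, hM⟩ := hbd
  obtain ⟨x₀, hx₀⟩ := eventually_atTop.1 hM
  set p := max (max n x₀) 1
  have hp1 : 1 ≤ p := le_max_right _ _
  have hpn : n ≤ p := (le_max_left _ _).trans (le_max_left _ _)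
  have hpx : x₀ ≤ p := (le_max_right _ _).trans (le_max_left _ _)
  have hM0 : 0 ≤ M := (abs_nonneg _).trans (hx₀ p hpx)
  set q := p + (M ^ 2 + 1) / δ
  have hq : p < q := lt_add_of_pos_right _ (by positivity)
  have hd : ∀ x, p ≤ x → HasDerivAt (fun y => u y ^ 2) (2 * (u x * u' x)) x := fun x hx => by
    have h0 : (0 : ℝ) < x := by linarith
    convert! (hu x h0).pow 2 using 1
    simp; ring
  obtain ⟨c, hc, hcd⟩ := exists_hasDerivAt_eq_slope (fun y => u y ^ 2)
    (fun x => 2 * (u x * u' x)) hq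
    (fun x hx => (hd x hx.1).continuousAt.continuousWithinAt) (fun x hx => hd x hx.1.le)
  have h1 : δ < u c * u' c := h c (hpn.trans hc.1.le)
  have h2 : u q ^ 2 ≤ M ^ 2 := sq_le_sq' (abs_le.1 (hx₀ q (hpx.trans hq.le))).1
    (abs_le.1 (hx₀ q (hpx.trans hq.le))).2
  have h3 : 2 * (u c * u' c) * (q - p) = u q ^ 2 - u p ^ 2 := by
    rw [hcd, div_mul_cancel₀ _ (sub_pos.2 hq).ne']
  have h4 : δ * (q - p) = M ^ 2 + 1 := by
    simp only [q, add_sub_cancel_left]; field_simp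
  nlinarith [sq_nonneg (u p), sub_pos.2 hq]

/-- The derivative of a truncation of `ρ` is a derivative of `ρ` or vanishes. -/
lemma HasDerivAt.hasDerivAt_or_eq_zero_of_min {ρ : ℝ → ℝ} {N d x : ℝ} (hc : ContinuousAt ρ x)
    (hd : HasDerivAt (fun y => min (ρ y) N) d x) : HasDerivAt ρ d x ∨ d = 0 := by
  rcases lt_or_ge (ρ x) N with h | h
  · left
    refine hd.congr_of_eventuallyEq ?_
    filter_upwards [hc.eventually_lt continuousAt_const h] with y hy
    exact (min_eq_left hy.le).symm
  · right
    refine IsLocalMax.hasDerivAt_eq_zero (Eventually.of_forall fun y => ?_) hd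
    simp [min_eq_right h]

/-- The pointwise inequality behind the Agmon estimate. -/
lemma agmon_pointwise {γ r s χ v w u p : ℝ} (hγ0 : 0 ≤ γ) (hγ1 : γ < 1) (hv : 0 < v)
    (hr : r ^ 2 ≤ v) (hχ0 : 0 ≤ χ) (hχ1 : χ ≤ 1) :
    χ ^ 2 * v * u ^ 2 ≤
      2 / (1 - γ) * (2 * χ * (s + γ * r * χ) * (u * p) + χ ^ 2 * (p * p + u * (v * u - w))) +
        (2 / (1 - γ) + 2 / (1 - γ) ^ 2) * (w ^ 2 / v + s ^ 2 * u ^ 2) := by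
  set t := 1 - γ with ht
  have ht0 : 0 < t := by linarith
  have ht1 : t ≤ 1 := by linarith
  have hγt : γ = 1 - t := by linarith
  have hχ2 : χ ^ 2 ≤ 1 := pow_le_one₀ hχ0 hχ1
  have hz : 0 ≤ w ^ 2 / v := by positivity
  have h1 : 2 * (u * w) ≤ t * v * u ^ 2 + w ^ 2 / v / t := by
    have : t * v * u ^ 2 + w ^ 2 / v / t - 2 * (u * w) = (t * v * u - w) ^ 2 / (v * t) := by
      field_simp; ring
    have : 0 ≤ (t * v * u - w) ^ 2 / (v * t) := by positivity
    linarith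
  have h2 : (s + γ * r * χ) ^ 2 ≤ (1 + 1 / t) * s ^ 2 + (1 - t) * χ ^ 2 * v := by
    have e : (1 + 1 / t) * s ^ 2 + (1 + t) * (γ * r * χ) ^ 2 - (s + γ * r * χ) ^ 2
        = (s - t * (γ * r * χ)) ^ 2 / t := by field_simp; ring
    have e0 : 0 ≤ (s - t * (γ * r * χ)) ^ 2 / t := by positivity
    have e1 : (1 + t) * γ ^ 2 ≤ 1 - t := by rw [hγt]; nlinarith [mul_pos ht0 ht0]
    have e2 : (1 + t) * (γ * r * χ) ^ 2 ≤ (1 - t) * χ ^ 2 * v := by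
      calc (1 + t) * (γ * r * χ) ^ 2 = (1 + t) * γ ^ 2 * (χ ^ 2 * r ^ 2) := by ring
        _ ≤ (1 - t) * (χ ^ 2 * v) := by gcongr
        _ = _ := by ring
    linarith
  have h3 := sq_nonneg (χ * p + (s + γ * r * χ) * u)
  have h4 : (s + γ * r * χ) ^ 2 * u ^ 2
      ≤ ((1 + 1 / t) * s ^ 2 + (1 - t) * χ ^ 2 * v) * u ^ 2 := by gcongr
  have h5 : χ ^ 2 * (2 * (u * w)) ≤ χ ^ 2 * (t * v * u ^ 2 + w ^ 2 / v / t) := by gcongr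
  have h6 : χ ^ 2 * (w ^ 2 / v / t) ≤ w ^ 2 / v / t :=
    mul_le_of_le_one_left (by positivity) hχ2
  have h7 : t / 2 * (χ ^ 2 * v * u ^ 2) ≤
      (2 * χ * (s + γ * r * χ) * (u * p) + χ ^ 2 * (p * p + u * (v * u - w))) +
      (w ^ 2 / v / t / 2 + (1 + 1 / t) * (s ^ 2 * u ^ 2)) := by
    nlinarith
  calc χ ^ 2 * v * u ^ 2 = 2 / t * (t / 2 * (χ ^ 2 * v * u ^ 2)) := by field_simp
    _ ≤ 2 / t * ((2 * χ * (s + γ * r * χ) * (u * p) + χ ^ 2 * (p * p + u * (v * u - w))) +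
      (w ^ 2 / v / t / 2 + (1 + 1 / t) * (s ^ 2 * u ^ 2))) := by gcongr
    _ = 2 / t * (2 * χ * (s + γ * r * χ) * (u * p) + χ ^ 2 * (p * p + u * (v * u - w))) +
      (1 / t ^ 2 * (w ^ 2 / v) + (2 / t + 2 / t ^ 2) * (s ^ 2 * u ^ 2)) := by
        field_simp
    _ ≤ _ := by
      have : 1 / t ^ 2 ≤ 2 / t + 2 / t ^ 2 := by
        have a1 : 0 < 1 / t := by positivity
        have a2 : 0 < 1 / t ^ 2 := by positivity
        have a3 : 2 / t = 2 * (1 / t) := by ring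
        have a4 : 2 / t ^ 2 = 2 * (1 / t ^ 2) := by ring
        linarith
      have := mul_le_mul_of_nonneg_right this hz
      linarith

/-- If `A ≤ G' + B` almost everywhere on `(a, R)`, with `G` absolutely continuous, `G a = 0` and
`G R ≤ ε`, then `∫ A ≤ ε + ∫ B` in `[0, ∞]`. -/
lemma AbsolutelyContinuousOnInterval.lintegral_le_of_le_deriv_add {G A B : ℝ → ℝ} {a R ε : ℝ}
    (hG : AbsolutelyContinuousOnInterval G a R) (haR : a ≤ R) (hGa : G a = 0) (hGR : G R ≤ ε)
    (hA0 : ∀ x ∈ Ioo a R, 0 ≤ A x)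
    (hA : ∀ᵐ x ∂(volume.restrict (Ioo a R)), A x ≤ deriv G x + B x) :
    ∫⁻ x in Ioo a R, ENNReal.ofReal (A x) ≤
      ENNReal.ofReal ε + ∫⁻ x in Ioo a R, ENNReal.ofReal (B x) := by
  have hint : IntegrableOn (deriv G) (Ioo a R) :=
    ((intervalIntegrable_iff_integrableOn_Ioc_of_le haR).1 hG.intervalIntegrable_deriv).mono_set
      Ioo_subset_Ioc_self
  have hFTC : ∫ x in Ioo a R, deriv G x = G R := by
    rw [← integral_Ioc_eq_integral_Ioo, ← intervalIntegral.integral_of_le haR,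
      hG.integral_deriv_eq_sub, hGa, sub_zero]
  set P := ∫⁻ x in Ioo a R, ENNReal.ofReal (deriv G x) with hP
  set Q := ∫⁻ x in Ioo a R, ENNReal.ofReal (-deriv G x) with hQ
  have hPfin : P ≠ ⊤ := hint.lintegral_lt_top.ne
  have hQfin : Q ≠ ⊤ := hint.neg.lintegral_lt_top.ne
  have hPQ : P ≤ ENNReal.ofReal ε + Q := by
    have h := integral_eq_lintegral_pos_part_sub_lintegral_neg_part hint
    rw [hFTC] at h
    rw [← ENNReal.ofReal_toReal hPfin, ← ENNReal.ofReal_toReal hQfin]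
    refine (ENNReal.ofReal_le_ofReal (q := ε + Q.toReal) ?_).trans ENNReal.ofReal_add_le
    linarith
  have hm : Measurable (deriv G) := measurable_deriv G
  have hm' : Measurable fun x => -deriv G x := hm.neg
  have hAB : (∫⁻ x in Ioo a R, ENNReal.ofReal (A x)) + Q ≤
      P + ∫⁻ x in Ioo a R, ENNReal.ofReal (B x) := by
    rw [hP, hQ, ← lintegral_add_right _ hm'.ennreal_ofReal,
      ← lintegral_add_left hm.ennreal_ofReal]
    refine lintegral_mono_ae ?_
    filter_upwards [hA, ae_restrict_of_forall_mem measurableSet_Ioo hA0] with x hx hx0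
    rcases le_total 0 (deriv G x) with h | h
    · rw [ENNReal.ofReal_of_nonpos (neg_nonpos.2 h), add_zero]
      exact (ENNReal.ofReal_le_ofReal hx).trans ENNReal.ofReal_add_le
    · rw [ENNReal.ofReal_of_nonpos h, zero_add]
      have h0 : 0 ≤ -deriv G x := neg_nonneg.2 h
      rw [← ENNReal.ofReal_add hx0 h0]
      exact ENNReal.ofReal_le_ofReal (by linarith)
  refine (ENNReal.add_le_add_iff_right hQfin).1 (hAB.trans ?_)
  calc _ ≤ ENNReal.ofReal ε + Q + ∫⁻ x in Ioo a R, ENNReal.ofReal (B x) := by gcongr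
    _ = _ := by ring

/-- The derivative of the linear cutoff that rises from `0` at `a` to `1` at `b`. -/
lemma hasDerivAt_linearCutoff {a b x : ℝ} (hab : a < b) (hx : x ≠ b) :
    HasDerivAt (fun y => min ((y - a) / (b - a)) 1) (if x < b then 1 / (b - a) else 0) x := by
  have hba : 0 < b - a := sub_pos.2 hab
  rcases lt_or_gt_of_ne hx with h | h
  · rw [if_pos h]
    refine (((hasDerivAt_id x).sub_const a).div_const (b - a)).congr_of_eventuallyEq ?_
    filter_upwards [Iio_mem_nhds h] with y hy
    exact min_eq_left ((div_le_one hba).2 (by linarith [mem_Iio.1 hy]))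
  · rw [if_neg h.not_gt]
    refine (hasDerivAt_const x (1 : ℝ)).congr_of_eventuallyEq ?_
    filter_upwards [Ioi_mem_nhds h] with y hy
    exact min_eq_right ((one_le_div hba).2 (by linarith [mem_Ioi.1 hy]))

/-- The Agmon estimate on a bounded interval, for a weight that is bounded above. -/
lemma agmon_truncated {γ : ℝ} (hγ0 : 0 ≤ γ) (hγ1 : γ < 1) {V σ w u u' u'' : ℝ → ℝ}
    (hV : ContinuousOn V (Ioi 0)) {K : NNReal} (hσ : LipschitzOnWith K σ (Ioi 0)) {N : ℝ}
    (hσN : ∀ x, σ x ≤ N)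
    (hσV : ∀ᵐ x ∂(volume.restrict (Ioi 0)), ∀ d : ℝ, HasDerivAt σ d x → d ^ 2 ≤ max (V x) 0)
    (hw : ContinuousOn w (Ioi 0))
    (hu : ∀ x ∈ Ioi (0 : ℝ), HasDerivAt u (u' x) x)
    (hu' : ∀ x ∈ Ioi (0 : ℝ), HasDerivAt u' (u'' x) x)
    (hu'' : ContinuousOn u'' (Ioi 0))
    (heq : ∀ x ∈ Ioi (0 : ℝ), -u'' x + V x * u x = w x)
    {a b R δ : ℝ} (ha : 0 < a) (hab : a < b) (hbR : b ≤ R) (hVpos : ∀ x, a < x → 0 < V x)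
    (hδ0 : 0 ≤ δ) (hδ : u R * u' R ≤ δ) :
    (∫⁻ x in Ioc b R, ENNReal.ofReal (Real.exp (2 * γ * σ x) * V x * u x ^ 2)) ≤
      ENNReal.ofReal (2 / (1 - γ) * (Real.exp (2 * γ * N) * δ)) +
      ENNReal.ofReal (2 / (1 - γ) + 2 / (1 - γ) ^ 2) *
        ((∫⁻ x in Ioi a, ENNReal.ofReal (Real.exp (2 * γ * σ x) * w x ^ 2 / V x)) +
          (ENNReal.ofReal ((b - a) ^ 2))⁻¹ *
            ∫⁻ x in Ioo a b, ENNReal.ofReal (Real.exp (2 * γ * σ x) * u x ^ 2)) := by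
  have ht : 0 < 1 - γ := sub_pos.2 hγ1
  have hba : 0 < b - a := sub_pos.2 hab
  have haR : a ≤ R := hab.le.trans hbR
  set C := 2 / (1 - γ) + 2 / (1 - γ) ^ 2 with hC
  have hC0 : 0 ≤ C := by positivity
  set W : ℝ → ℝ := fun x => Real.exp (2 * γ * σ x) with hW
  have hW0 : ∀ x, 0 < W x := fun x => Real.exp_pos _
  set χ : ℝ → ℝ := fun x => min ((x - a) / (b - a)) 1 with hχ
  set s : ℝ → ℝ := fun x => if x < b then 1 / (b - a) else 0 with hs
  have hsub : uIcc a R ⊆ Ioi 0 := by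
    rw [uIcc_of_le haR]; exact fun x hx => ha.trans_le hx.1
  have hIoo : Ioo a R ⊆ Ioi 0 := fun x hx => ha.trans hx.1
  have hσac := (hσ.mono hsub).absolutelyContinuousOnInterval
  have hWac : AbsolutelyContinuousOnInterval W a R := by
    obtain ⟨L, hL⟩ := exists_lipschitzOnWith_exp_mul_Iic (k := 2 * γ) (by positivity) N
    exact (hL.comp (hσ.mono hsub) fun x _ => hσN x).absolutelyContinuousOnInterval
  have hχac : AbsolutelyContinuousOnInterval χ a R := by
    have h1 : LipschitzWith (1 / (b - a)).toNNReal fun x : ℝ => (x - a) / (b - a) := by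
      refine LipschitzWith.of_dist_le_mul fun x y => le_of_eq ?_
      rw [Real.coe_toNNReal _ (by positivity), Real.dist_eq, Real.dist_eq, ← sub_div,
        sub_sub_sub_cancel_right, abs_div, abs_of_pos hba]
      ring
    exact (h1.min_const 1).lipschitzOnWith.absolutelyContinuousOnInterval
  have hu'c : ContinuousOn u' (Ioi 0) := fun x hx => (hu' x hx).continuousAt.continuousWithinAt
  have huc : ContinuousOn u (Ioi 0) := fun x hx => (hu x hx).continuousAt.continuousWithinAt
  have huac := absolutelyContinuousOnInterval_of_hasDerivAt ha haR hu hu'c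
  have hu'ac := absolutelyContinuousOnInterval_of_hasDerivAt ha haR hu' hu''
  have hGac : AbsolutelyContinuousOnInterval
      (fun x => 2 / (1 - γ) * ((W x * (χ x * χ x)) * (u x * u' x))) a R :=
    ((hWac.fun_mul (hχac.fun_mul hχac)).fun_mul (huac.fun_mul hu'ac)).const_mul _
  set G : ℝ → ℝ := fun x => 2 / (1 - γ) * ((W x * (χ x * χ x)) * (u x * u' x)) with hG
  have hχ0 : ∀ x, a < x → 0 ≤ χ x := fun x hx =>
    le_min (div_nonneg (sub_nonneg.2 hx.le) hba.le) zero_le_one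
  have hχ1 : ∀ x, χ x ≤ 1 := fun x => min_le_right _ _
  have hχb : ∀ x, b ≤ x → χ x = 1 := fun x hx =>
    min_eq_right ((one_le_div hba).2 (by linarith))
  have hGa : G a = 0 := by simp [hG, hχ]
  have hGR : G R ≤ 2 / (1 - γ) * (Real.exp (2 * γ * N) * δ) := by
    simp only [hG, hχb R hbR, mul_one]
    have h1 : W R ≤ Real.exp (2 * γ * N) :=
      Real.exp_le_exp.2 (mul_le_mul_of_nonneg_left (hσN R) (by positivity))
    have h2 : W R * (u R * u' R) ≤ Real.exp (2 * γ * N) * δ :=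
      (mul_le_mul_of_nonneg_left hδ (hW0 R).le).trans (mul_le_mul_of_nonneg_right h1 hδ0)
    gcongr
  have hmain := hGac.lintegral_le_of_le_deriv_add (A := fun x => W x * (χ x ^ 2 * V x * u x ^ 2))
    (B := fun x => C * (W x * w x ^ 2 / V x) + C * (s x ^ 2 * (W x * u x ^ 2))) haR hGa hGR
    (fun x hx => by have := hVpos x hx.1; have := hW0 x; positivity) (by
      have hne : ∀ᵐ x ∂(volume.restrict (Ioo a R)), x ≠ b :=
        ae_restrict_of_ae (by simp [ae_iff, measure_singleton])
      filter_upwards [hne, ae_restrict_of_ae hσac.ae_differentiableAt,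
        ae_mono (Measure.restrict_mono_set volume hIoo) hσV,
        ae_restrict_mem measurableSet_Ioo] with x hxb hxσ hxV hx
      have hx0 : x ∈ Ioi (0 : ℝ) := hIoo hx
      have hVx := hVpos x hx.1
      have hσd := (hxσ (by rw [uIcc_of_le haR]; exact Ioo_subset_Icc_self hx)).hasDerivAt
      set r := deriv σ x
      have hr : r ^ 2 ≤ V x := (hxV r hσd).trans_eq (max_eq_left hVx.le)
      have hWd : HasDerivAt W (W x * (2 * γ * r)) x := (hσd.const_mul (2 * γ)).exp
      have hχd : HasDerivAt χ (s x) x := hasDerivAt_linearCutoff hab hxb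
      have hGd := ((hWd.mul (hχd.mul hχd)).mul ((hu x hx0).mul (hu' x hx0))).const_mul
        (2 / (1 - γ))
      have hu''x : u'' x = V x * u x - w x := by linarith [heq x hx0]
      have key := mul_le_mul_of_nonneg_left (agmon_pointwise (s := s x) (w := w x) (u := u x)
        (p := u' x) hγ0 hγ1 hVx hr (hχ0 x hx.1) (hχ1 x)) (hW0 x).le
      refine key.trans_eq ?_
      have hGd' : deriv G x = _ := HasDerivAt.deriv hGd
      rw [hGd', hu''x]
      simp only [Pi.mul_apply]
      ring)
  have hWc : ContinuousOn W (Ioi 0) := (hσ.continuousOn.const_mul (2 * γ)).rexp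
  have hBm : AEMeasurable (fun x => ENNReal.ofReal (C * (W x * w x ^ 2 / V x)))
      (volume.restrict (Ioo a R)) := by
    refine (ContinuousOn.aemeasurable ?_ measurableSet_Ioo).ennreal_ofReal
    exact (((hWc.mul (hw.pow 2)).mono hIoo).div (hV.mono hIoo)
      fun x hx => (hVpos x hx.1).ne').const_mul C
  calc ∫⁻ x in Ioc b R, ENNReal.ofReal (W x * V x * u x ^ 2)
      = ∫⁻ x in Ioo b R, ENNReal.ofReal (W x * (χ x ^ 2 * V x * u x ^ 2)) := by
        rw [← restrict_Ioo_eq_restrict_Ioc]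
        refine setLIntegral_congr_fun measurableSet_Ioo fun x hx => ?_
        simp only [hχb x hx.1.le]
        ring_nf
    _ ≤ ∫⁻ x in Ioo a R, ENNReal.ofReal (W x * (χ x ^ 2 * V x * u x ^ 2)) :=
        lintegral_mono_set (Ioo_subset_Ioo_left hab.le)
    _ ≤ _ := hmain
    _ ≤ _ := by
        gcongr
        calc ∫⁻ x in Ioo a R,
              ENNReal.ofReal (C * (W x * w x ^ 2 / V x) + C * (s x ^ 2 * (W x * u x ^ 2)))
            ≤ ∫⁻ x in Ioo a R, (ENNReal.ofReal (C * (W x * w x ^ 2 / V x)) +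
                ENNReal.ofReal (C * (s x ^ 2 * (W x * u x ^ 2)))) :=
              lintegral_mono fun x => ENNReal.ofReal_add_le
          _ = ENNReal.ofReal C * (∫⁻ x in Ioo a R, ENNReal.ofReal (W x * w x ^ 2 / V x)) +
              ENNReal.ofReal C * ∫⁻ x in Ioo a R, ENNReal.ofReal (s x ^ 2 * (W x * u x ^ 2)) := by
              rw [lintegral_add_left' hBm]
              simp only [ENNReal.ofReal_mul hC0]
              rw [lintegral_const_mul' _ _ ENNReal.ofReal_ne_top,
                lintegral_const_mul' _ _ ENNReal.ofReal_ne_top]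
          _ ≤ _ := by
              rw [mul_add]
              gcongr
              · exact Ioo_subset_Ioi_self
              · have hpt : ∀ x, ENNReal.ofReal (s x ^ 2 * (W x * u x ^ 2)) =
                    (Iio b).indicator (fun y => (ENNReal.ofReal ((b - a) ^ 2))⁻¹ *
                      ENNReal.ofReal (W y * u y ^ 2)) x := fun x => by
                  by_cases hx : x < b
                  · rw [indicator_of_mem (mem_Iio.2 hx), ENNReal.ofReal_mul (sq_nonneg _),
                      ← ENNReal.ofReal_inv_of_pos (by positivity)]
                    simp [hs, hx]
                  · simp [hs, hx]
                simp only [hpt]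
                rw [lintegral_indicator measurableSet_Iio,
                  Measure.restrict_restrict measurableSet_Iio,
                  lintegral_const_mul' _ _ (ENNReal.inv_ne_top.2 (by simp; positivity))]
                gcongr
                exact fun x hx => ⟨hx.2.1, hx.1⟩

/-- Agmon's general estimate.  Let `V : (0,∞) → ℝ` be continuous, `ρ : (0,∞) → ℝ` Lipschitz
with `ρ′(x)² ≤ max{V(x),0}` a.e., `w : (0,∞) → ℝ` continuous, and let `u ∈ C²((0,∞))` solve
`−u″ + Vu = w` with `limsup_{x→+∞}|u(x)| < ∞`.  Then for every `γ ∈ [0,1)` there is a constant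
`C = C(γ)` such that for all `0 < a < b` with `V > 0` on `(a,∞)`:
`∫_b^∞ e^{2γρ} V u² ≤ C ( ∫_a^∞ e^{2γρ} w²/V + (b−a)^{−2} ∫_a^b e^{2γρ} u² )`. -/
theorem agmon_general (γ : ℝ) (hγ0 : 0 ≤ γ) (hγ1 : γ < 1) :
    ∃ C : ℝ, 0 < C ∧
      ∀ V ρ w u u' u'' : ℝ → ℝ,
        ContinuousOn V (Ioi 0) →
        (∃ K : NNReal, LipschitzOnWith K ρ (Ioi 0)) →
        (∀ᵐ x ∂(volume.restrict (Ioi 0)), ∀ d : ℝ, HasDerivAt ρ d x → d ^ 2 ≤ max (V x) 0) →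
        ContinuousOn w (Ioi 0) →
        (∀ x ∈ Ioi (0 : ℝ), HasDerivAt u (u' x) x) →
        (∀ x ∈ Ioi (0 : ℝ), HasDerivAt u' (u'' x) x) →
        ContinuousOn u'' (Ioi 0) →
        (∀ x ∈ Ioi (0 : ℝ), -u'' x + V x * u x = w x) →
        (∃ M : ℝ, ∀ᶠ x in atTop, |u x| ≤ M) →
        ∀ a b : ℝ, 0 < a → a < b → (∀ x, a < x → 0 < V x) →
          (∫⁻ x in Ioi b, ENNReal.ofReal (Real.exp (2 * γ * ρ x) * V x * u x ^ 2)) ≤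
            ENNReal.ofReal C *
              ((∫⁻ x in Ioi a, ENNReal.ofReal (Real.exp (2 * γ * ρ x) * w x ^ 2 / V x)) +
                (ENNReal.ofReal ((b - a) ^ 2))⁻¹ *
                  ∫⁻ x in Ioo a b, ENNReal.ofReal (Real.exp (2 * γ * ρ x) * u x ^ 2)) := by
  have ht : 0 < 1 - γ := sub_pos.2 hγ1
  refine ⟨2 / (1 - γ) + 2 / (1 - γ) ^ 2, by positivity, ?_⟩
  intro V ρ w u u' u'' hV hρ hρV hw hu hu' hu'' heq hbd a b ha hab hVpos
  obtain ⟨K, hK⟩ := hρ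
  have hUnion : Ioi b = ⋃ n : ℕ, Ioc b (n : ℝ) := by
    ext x
    simp only [mem_Ioi, mem_iUnion, mem_Ioc, exists_and_left]
    exact ⟨fun h => ⟨h, exists_nat_ge x⟩, fun h => h.1⟩
  have hdir : Directed (· ⊆ ·) fun n : ℕ => Ioc b (n : ℝ) :=
    Monotone.directed_le fun m n hmn => Ioc_subset_Ioc_right (Nat.cast_le.2 hmn)
  rw [hUnion, setLIntegral_iUnion_of_directed _ hdir]
  refine iSup_le fun n => ?_
  have hb0 : 0 < b := ha.trans hab
  obtain ⟨N, hN⟩ := (isCompact_Icc (a := b) (b := (n : ℝ))).exists_bound_of_continuousOn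
    (hK.continuousOn.mono fun x hx => hb0.trans_le hx.1)
  set σ : ℝ → ℝ := fun x => min (ρ x) N with hσ
  have hσL : LipschitzOnWith (1 * K) σ (Ioi 0) :=
    (LipschitzWith.id.min_const N).comp_lipschitzOnWith hK
  have hσV : ∀ᵐ x ∂(volume.restrict (Ioi 0)), ∀ d : ℝ, HasDerivAt σ d x →
      d ^ 2 ≤ max (V x) 0 := by
    filter_upwards [hρV, ae_restrict_mem measurableSet_Ioi] with x hx hx0 d hd
    rcases hd.hasDerivAt_or_eq_zero_of_min
      (hK.continuousOn.continuousAt (Ioi_mem_nhds hx0)) with h | rfl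
    · exact hx d h
    · simp
  have hexp : ∀ x, Real.exp (2 * γ * σ x) ≤ Real.exp (2 * γ * ρ x) := fun x =>
    Real.exp_le_exp.2 (mul_le_mul_of_nonneg_left (min_le_left _ _) (by positivity))
  refine ENNReal.le_of_forall_pos_le_add fun ε hε _ => ?_
  set c := 2 / (1 - γ) * Real.exp (2 * γ * N)
  have hc : 0 < c := by positivity
  have hδ : 0 < (ε : ℝ) / c := div_pos hε hc
  obtain ⟨R, hR, hRδ⟩ := exists_ge_mul_deriv_le hu hbd hδ (max b n)
  have htrunc := agmon_truncated hγ0 hγ1 hV hσL (fun x => min_le_right _ _) hσV hw hu hu' hu''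
    heq ha hab ((le_max_left _ _).trans hR) hVpos hδ.le hRδ
  calc ∫⁻ x in Ioc b (n : ℝ), ENNReal.ofReal (Real.exp (2 * γ * ρ x) * V x * u x ^ 2)
      = ∫⁻ x in Ioc b (n : ℝ), ENNReal.ofReal (Real.exp (2 * γ * σ x) * V x * u x ^ 2) := by
        refine setLIntegral_congr_fun measurableSet_Ioc fun x hx => ?_
        have : σ x = ρ x := min_eq_left ((le_abs_self _).trans (hN x (Ioc_subset_Icc_self hx)))
        simp only [this]
    _ ≤ ∫⁻ x in Ioc b R, ENNReal.ofReal (Real.exp (2 * γ * σ x) * V x * u x ^ 2) :=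
        lintegral_mono_set (Ioc_subset_Ioc_right ((le_max_right _ _).trans hR))
    _ ≤ _ := htrunc
    _ ≤ _ := by
        rw [add_comm]
        have hcε : 2 / (1 - γ) * (Real.exp (2 * γ * N) * (ε / c)) = ε := by
          rw [← mul_assoc]
          exact mul_div_cancel₀ _ hc.ne'
        rw [hcε, ENNReal.ofReal_coe_nnreal]
        have hle : ∫⁻ x in Ioi a, ENNReal.ofReal (Real.exp (2 * γ * σ x) * w x ^ 2 / V x) ≤
            ∫⁻ x in Ioi a, ENNReal.ofReal (Real.exp (2 * γ * ρ x) * w x ^ 2 / V x) := by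
          refine setLIntegral_mono' measurableSet_Ioi fun x hx => ENNReal.ofReal_le_ofReal ?_
          have := (hVpos x hx).le
          have := hexp x
          gcongr
        gcongr
        exact min_le_left _ _
end

section
/- Under the setup, there exist constants C = C(κ,δ), c = c(κ) > 0 and C′ = C′(κ,δ) such that: (a) for every x > 0 with V(x) < E/2: u(x)² + u′(x)²/E ≤ C |{V<E}|^{−1} ∫_{{E/2<V<2E}} u²; (b) for every x > 0 with V(x) ≥ 4E: u(x)² + u′(x)²/E ≤ C′ |{V≤E}|^{−1} e^{−c x V(x)^{1/2}} ∫_{{E<V<2E}} u². -/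
open MeasureTheory Filter Set

/-- `V ∈ 𝓗𝒫₁(κ)`: `V` is positive and `C¹` on `(0,∞)` with derivative `V'`, and
`κ⁻¹V(x) ≤ xV′(x) ≤ κV(x)` for all `x > 0`. -/
def HP1 (κ : ℝ) (V V' : ℝ → ℝ) : Prop :=
  (∀ x ∈ Set.Ioi (0 : ℝ), 0 < V x) ∧
  (∀ x ∈ Set.Ioi (0 : ℝ), HasDerivAt V (V' x) x) ∧
  ContinuousOn V' (Set.Ioi 0) ∧
  (∀ x ∈ Set.Ioi (0 : ℝ), κ⁻¹ * V x ≤ x * V' x ∧ x * V' x ≤ κ * V x)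

namespace HP1

variable {κ : ℝ} {V V' : ℝ → ℝ}

lemma strictMonoOn (h : HP1 κ V V') (hκ : 1 ≤ κ) : StrictMonoOn V (Ioi 0) := by
  obtain ⟨hpos, hd, -, hb⟩ := h
  refine strictMonoOn_of_deriv_pos (convex_Ioi 0)
    (fun x hx => (hd x hx).continuousAt.continuousWithinAt) fun x hx => ?_
  rw [interior_Ioi] at hx
  rw [(hd x hx).deriv]
  have h1 : 0 < κ⁻¹ * V x := mul_pos (inv_pos.2 (by linarith)) (hpos x hx)
  exact pos_of_mul_pos_right (h1.trans_le (hb x hx).1) (le_of_lt hx)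

/-- The growth of `V` over `[p, q]` is controlled on both sides by the relative length. -/
lemma growth (h : HP1 κ V V') (hκ : 1 ≤ κ) {p q : ℝ} (hp : 0 < p) (hpq : p < q) :
    (q - p) * V p ≤ κ * q * (V q - V p) ∧ p * (V q - V p) ≤ κ * (q - p) * V q := by
  have hmono := (h.strictMonoOn hκ).monotoneOn
  obtain ⟨hpos, hd, -, hb⟩ := h
  obtain ⟨t, ht, hslope⟩ := exists_hasDerivAt_eq_slope V V' hpq
    (fun x hx => (hd x (hp.trans_le hx.1)).continuousAt.continuousWithinAt)
    (fun x hx => hd x (hp.trans hx.1))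
  have ht0 : 0 < t := hp.trans ht.1
  have hq0 : 0 < q := hp.trans hpq
  have hκ0 : 0 < κ := by linarith
  have hlen : 0 < q - p := sub_pos.2 hpq
  have hV : V q - V p = V' t * (q - p) := by rw [hslope]; field_simp
  obtain ⟨hlow, hupp⟩ := hb t ht0
  have hlow' : V t ≤ κ * (t * V' t) := by
    have := mul_le_mul_of_nonneg_left hlow hκ0.le
    rwa [← mul_assoc, mul_inv_cancel₀ hκ0.ne', one_mul] at this
  have hVt : 0 < V t := hpos t ht0
  have hV't : 0 ≤ V' t := by
    have h1 : 0 < κ⁻¹ * V t := mul_pos (inv_pos.2 hκ0) hVt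
    exact (pos_of_mul_pos_right (h1.trans_le hlow) ht0.le).le
  have hpt : V p ≤ V t := hmono hp ht0 ht.1.le
  have htq : V t ≤ V q := hmono ht0 hq0 ht.2.le
  have htq' : t * V' t ≤ q * V' t := mul_le_mul_of_nonneg_right ht.2.le hV't
  have hpt' : p * V' t ≤ t * V' t := mul_le_mul_of_nonneg_right ht.1.le hV't
  rw [hV]
  constructor
  · have : V p ≤ κ * (q * V' t) :=
      (hpt.trans hlow').trans (mul_le_mul_of_nonneg_left htq' hκ0.le)
    nlinarith
  · have : p * V' t ≤ κ * V q :=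
      (hpt'.trans hupp).trans (mul_le_mul_of_nonneg_left htq hκ0.le)
    nlinarith

lemma shrink_le (h : HP1 κ V V') (hκ : 1 ≤ κ) {x : ℝ} (hx : 0 < x) :
    6 / 7 * V x ≤ V ((1 - 1 / (8 * κ)) * x) := by
  have hκ0 : 0 < κ := by linarith
  have he : 0 < 1 / (8 * κ) := by positivity
  have heκ : κ * (1 / (8 * κ)) = 1 / 8 := by field_simp
  set e := 1 / (8 * κ)
  have he8 : e ≤ 1 / 8 := by nlinarith
  have hVx := h.1 x hx
  have hg := (h.growth hκ (p := (1 - e) * x) (q := x) (by nlinarith) (by nlinarith)).2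
  have h1 : κ * (x - (1 - e) * x) * V x = x * (1 / 8 * V x) := by
    linear_combination x * V x * heκ
  rw [h1, mul_comm (1 - e), mul_assoc] at hg
  have h2 := le_of_mul_le_mul_left hg hx
  rcases le_or_gt (V x - V (x * (1 - e))) 0 with h3 | h3
  · rw [mul_comm (1 - e)]; linarith
  · rw [mul_comm (1 - e)]; nlinarith

/-- The threshold point `R` with `V R = E`, given that the sublevel set has finite positive
measure. -/
lemma exists_eq (h : HP1 κ V V') (hκ : 1 ≤ κ) {E : ℝ}
    (hvol : 0 < (volume {x : ℝ | 0 < x ∧ V x ≤ E}).toReal) : ∃ R, 0 < R ∧ V R = E := by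
  obtain ⟨hne, hfin⟩ := ENNReal.toReal_pos_iff.1 hvol
  obtain ⟨p, hp0, hp⟩ := nonempty_of_measure_ne_zero hne.ne'
  have hq : ∃ q, 0 < q ∧ E < V q := by
    by_contra! hcon
    have hset : {x : ℝ | 0 < x ∧ V x ≤ E} = Ioi 0 := by
      ext x
      exact ⟨fun hx => hx.1, fun hx => ⟨hx, hcon x hx⟩⟩
    rw [hset, Real.volume_Ioi] at hfin
    exact lt_irrefl _ hfin
  obtain ⟨q, hq0, hq⟩ := hq
  have hpq : p < q := ((h.strictMonoOn hκ).lt_iff_lt hp0 hq0).1 (hp.trans_lt hq)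
  obtain ⟨R, hR, hRE⟩ := intermediate_value_Icc hpq.le
    (fun x hx => (h.2.1 x (lt_of_lt_of_le hp0 hx.1)).continuousAt.continuousWithinAt)
    (show E ∈ Icc (V p) (V q) from ⟨hp, hq.le⟩)
  exact ⟨R, lt_of_lt_of_le hp0 hR.1, hRE⟩

end HP1

lemma monotoneOn_of_hasDerivAt {f f' : ℝ → ℝ} {s : Set ℝ} (hs : Convex ℝ s)
    (hd : ∀ x ∈ s, HasDerivAt f (f' x) x) (h0 : ∀ x ∈ s, 0 ≤ f' x) : MonotoneOn f s :=
  monotoneOn_of_deriv_nonneg hs (fun x hx => (hd x hx).continuousAt.continuousWithinAt)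
    (fun x hx => (hd x (interior_subset hx)).differentiableAt.differentiableWithinAt)
    fun x hx => by
      rw [(hd x (interior_subset hx)).deriv]
      exact h0 x (interior_subset hx)

lemma antitoneOn_of_hasDerivAt {f f' : ℝ → ℝ} {s : Set ℝ} (hs : Convex ℝ s)
    (hd : ∀ x ∈ s, HasDerivAt f (f' x) x) (h0 : ∀ x ∈ s, f' x ≤ 0) : AntitoneOn f s :=
  antitoneOn_of_deriv_nonpos hs (fun x hx => (hd x hx).continuousAt.continuousWithinAt)
    (fun x hx => (hd x (interior_subset hx)).differentiableAt.differentiableWithinAt)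
    fun x hx => by
      rw [(hd x (interior_subset hx)).deriv]
      exact h0 x (interior_subset hx)

lemma not_integrableOn_Ioi_of_le {f : ℝ → ℝ} {a c : ℝ} (hc : 0 < c)
    (hf : ∀ x ∈ Ioi a, c ≤ f x) : ¬ IntegrableOn f (Ioi a) := by
  intro hint
  have hconst : IntegrableOn (fun _ : ℝ => c) (Ioi a) := by
    refine Integrable.mono' hint aestronglyMeasurable_const ?_
    filter_upwards [ae_restrict_mem measurableSet_Ioi] with x hx
    rw [Real.norm_eq_abs, abs_of_pos hc]
    exact hf x hx
  rw [integrableOn_const_iff] at hconst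
  rcases hconst with h | h
  · simp [hc.ne'] at h
  · simp at h

section Decay

variable {w w' w'' : ℝ → ℝ} {a : ℝ}

/-- An integrable nonnegative function with nondecreasing derivative has nonpositive derivative. -/
lemma deriv_nonpos_of_convex_of_integrableOn
    (hd : ∀ x ∈ Ici a, HasDerivAt w (w' x) x) (hd' : ∀ x ∈ Ici a, HasDerivAt w' (w'' x) x)
    (h'' : ∀ x ∈ Ici a, 0 ≤ w'' x) (hw : ∀ x ∈ Ici a, 0 ≤ w x) (hint : IntegrableOn w (Ioi a)) :
    ∀ x ∈ Ici a, w' x ≤ 0 := by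
  intro x hx
  by_contra! hpos
  have hmono' := monotoneOn_of_hasDerivAt (convex_Ici a) hd' h''
  have hsub : Ici x ⊆ Ici a := Ici_subset_Ici.2 hx
  have hlin : MonotoneOn (fun t => w t - w' x * t) (Ici x) := by
    refine monotoneOn_of_hasDerivAt (f' := fun t => w' t - w' x * 1) (convex_Ici x)
      (fun t ht => (hd t (hsub ht)).sub ((hasDerivAt_id t).const_mul _)) fun t ht => ?_
    have := hmono' hx (hsub ht) ht
    simp only [mul_one]; linarith
  refine not_integrableOn_Ioi_of_le (a := x + 1) hpos (fun t ht => ?_)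
    (hint.mono_set (Ioi_subset_Ioi (show a ≤ x + 1 from le_trans hx (by linarith))))
  have ht' : x + 1 < t := ht
  have h1 := hlin self_mem_Ici (show t ∈ Ici x from by simp only [mem_Ici]; linarith) (by linarith)
  simp only at h1
  have h2 := hw x hx
  nlinarith

/-- Exponential decay from the differential inequality `k² w ≤ w''`. -/
lemma le_mul_exp_of_sq_mul_le {k : ℝ} (hk : 0 < k)
    (hd : ∀ x ∈ Ici a, HasDerivAt w (w' x) x) (hd' : ∀ x ∈ Ici a, HasDerivAt w' (w'' x) x)
    (h'' : ∀ x ∈ Ici a, k ^ 2 * w x ≤ w'' x) (hw : ∀ x ∈ Ici a, 0 ≤ w x)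
    (hint : IntegrableOn w (Ioi a)) {x : ℝ} (hx : a ≤ x) :
    w x ≤ w a * Real.exp (-(k * (x - a))) := by
  have hneg := deriv_nonpos_of_convex_of_integrableOn hd hd'
    (fun x hx => (mul_nonneg (sq_nonneg k) (hw x hx)).trans (h'' x hx)) hw hint
  have hexp : ∀ c t : ℝ, HasDerivAt (fun s => Real.exp (c * s)) (Real.exp (c * t) * (c * 1)) t :=
    fun c t => ((hasDerivAt_id t).const_mul c).exp
  have hmono : MonotoneOn (fun t => (w' t + k * w t) * Real.exp (-k * t)) (Ici a) := by
    refine monotoneOn_of_hasDerivAt (convex_Ici a)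
      (fun t ht => ((hd' t ht).add ((hd t ht).const_mul k)).mul (hexp (-k) t)) fun t ht => ?_
    have h1 : 0 ≤ (w'' t - k ^ 2 * w t) * Real.exp (-k * t) :=
      mul_nonneg (sub_nonneg.2 (h'' t ht)) (Real.exp_pos _).le
    simp only [Pi.add_apply]
    linarith
  have hle : ∀ t ∈ Ici a, w' t + k * w t ≤ 0 := by
    intro t ht
    by_contra! hpos
    refine not_integrableOn_Ioi_of_le (a := t) (c := (w' t + k * w t) / k) (by positivity)
      (fun s hs => ?_) (hint.mono_set (Ioi_subset_Ioi ht))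
    have hsa : s ∈ Ici a := mem_Ici.2 (le_trans (mem_Ici.1 ht) (le_of_lt (mem_Ioi.1 hs)))
    have h1 := hmono ht hsa (le_of_lt hs)
    simp only at h1
    have h2 : Real.exp (-k * s) ≤ Real.exp (-k * t) := by
      apply Real.exp_le_exp.2
      have : t < s := hs
      nlinarith
    have h3 : (w' t + k * w t) * Real.exp (-k * t) ≤ k * w s * Real.exp (-k * t) := by
      refine h1.trans ?_
      have hs0 := hneg s hsa
      have hws : 0 ≤ k * w s := mul_nonneg hk.le (hw s hsa)
      calc (w' s + k * w s) * Real.exp (-k * s) ≤ k * w s * Real.exp (-k * s) :=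
            mul_le_mul_of_nonneg_right (by linarith) (Real.exp_pos _).le
        _ ≤ _ := mul_le_mul_of_nonneg_left h2 hws
    rw [div_le_iff₀ hk]
    have := le_of_mul_le_mul_right h3 (Real.exp_pos _)
    linarith
  have hanti : AntitoneOn (fun t => w t * Real.exp (k * t)) (Ici a) := by
    refine antitoneOn_of_hasDerivAt (convex_Ici a)
      (fun t ht => (hd t ht).mul (hexp k t)) fun t ht => ?_
    have h1 : (w' t + k * w t) * Real.exp (k * t) ≤ 0 :=
      mul_nonpos_of_nonpos_of_nonneg (hle t ht) (Real.exp_pos _).le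
    linarith
  have h1 := hanti self_mem_Ici hx hx
  simp only at h1
  have h2 : Real.exp (-(k * (x - a))) = Real.exp (k * a) / Real.exp (k * x) := by
    rw [← Real.exp_sub]; ring_nf
  rw [h2, ← mul_div_assoc, le_div_iff₀ (Real.exp_pos _)]
  exact h1

end Decay

lemma sub_le_setIntegral_of_hasDerivAt_le {F F' g : ℝ → ℝ} {a b : ℝ} (hab : a ≤ b)
    (hF : ∀ x ∈ Icc a b, HasDerivAt F (F' x) x) (hg : IntegrableOn g (Icc a b))
    (hle : ∀ x ∈ Icc a b, F' x ≤ g x) : F b - F a ≤ ∫ t in Ioo a b, g t := by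
  have h := intervalIntegral.sub_le_integral_of_hasDeriv_right_of_le hab
    (fun x hx => (hF x hx).continuousAt.continuousWithinAt)
    (fun x hx => (hF x (Ioo_subset_Icc_self hx)).hasDerivWithinAt) hg
    (fun x hx => hle x (Ioo_subset_Icc_self hx))
  rwa [intervalIntegral.integral_of_le hab, integral_Ioc_eq_integral_Ioo] at h

section Schrodinger

variable {κ E δ R : ℝ} {V V' u u' : ℝ → ℝ}

lemma hasDerivAt_sq {x : ℝ} (hu : HasDerivAt u (u' x) x) :
    HasDerivAt (fun t => u t ^ 2) (2 * (u x * u' x)) x := by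
  refine (hu.fun_pow 2).congr_deriv ?_
  norm_num
  ring

/-- Monotonicity of `u² + u'² / (E - V)` below the threshold, in the form needed later. -/
lemma energy_le (hκ : 1 ≤ κ) (hV : HP1 κ V V') (hR : 0 < R) (hVR : V R = E)
    (hu : ∀ x ∈ Ioi (0 : ℝ), HasDerivAt u (u' x) x)
    (hu' : ∀ x ∈ Ioi (0 : ℝ), HasDerivAt u' ((V x - E) * u x) x)
    {x t : ℝ} (hx : 0 < x) (hxt : x ≤ t) (htR : t < R) :
    u x ^ 2 + u' x ^ 2 / E ≤ u t ^ 2 + u' t ^ 2 / (E - V t) := by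
  have hlt : ∀ s ∈ Ioo 0 R, 0 < E - V s := fun s hs =>
    sub_pos.2 (hVR ▸ hV.strictMonoOn hκ hs.1 hR hs.2)
  have hmono : MonotoneOn (fun s => u s ^ 2 + u' s ^ 2 / (E - V s)) (Ioo 0 R) := by
    refine monotoneOn_of_hasDerivAt (f' := fun s => u' s ^ 2 * V' s / (E - V s) ^ 2)
      (convex_Ioo 0 R) (fun s hs => ?_) fun s hs => ?_
    · have hne := (hlt s hs).ne'
      refine ((hasDerivAt_sq (hu s hs.1)).fun_add (((hu' s hs.1).fun_pow 2).fun_div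
        ((hV.2.1 s hs.1).const_sub E) hne)).congr_deriv ?_
      field_simp
      ring
    · have hb := (hV.2.2.2 s hs.1).1
      have h1 : 0 < κ⁻¹ * V s := mul_pos (inv_pos.2 (by linarith)) (hV.1 s hs.1)
      have h2 : 0 ≤ V' s := (pos_of_mul_pos_right (h1.trans_le hb) hs.1.le).le
      positivity
  have hxR : x ∈ Ioo 0 R := ⟨hx, hxt.trans_lt htR⟩
  refine le_trans ?_ (hmono hxR ⟨hx.trans_le hxt, htR⟩ hxt)
  have := hlt x hxR
  have := hV.1 x hx
  simp only
  gcongr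
  linarith

/-- A Caccioppoli-type bound: if a constant is dominated on `[a, b]` by `u² + M u'² / E`, then it
is dominated by the mean of `u²`. -/
lemma caccioppoli {a b M P : ℝ} (hab : a < b) (ha : 0 < a) (hE : 0 < E) (hM : 0 ≤ M)
    (hu : ∀ x ∈ Ioi (0 : ℝ), HasDerivAt u (u' x) x)
    (hu' : ∀ x ∈ Ioi (0 : ℝ), HasDerivAt u' ((V x - E) * u x) x)
    (hV : ∀ x ∈ Ioi (0 : ℝ), 0 < V x)
    (hint : IntegrableOn (fun x => u x ^ 2) (Ioi 0))
    (hP : ∀ t ∈ Icc a b, P ≤ u t ^ 2 + M * u' t ^ 2 / E) :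
    P * (b - a) ^ 5 / 30 ≤
      ((1 + 2 * M) * (b - a) ^ 4 + 4 * M * (b - a) ^ 2 / E) * ∫ t in Ioo a b, u t ^ 2 := by
  set h := b - a with hh
  have hh0 : 0 < h := sub_pos.2 hab
  have hpos : ∀ t ∈ Icc a b, t ∈ Ioi (0 : ℝ) := fun t ht => ha.trans_le ht.1
  let η : ℝ → ℝ := fun t => (t - a) * (b - t)
  let η' : ℝ → ℝ := fun t => a + b - 2 * t
  have hη : ∀ t, HasDerivAt η (η' t) t := fun t => by
    refine (((hasDerivAt_id t).sub_const a).fun_mul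
      ((hasDerivAt_id t).const_sub b)).congr_deriv ?_
    simp only [η', id]; ring
  let F : ℝ → ℝ := fun t =>
    P * (h ^ 2 * (t - a) ^ 3 / 3 - h * (t - a) ^ 4 / 2 + (t - a) ^ 5 / 5) -
      2 * M / E * (η t ^ 2 * (u t * u' t))
  let F' : ℝ → ℝ := fun t => P * η t ^ 2 - 2 * M / E *
    (2 * (η t * η' t) * (u t * u' t) + η t ^ 2 * (u' t * u' t + u t * ((V t - E) * u t)))
  have hF : ∀ t ∈ Icc a b, HasDerivAt F (F' t) t := fun t ht => by
    have hA : HasDerivAt (fun t => h ^ 2 * (t - a) ^ 3 / 3 - h * (t - a) ^ 4 / 2 + (t - a) ^ 5 / 5)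
        (η t ^ 2) t := by
      have hs : HasDerivAt (fun t : ℝ => t - a) 1 t := (hasDerivAt_id t).sub_const a
      refine (((((hs.fun_pow 3).const_mul (h ^ 2)).div_const 3).fun_sub
        (((hs.fun_pow 4).const_mul h).div_const 2)).fun_add ((hs.fun_pow 5).div_const 5)).congr_deriv ?_
      simp only [η, hh]
      push_cast
      ring
    exact (hA.const_mul P).sub (((hasDerivAt_sq (u := η) (u' := η') (hη t)).mul
      ((hu t (hpos t ht)).mul (hu' t (hpos t ht)))).const_mul (2 * M / E))
  have hle : ∀ t ∈ Icc a b,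
      F' t ≤ ((1 + 2 * M) * h ^ 4 + 4 * M * h ^ 2 / E) * u t ^ 2 := fun t ht => by
    have hVt := hV t (hpos t ht)
    have hη0 : 0 ≤ η t := mul_nonneg (sub_nonneg.2 ht.1) (sub_nonneg.2 ht.2)
    have hηh : η t ≤ h ^ 2 := by
      rw [pow_two]
      exact mul_le_mul (by linarith [ht.2]) (by linarith [ht.1]) (sub_nonneg.2 ht.2) hh0.le
    have hη2 : η t ^ 2 ≤ h ^ 4 := by
      calc η t ^ 2 ≤ (h ^ 2) ^ 2 := pow_le_pow_left₀ hη0 hηh 2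
        _ = h ^ 4 := by ring
    have hη'2 : η' t ^ 2 ≤ h ^ 2 := by
      apply sq_le_sq'
      · simp only [η']; linarith [ht.2]
      · simp only [η']; linarith [ht.1]
    have hG : η t ^ 2 * u' t ^ 2 / 2 - 2 * (η' t ^ 2 * u t ^ 2) - E * (η t ^ 2 * u t ^ 2) ≤
        2 * (η t * η' t) * (u t * u' t) +
          η t ^ 2 * (u' t * u' t + u t * ((V t - E) * u t)) := by
      have h1 := sq_nonneg (η t * u' t + 2 * (η' t * u t))
      have h2 : 0 ≤ V t * (η t ^ 2 * u t ^ 2) := by positivity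
      linarith
    have hG' := mul_le_mul_of_nonneg_left hG (show 0 ≤ 2 * M / E by positivity)
    have hPt := mul_le_mul_of_nonneg_right (hP t ht) (sq_nonneg (η t))
    have hsum : F' t ≤ (1 + 2 * M) * (η t ^ 2 * u t ^ 2) + 4 * M / E * (η' t ^ 2 * u t ^ 2) := by
      calc F' t ≤ (u t ^ 2 + M * u' t ^ 2 / E) * η t ^ 2 - 2 * M / E *
            (η t ^ 2 * u' t ^ 2 / 2 - 2 * (η' t ^ 2 * u t ^ 2) - E * (η t ^ 2 * u t ^ 2)) := by
            simp only [F']; linarith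
        _ = _ := by field_simp; ring
    calc F' t ≤ _ := hsum
      _ ≤ (1 + 2 * M) * (h ^ 4 * u t ^ 2) + 4 * M / E * (h ^ 2 * u t ^ 2) := by gcongr
      _ = _ := by ring
  have hfin := sub_le_setIntegral_of_hasDerivAt_le hab.le hF
    ((hint.mono_set hpos).const_mul _) hle
  rw [integral_const_mul] at hfin
  refine le_trans (le_of_eq ?_) hfin
  simp only [F, η, ← hh]
  ring

/-- Above the threshold, `u'²` is controlled by `u²` at an earlier point. -/
lemma deriv_sq_le {p q : ℝ} (hp : 0 < p) (hpq : p < q)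
    (hu : ∀ x ∈ Ioi (0 : ℝ), HasDerivAt u (u' x) x)
    (hu' : ∀ x ∈ Ioi (0 : ℝ), HasDerivAt u' ((V x - E) * u x) x)
    (hV : ∀ x ∈ Ici p, E ≤ V x) (huu' : ∀ x ∈ Ici p, u x * u' x ≤ 0) :
    u' q ^ 2 * (q - p) ^ 2 ≤ u p ^ 2 := by
  have hpos : ∀ x ∈ Ici p, x ∈ Ioi (0 : ℝ) := fun x hx => hp.trans_le hx
  have hanti : AntitoneOn (fun x => u' x ^ 2) (Ici p) := by
    refine antitoneOn_of_hasDerivAt (convex_Ici p)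
      (fun x hx => (hu' x (hpos x hx)).pow 2) fun x hx => ?_
    have := mul_nonpos_of_nonneg_of_nonpos (sub_nonneg.2 (hV x hx)) (huu' x hx)
    norm_num
    linarith
  have hmono : MonotoneOn (fun x => u x * u' x - u' q ^ 2 * x) (Icc p q) := by
    refine monotoneOn_of_hasDerivAt (convex_Icc p q)
      (fun x hx => ((hu x (hpos x hx.1)).mul (hu' x (hpos x hx.1))).sub
        ((hasDerivAt_id x).const_mul _)) fun x hx => ?_
    have h1 := hanti (show x ∈ Ici p from hx.1) (show q ∈ Ici p from hpq.le) hx.2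
    have h2 := mul_nonneg (sub_nonneg.2 (hV x hx.1)) (sq_nonneg (u x))
    simp only at h1
    linarith
  have hanti2 : AntitoneOn (fun x => u x ^ 2 - u' q ^ 2 * (x - q) ^ 2) (Icc p q) := by
    refine antitoneOn_of_hasDerivAt (convex_Icc p q)
      (fun x hx => (hasDerivAt_sq (hu x (hpos x hx.1))).sub
        ((((hasDerivAt_id x).sub_const q).pow 2).const_mul _)) fun x hx => ?_
    have h1 := hmono hx (right_mem_Icc.2 hpq.le) hx.2
    have h2 := huu' q hpq.le
    simp only at h1
    simp only [id]
    norm_num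
    linarith
  have h1 := hanti2 (left_mem_Icc.2 hpq.le) (right_mem_Icc.2 hpq.le) hpq.le
  simp only at h1
  have h2 := sq_nonneg (u q)
  linarith

lemma setIntegral_sq_mono {s t : Set ℝ} (hint : IntegrableOn (fun x => u x ^ 2) (Ioi 0))
    (hst : s ⊆ t) (ht : t ⊆ Ioi 0) : ∫ x in s, u x ^ 2 ≤ ∫ x in t, u x ^ 2 :=
  setIntegral_mono_set (hint.mono_set ht) (Eventually.of_forall fun _ => sq_nonneg _)
    (Eventually.of_forall hst)

lemma bound_below (hκ : 1 ≤ κ) (hV : HP1 κ V V') (hE : 0 < E) (hδ : 0 < δ) (hR : 0 < R)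
    (hVR : V R = E) (hδR : δ ^ 2 ≤ E * R ^ 2)
    (hu : ∀ x ∈ Ioi (0 : ℝ), HasDerivAt u (u' x) x)
    (hu' : ∀ x ∈ Ioi (0 : ℝ), HasDerivAt u' ((V x - E) * u x) x)
    (hint : IntegrableOn (fun x => u x ^ 2) (Ioi 0)) {x : ℝ} (hx : 0 < x) (hxE : V x < E / 2) :
    u x ^ 2 + u' x ^ 2 / E ≤
      30 * (1 + 2 * (9 * κ ^ 2) + 4 * (9 * κ ^ 2) * (100 * κ ^ 2 / δ ^ 2)) * (10 * κ) * R⁻¹ *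
        ∫ t in {y : ℝ | 0 < y ∧ E / 2 < V y ∧ V y < 2 * E}, u t ^ 2 := by
  have hκ0 : 0 < κ := by linarith
  have hsm := hV.strictMonoOn hκ
  have he : 0 < 1 / (8 * κ) := by positivity
  have heκ : 1 / (8 * κ) * κ = 1 / 8 := by field_simp
  have hVb := hV.shrink_le hκ hR
  have hgb := hV.growth hκ (p := (1 - 1 / (8 * κ)) * R) (q := R)
  have hVa := hV.shrink_le hκ (x := (1 - 1 / (8 * κ)) * R)
  set e := 1 / (8 * κ)
  have he8 : e ≤ 1 / 8 := by nlinarith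
  set b := (1 - e) * R
  set a := (1 - e) * b
  have hb0 : 0 < b := mul_pos (by linarith) hR
  have ha0 : 0 < a := mul_pos (by linarith) hb0
  have hab : a < b := by simp only [a]; nlinarith
  have hbR : b < R := by simp only [b]; nlinarith
  replace hVa := hVa hb0
  replace hgb := (hgb hb0 hbR).1
  have hVaE : E / 2 < V a := by rw [hVR] at hVb; linarith
  have hVbE : V b < E := hVR ▸ hsm hb0 hR hbR
  have hxa : x < a := (hsm.lt_iff_lt hx ha0).1 (hxE.trans hVaE)
  have hgap : E ≤ 9 * κ ^ 2 * (E - V b) := by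
    have h1 : (R - b) * V b = R * (e * V b) := by simp only [b]; ring
    rw [h1, hVR, show κ * R * (E - V b) = R * (κ * (E - V b)) by ring] at hgb
    have h2 := mul_le_mul_of_nonneg_left (le_of_mul_le_mul_left hgb hR) hκ0.le
    rw [← mul_assoc, mul_comm κ e, heκ] at h2
    have h3 : 1 * (E - V b) ≤ κ ^ 2 * (E - V b) :=
      mul_le_mul_of_nonneg_right (by nlinarith) (by linarith)
    nlinarith
  have hP : ∀ t ∈ Icc a b, u x ^ 2 + u' x ^ 2 / E ≤ u t ^ 2 + 9 * κ ^ 2 * u' t ^ 2 / E := by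
    intro t ht
    have ht0 : 0 < t := ha0.trans_le ht.1
    refine (energy_le hκ hV hR hVR hu hu' hx (hxa.le.trans ht.1) (ht.2.trans_lt hbR)).trans ?_
    have hVt : V t ≤ V b := hsm.monotoneOn ht0 hb0 ht.2
    refine add_le_add le_rfl ?_
    rw [div_le_div_iff₀ (by linarith) hE]
    have h1 : E ≤ 9 * κ ^ 2 * (E - V t) :=
      hgap.trans (mul_le_mul_of_nonneg_left (by linarith) (by positivity))
    nlinarith [mul_le_mul_of_nonneg_left h1 (sq_nonneg (u' t))]
  have hc := caccioppoli hab ha0 hE (by positivity : (0 : ℝ) ≤ 9 * κ ^ 2) hu hu' hV.1 hint hP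
  have hh : R / (10 * κ) ≤ b - a := by
    rw [div_le_iff₀ (by positivity)]
    have h1 : (b - a) * (10 * κ) = 10 / 8 * b := by
      simp only [a]; linear_combination 10 * b * heκ
    rw [h1]
    simp only [b]; nlinarith
  have hI0 : 0 ≤ ∫ t in Ioo a b, u t ^ 2 := integral_nonneg fun _ => sq_nonneg _
  have hI : ∫ t in Ioo a b, u t ^ 2 ≤
      ∫ t in {y : ℝ | 0 < y ∧ E / 2 < V y ∧ V y < 2 * E}, u t ^ 2 := by
    refine setIntegral_sq_mono hint (fun t ht => ?_) fun t ht => ht.1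
    have ht0 : 0 < t := ha0.trans ht.1
    exact ⟨ht0, hVaE.trans (hsm ha0 ht0 ht.1), by linarith [hsm ht0 hb0 ht.2]⟩
  set I := ∫ t in Ioo a b, u t ^ 2
  set h := b - a
  have hh0 : 0 < h := sub_pos.2 hab
  have hEh : 1 / (E * h ^ 2) ≤ 100 * κ ^ 2 / δ ^ 2 := by
    rw [div_le_div_iff₀ (by positivity) (by positivity), one_mul]
    rw [div_le_iff₀ (by positivity)] at hh
    calc δ ^ 2 ≤ E * R ^ 2 := hδR
      _ ≤ E * (h * (10 * κ)) ^ 2 := by gcongr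
      _ = _ := by ring
  have hinv : 1 / h ≤ 10 * κ * R⁻¹ := by
    rw [div_le_iff₀ hh0]
    rw [div_le_iff₀ (by positivity)] at hh
    calc (1 : ℝ) = R * R⁻¹ := (mul_inv_cancel₀ hR.ne').symm
      _ ≤ (h * (10 * κ)) * R⁻¹ := by gcongr
      _ = _ := by ring
  calc u x ^ 2 + u' x ^ 2 / E
      ≤ 30 * (1 + 2 * (9 * κ ^ 2) + 4 * (9 * κ ^ 2) * (1 / (E * h ^ 2))) * (1 / h) * I := by
        have h5 : (u x ^ 2 + u' x ^ 2 / E) * h ^ 5 / 30 ≤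
          (30 * (1 + 2 * (9 * κ ^ 2) + 4 * (9 * κ ^ 2) * (1 / (E * h ^ 2))) * (1 / h) * I) *
            h ^ 5 / 30 := by
          refine hc.trans (le_of_eq ?_)
          field_simp
        rw [div_le_div_iff_of_pos_right (by norm_num)] at h5
        exact le_of_mul_le_mul_right h5 (by positivity)
    _ ≤ 30 * (1 + 2 * (9 * κ ^ 2) + 4 * (9 * κ ^ 2) * (100 * κ ^ 2 / δ ^ 2)) * (10 * κ * R⁻¹) *
        ∫ t in {y : ℝ | 0 < y ∧ E / 2 < V y ∧ V y < 2 * E}, u t ^ 2 := by gcongr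
    _ = _ := by ring

lemma bound_above (hκ : 1 ≤ κ) (hV : HP1 κ V V') (hE : 0 < E) (hδ : 0 < δ) (hR : 0 < R)
    (hVR : V R = E) (hδR : δ ^ 2 ≤ E * R ^ 2)
    (hu : ∀ x ∈ Ioi (0 : ℝ), HasDerivAt u (u' x) x)
    (hu' : ∀ x ∈ Ioi (0 : ℝ), HasDerivAt u' ((V x - E) * u x) x)
    (hint : IntegrableOn (fun x => u x ^ 2) (Ioi 0)) {x : ℝ} (hx : 0 < x) (hxE : 4 * E ≤ V x) :
    u x ^ 2 + u' x ^ 2 / E ≤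
      (1 + 256 * κ ^ 2 / δ ^ 2) * (8 * κ) * R⁻¹ *
        Real.exp (-(1 / (16 * κ) * x * Real.sqrt (V x))) *
        ∫ t in {y : ℝ | 0 < y ∧ E < V y ∧ V y < 2 * E}, u t ^ 2 := by
  have hκ0 : 0 < κ := by linarith
  have hsm := hV.strictMonoOn hκ
  have he : 0 < 1 / (8 * κ) := by positivity
  have heκ : 1 / (8 * κ) * κ = 1 / 8 := by field_simp
  have he2 : 1 / (16 * κ) = 1 / (8 * κ) / 2 := by field_simp; norm_num
  have hVy := hV.shrink_le hκ hx
  have hVq := hV.shrink_le hκ (x := R / (1 - 1 / (8 * κ)))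
  rw [he2]
  set e := 1 / (8 * κ)
  have he8 : e ≤ 1 / 8 := by nlinarith
  have he1 : 0 < 1 - e := by linarith
  set y := (1 - e) * x
  set q := R / (1 - e) with hq
  have hqe : (1 - e) * q = R := by rw [hq]; field_simp
  have hy0 : 0 < y := mul_pos he1 hx
  have hq0 : 0 < q := div_pos hR he1
  have hRq : R < q := by nlinarith
  have hyx : y < x := by simp only [y]; nlinarith
  replace hVq := hVq hq0
  rw [hqe, hVR] at hVq
  have hqy : q < y := (hsm.lt_iff_lt hq0 hy0).1 (by linarith)
  set p := (y + x) / 2 with hp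
  have hyp : y < p := by linarith
  have hpx : p < x := by linarith
  have hRx : R < x := by linarith
  have hge : ∀ t ∈ Ici R, E ≤ V t := fun t ht =>
    hVR ▸ hsm.monotoneOn hR (lt_of_lt_of_le hR ht) ht
  -- The square of `u` satisfies `w'' = 2 u'² + 2 (V - E) u²`.
  have hw : ∀ t ∈ Ioi (0 : ℝ), HasDerivAt (fun s => u s ^ 2) (2 * (u t * u' t)) t :=
    fun t ht => hasDerivAt_sq (hu t ht)
  have hw' : ∀ t ∈ Ioi (0 : ℝ), HasDerivAt (fun s => 2 * (u s * u' s))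
      (2 * (u' t * u' t + u t * ((V t - E) * u t))) t :=
    fun t ht => ((hu t ht).fun_mul (hu' t ht)).const_mul 2
  have hpos : ∀ {c : ℝ}, 0 < c → ∀ t ∈ Ici c, t ∈ Ioi (0 : ℝ) := fun hc t ht => lt_of_lt_of_le hc ht
  have huu' : ∀ t ∈ Ici R, 2 * (u t * u' t) ≤ 0 :=
    deriv_nonpos_of_convex_of_integrableOn (fun t ht => hw t (hpos hR t ht))
      (fun t ht => hw' t (hpos hR t ht))
      (fun t ht => by nlinarith [mul_nonneg (sub_nonneg.2 (hge t ht)) (sq_nonneg (u t))])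
      (fun t _ => sq_nonneg _) (hint.mono_set (Ioi_subset_Ioi hR.le))
  have hanti : AntitoneOn (fun t => u t ^ 2) (Ici R) :=
    antitoneOn_of_hasDerivAt (convex_Ici R) (fun t ht => hw t (hpos hR t ht)) huu'
  have hVx := hV.1 x hx
  have hdecay : u p ^ 2 ≤ u y ^ 2 * Real.exp (-(Real.sqrt (V x) * (p - y))) := by
    refine le_mul_exp_of_sq_mul_le (Real.sqrt_pos.2 hVx) (fun t ht => hw t (hpos hy0 t ht))
      (fun t ht => hw' t (hpos hy0 t ht)) (fun t ht => ?_) (fun t _ => sq_nonneg _)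
      (hint.mono_set (Ioi_subset_Ioi hy0.le)) hyp.le
    rw [Real.sq_sqrt hVx.le]
    have hVt : V y ≤ V t := hsm.monotoneOn hy0 (hpos hy0 t ht) ht
    have h1 := mul_le_mul_of_nonneg_right (show V x ≤ 2 * (V t - E) by linarith) (sq_nonneg (u t))
    nlinarith [sq_nonneg (u' t)]
  have hexp : Real.exp (-(Real.sqrt (V x) * (p - y))) =
      Real.exp (-(e / 2 * x * Real.sqrt (V x))) := by
    congr 1
    simp only [hp, y]
    ring
  rw [hexp] at hdecay
  have hder : u' x ^ 2 * (x - p) ^ 2 ≤ u p ^ 2 :=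
    deriv_sq_le (hy0.trans hyp) hpx hu hu'
      (fun t ht => hge t (le_trans (by linarith) (mem_Ici.1 ht)))
      (fun t ht => by linarith [huu' t (le_trans (by linarith) (mem_Ici.1 ht))])
  have hder' : u' x ^ 2 / E ≤ 256 * κ ^ 2 / δ ^ 2 * u p ^ 2 := by
    have h1 : x = (x - p) * (16 * κ) := by
      simp only [hp, y]; linear_combination (-8 * x) * heκ
    have h2 : δ ^ 2 ≤ E * (256 * κ ^ 2) * (x - p) ^ 2 := by
      calc δ ^ 2 ≤ E * R ^ 2 := hδR
        _ ≤ E * x ^ 2 := by gcongr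
        _ = E * ((x - p) * (16 * κ)) ^ 2 := by rw [← h1]
        _ = _ := by ring
    rw [div_le_iff₀ hE, div_mul_eq_mul_div, div_mul_eq_mul_div, le_div_iff₀ (by positivity)]
    calc u' x ^ 2 * δ ^ 2 ≤ u' x ^ 2 * (E * (256 * κ ^ 2) * (x - p) ^ 2) := by gcongr
      _ = E * (256 * κ ^ 2) * (u' x ^ 2 * (x - p) ^ 2) := by ring
      _ ≤ E * (256 * κ ^ 2) * u p ^ 2 := by gcongr
      _ = _ := by ring
  have hpx' : u x ^ 2 ≤ u p ^ 2 :=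
    hanti (show R ≤ p by linarith) (show R ≤ x by linarith) hpx.le
  have hyq : u y ^ 2 ≤ u q ^ 2 := hanti hRq.le (show R ≤ y by linarith) hqy.le
  have hmean : u q ^ 2 * (q - R) ≤ ∫ t in Ioo R q, u t ^ 2 := by
    have h1 := sub_le_setIntegral_of_hasDerivAt_le (F := fun t => u q ^ 2 * t)
      (F' := fun _ => u q ^ 2 * 1) hRq.le (fun t _ => (hasDerivAt_id t).const_mul _)
      (hint.mono_set fun t ht => hpos hR t ht.1)
      (fun t ht => by
        rw [mul_one]
        exact hanti (show R ≤ t from ht.1) (show R ≤ q from hRq.le) ht.2)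
    linarith
  have hI : ∫ t in Ioo R q, u t ^ 2 ≤
      ∫ t in {y : ℝ | 0 < y ∧ E < V y ∧ V y < 2 * E}, u t ^ 2 := by
    refine setIntegral_sq_mono hint (fun t ht => ?_) fun t ht => ht.1
    have ht0 : 0 < t := hR.trans ht.1
    exact ⟨ht0, hVR ▸ hsm hR ht0 ht.1, by linarith [hsm ht0 hq0 ht.2]⟩
  set I := ∫ t in {y : ℝ | 0 < y ∧ E < V y ∧ V y < 2 * E}, u t ^ 2
  have hqI : u q ^ 2 ≤ 8 * κ * R⁻¹ * I := by
    have h1 : R ≤ (q - R) * (8 * κ) := by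
      have : (q - R) * (8 * κ) = q := by rw [← hqe]; linear_combination 8 * q * heκ
      linarith
    rw [mul_right_comm, ← div_eq_mul_inv, le_div_iff₀ hR]
    calc u q ^ 2 * R ≤ u q ^ 2 * ((q - R) * (8 * κ)) := by gcongr
      _ = 8 * κ * (u q ^ 2 * (q - R)) := by ring
      _ ≤ 8 * κ * I := by gcongr; exact hmean.trans hI
  calc u x ^ 2 + u' x ^ 2 / E ≤ (1 + 256 * κ ^ 2 / δ ^ 2) * u p ^ 2 := by linarith
    _ ≤ (1 + 256 * κ ^ 2 / δ ^ 2) *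
        (8 * κ * R⁻¹ * I * Real.exp (-(e / 2 * x * Real.sqrt (V x)))) := by
        gcongr
        exact hdecay.trans (mul_le_mul_of_nonneg_right (hyq.trans hqI) (Real.exp_pos _).le)
    _ = _ := by ring

end Schrodinger

/-- Pointwise bounds for `L²` solutions.  Let `κ ≥ 1`, `V ∈ 𝓗𝒫₁(κ)`, `δ > 0`, `E > 0` with
`√E·|{V ≤ E}| ≥ δ`, and let `u ∈ C²((0,∞)) ∩ L²((0,∞))` solve `−u″ + Vu = Eu`.  Then:
(a) for `x > 0` with `V(x) < E/2`:
    `u(x)² + u′(x)²/E ≤ C(κ,δ)|{V<E}|⁻¹∫_{E/2<V<2E}u²`;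
(b) for `x > 0` with `V(x) ≥ 4E`:
    `u(x)² + u′(x)²/E ≤ C′(κ,δ)|{V≤E}|⁻¹e^{−c(κ)x√V(x)}∫_{E<V<2E}u²`. -/
theorem pointwise_eigen (κ : ℝ) (hκ : 1 ≤ κ) :
    ∃ c : ℝ, 0 < c ∧
      ∀ δ : ℝ, 0 < δ →
        ∃ C : ℝ, 0 < C ∧ ∃ C' : ℝ, 0 < C' ∧
          ∀ V V' u u' u'' : ℝ → ℝ, ∀ E : ℝ,
            HP1 κ V V' → 0 < E →
            δ ≤ Real.sqrt E * (volume {x : ℝ | 0 < x ∧ V x ≤ E}).toReal →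
            (∀ x ∈ Ioi (0 : ℝ), HasDerivAt u (u' x) x) →
            (∀ x ∈ Ioi (0 : ℝ), HasDerivAt u' (u'' x) x) →
            ContinuousOn u'' (Ioi 0) →
            (∀ x ∈ Ioi (0 : ℝ), -u'' x + V x * u x = E * u x) →
            IntegrableOn (fun x => u x ^ 2) (Ioi 0) →
            (∀ x : ℝ, 0 < x → V x < E / 2 →
              u x ^ 2 + u' x ^ 2 / E ≤
                C * (volume {y : ℝ | 0 < y ∧ V y < E}).toReal⁻¹ *
                  ∫ t in {y : ℝ | 0 < y ∧ E / 2 < V y ∧ V y < 2 * E}, u t ^ 2) ∧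
            (∀ x : ℝ, 0 < x → 4 * E ≤ V x →
              u x ^ 2 + u' x ^ 2 / E ≤
                C' * (volume {y : ℝ | 0 < y ∧ V y ≤ E}).toReal⁻¹ *
                  Real.exp (-(c * x * Real.sqrt (V x))) *
                  ∫ t in {y : ℝ | 0 < y ∧ E < V y ∧ V y < 2 * E}, u t ^ 2) := by
  have hκ0 : 0 < κ := by linarith
  refine ⟨1 / (16 * κ), by positivity, fun δ hδ =>
    ⟨30 * (1 + 2 * (9 * κ ^ 2) + 4 * (9 * κ ^ 2) * (100 * κ ^ 2 / δ ^ 2)) * (10 * κ), by positivity,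
      (1 + 256 * κ ^ 2 / δ ^ 2) * (8 * κ), by positivity, ?_⟩⟩
  intro V V' u u' u'' E hV hE hvol hu hu' _ heq hint
  obtain ⟨R, hR, hVR⟩ := hV.exists_eq hκ
    (pos_of_mul_pos_right (hδ.trans_le hvol) (Real.sqrt_nonneg E))
  have hsm := hV.strictMonoOn hκ
  have hle : {x : ℝ | 0 < x ∧ V x ≤ E} = Ioc 0 R := by
    ext x
    refine and_congr_right fun hx => ?_
    rw [← hVR]
    exact hsm.le_iff_le hx hR
  have hlt : {x : ℝ | 0 < x ∧ V x < E} = Ioo 0 R := by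
    ext x
    refine and_congr_right fun hx => ?_
    rw [← hVR]
    exact hsm.lt_iff_lt hx hR
  rw [hle, Real.volume_Ioc, sub_zero, ENNReal.toReal_ofReal hR.le] at hvol
  rw [hle, hlt, Real.volume_Ioc, Real.volume_Ioo, sub_zero, ENNReal.toReal_ofReal hR.le]
  have hδR : δ ^ 2 ≤ E * R ^ 2 := by
    calc δ ^ 2 ≤ (Real.sqrt E * R) ^ 2 := pow_le_pow_left₀ hδ.le hvol 2
      _ = E * R ^ 2 := by rw [mul_pow, Real.sq_sqrt hE.le]
  have hu₂ : ∀ x ∈ Ioi (0 : ℝ), HasDerivAt u' ((V x - E) * u x) x := fun x hx => by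
    convert hu' x hx using 1
    linarith [heq x hx]
  exact ⟨fun x hx hxE => bound_below hκ hV hE hδ hR hVR hδR hu hu₂ hint hx hxE,
    fun x hx hxE => bound_above hκ hV hE hδ hR hVR hδR hu hu₂ hint hx hxE⟩
end

section
/- Under the setup, for all a, b ∈ ℝ there exists c = c(a,b,κ,δ) > 0 such that ∫₀^∞ x^a V(x)^b u(x)² dx ≥ c |{V≤E}|^a E^b ∫₀^∞ u², where the left-hand side takes values in [0,+∞]. -/
open MeasureTheory Filter Set

/-- A square-integrable solution of `v'' = lam (W - 1) v` has its mass beyond `2` controlled by its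
mass on `[1, 2]`. -/
theorem integral_Ioi_two_le {lam s : ℝ} (hlam : 0 < lam) (hs : 0 < s) {W v v' : ℝ → ℝ}
    (hW1 : ∀ y, 1 ≤ y → 1 ≤ W y) (hW2 : ∀ y, 2 ≤ y → 1 + s ≤ W y)
    (hWc : ContinuousOn W (Ioi 0))
    (hv : ∀ y ∈ Ioi (0 : ℝ), HasDerivAt v (v' y) y)
    (hv' : ∀ y ∈ Ioi (0 : ℝ), HasDerivAt v' (lam * (W y - 1) * v y) y)
    (hint : IntegrableOn (fun y => v y ^ 2) (Ioi 0)) :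
    ∫ y in Ioi (2 : ℝ), v y ^ 2 ≤ (lam * s)⁻¹ * ∫ y in (1 : ℝ)..2, v y ^ 2 := by
  have hvc : ContinuousOn v (Ioi 0) := fun y hy => (hv y hy).continuousAt.continuousWithinAt
  have hv'c : ContinuousOn v' (Ioi 0) := fun y hy => (hv' y hy).continuousAt.continuousWithinAt
  have hf : ∀ y ∈ Ioi (0 : ℝ), HasDerivAt (fun y => v y ^ 2) (2 * v y * v' y) y := by
    intro y hy
    refine ((hv y hy).pow 2).congr_deriv ?_
    norm_num
  have hg : ∀ y ∈ Ioi (0 : ℝ), HasDerivAt (fun y => 2 * v y * v' y)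
      (2 * v' y ^ 2 + 2 * lam * (W y - 1) * v y ^ 2) y := by
    intro y hy
    refine (((hv y hy).const_mul 2).mul (hv' y hy)).congr_deriv ?_
    ring
  have hmono : MonotoneOn (fun y => 2 * v y * v' y) (Ici 1) := by
    refine monotoneOn_of_hasDerivWithinAt_nonneg (convex_Ici 1)
      (fun y hy => (hg y (lt_of_lt_of_le one_pos (mem_Ici.1 hy))).continuousAt.continuousWithinAt)
      (f' := fun y => 2 * v' y ^ 2 + 2 * lam * (W y - 1) * v y ^ 2) ?_ ?_
    · intro y hy
      rw [interior_Ici] at hy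
      exact (hg y (lt_trans one_pos (mem_Ioi.1 hy))).hasDerivWithinAt
    · intro y hy
      rw [interior_Ici] at hy
      have h1 := sub_nonneg.2 (hW1 y (le_of_lt hy))
      positivity
  have hneg : ∀ t, 1 ≤ t → 2 * v t * v' t ≤ 0 := by
    intro t ht
    by_contra! hd
    set d := 2 * v t * v' t with hd_def
    have hm : MonotoneOn (fun y => v y ^ 2 - d * y) (Ici t) := by
      refine monotoneOn_of_hasDerivWithinAt_nonneg (convex_Ici t)
        (f' := fun y => 2 * v y * v' y - d) ?_ ?_ ?_
      · intro y hy
        have hy0 : y ∈ Ioi (0 : ℝ) := lt_of_lt_of_le (lt_of_lt_of_le one_pos ht) hy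
        exact ((hf y hy0).continuousAt.sub (by fun_prop)).continuousWithinAt
      · intro y hy
        rw [interior_Ici] at hy
        have hy0 : y ∈ Ioi (0 : ℝ) := lt_trans (lt_of_lt_of_le one_pos ht) hy
        exact (((hf y hy0).sub ((hasDerivAt_id y).const_mul d)).congr_deriv
          (by simp)).hasDerivWithinAt
      · intro y hy
        rw [interior_Ici] at hy
        exact sub_nonneg.2 (hmono ht (ht.trans hy.le) hy.le)
    have hlow : ∀ y ∈ Ioi (t + 1), d ≤ v y ^ 2 := by
      intro y hy
      have hy' : t + 1 < y := hy
      have h1 : v t ^ 2 - d * t ≤ v y ^ 2 - d * y :=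
        hm (self_mem_Ici) (by simp only [mem_Ici]; linarith) (by linarith)
      nlinarith [sq_nonneg (v t)]
    have h2 : IntegrableOn (fun y => v y ^ 2) (Ioi (t + 1)) :=
      hint.mono_set (Ioi_subset_Ioi (by linarith))
    have h3 : IntegrableOn (fun _ : ℝ => d) (Ioi (t + 1)) := by
      refine Integrable.mono' h2 aestronglyMeasurable_const ?_
      filter_upwards [ae_restrict_mem measurableSet_Ioi] with y hy
      rw [Real.norm_of_nonneg hd.le]
      exact hlow y hy
    rw [integrableOn_const_iff (by finiteness)] at h3
    simp [hd.ne'] at h3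
  set D := -(2 * v 2 * v' 2) with hD
  have hnear : D / 2 ≤ ∫ y in (1 : ℝ)..2, v y ^ 2 := by
    have hm : AntitoneOn (fun y => v y ^ 2 + D * y) (Icc 1 2) := by
      refine antitoneOn_of_hasDerivWithinAt_nonpos (convex_Icc 1 2)
        (f' := fun y => 2 * v y * v' y + D) ?_ ?_ ?_
      · intro y hy
        have hy0 : y ∈ Ioi (0 : ℝ) := lt_of_lt_of_le one_pos hy.1
        exact ((hf y hy0).continuousAt.add (by fun_prop)).continuousWithinAt
      · intro y hy
        rw [interior_Icc] at hy
        have hy0 : y ∈ Ioi (0 : ℝ) := lt_trans one_pos hy.1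
        exact (((hf y hy0).add ((hasDerivAt_id y).const_mul D)).congr_deriv
          (by simp)).hasDerivWithinAt
      · intro y hy
        rw [interior_Icc] at hy
        have h1 : 2 * v y * v' y ≤ 2 * v 2 * v' 2 :=
          hmono hy.1.le (by simp only [mem_Ici]; norm_num) hy.2.le
        linarith
    have h1 : ∫ y in (1 : ℝ)..2, D * (2 - y) = D / 2 := by
      rw [intervalIntegral.integral_const_mul, intervalIntegral.integral_sub (by simp) (by simp)]
      simp
      ring
    rw [← h1]
    refine intervalIntegral.integral_mono_on (by norm_num)
      (Continuous.intervalIntegrable (by fun_prop) _ _) ?_ ?_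
    · refine ContinuousOn.intervalIntegrable ((hvc.pow 2).mono ?_)
      rw [uIcc_of_le (by norm_num)]
      exact fun y hy => lt_of_lt_of_le one_pos hy.1
    · intro y hy
      have h2 : v 2 ^ 2 + D * 2 ≤ v y ^ 2 + D * y := hm hy (by norm_num) hy.2
      nlinarith [sq_nonneg (v 2)]
  have hls : 0 < lam * s := mul_pos hlam hs
  have hfar : ∀ T, 2 ≤ T → ∫ y in (2 : ℝ)..T, v y ^ 2 ≤ (lam * s)⁻¹ * (D / 2) := by
    intro T hT
    have hsub : uIcc 2 T ⊆ Ioi (0 : ℝ) := by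
      rw [uIcc_of_le hT]
      exact fun y hy => lt_of_lt_of_le two_pos hy.1
    have hi : IntervalIntegrable (fun y => 2 * v' y ^ 2 + 2 * lam * (W y - 1) * v y ^ 2)
        volume 2 T := by
      refine ContinuousOn.intervalIntegrable (ContinuousOn.mono ?_ hsub)
      fun_prop
    have h1 := intervalIntegral.integral_eq_sub_of_hasDerivAt (fun y hy => hg y (hsub hy)) hi
    have h2 : ∫ y in (2 : ℝ)..T, 2 * (lam * s) * v y ^ 2 ≤
        ∫ y in (2 : ℝ)..T, (2 * v' y ^ 2 + 2 * lam * (W y - 1) * v y ^ 2) := by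
      refine intervalIntegral.integral_mono_on hT
        (ContinuousOn.intervalIntegrable ((continuousOn_const.mul (hvc.pow 2)).mono hsub)) hi ?_
      intro y hy
      have h3 : lam * s * v y ^ 2 ≤ lam * (W y - 1) * v y ^ 2 := by
        have := hW2 y hy.1
        gcongr
        linarith
      nlinarith [sq_nonneg (v' y)]
    rw [intervalIntegral.integral_const_mul, h1] at h2
    have h4 := hneg T (by linarith)
    rw [inv_mul_eq_div, le_div_iff₀ hls]
    linarith
  have hlim := intervalIntegral_tendsto_integral_Ioi 2
    (hint.mono_set (Ioi_subset_Ioi (by norm_num : (0 : ℝ) ≤ 2))) tendsto_id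
  refine (le_of_tendsto hlim ?_).trans (mul_le_mul_of_nonneg_left hnear (by positivity))
  filter_upwards [eventually_ge_atTop 2] with T hT using hfar T hT

/-- A solution of `v'' = lam (W - 1) v` with `W` nondecreasing and below `1 - s` on `(0, 1/2]` has
its mass on `(0, 1/4]` controlled by its mass on `[1/4, 1/2]`. -/
theorem integral_Ioc_zero_quarter_le {lam s : ℝ} (hlam : 0 < lam) (hs : 0 < s)
    {W W' v v' : ℝ → ℝ} (hW0 : ∀ y ∈ Ioi (0 : ℝ), 0 ≤ W y)
    (hWs : ∀ y ∈ Ioc (0 : ℝ) (1 / 2), W y ≤ 1 - s)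
    (hW : ∀ y ∈ Ioi (0 : ℝ), HasDerivAt W (W' y) y)
    (hW' : ∀ y ∈ Ioi (0 : ℝ), 0 ≤ W' y)
    (hv : ∀ y ∈ Ioi (0 : ℝ), HasDerivAt v (v' y) y)
    (hv' : ∀ y ∈ Ioi (0 : ℝ), HasDerivAt v' (lam * (W y - 1) * v y) y) :
    ∫ y in Ioc (0 : ℝ) (1 / 4), v y ^ 2 ≤
      7680 * (1 + 2 / s + 4 / (lam * s)) * ∫ y in (1 / 4 : ℝ)..(1 / 2), v y ^ 2 := by
  have hWc : ContinuousOn W (Ioi 0) := fun y hy => (hW y hy).continuousAt.continuousWithinAt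
  have hvc : ContinuousOn v (Ioi 0) := fun y hy => (hv y hy).continuousAt.continuousWithinAt
  have hv'c : ContinuousOn v' (Ioi 0) := fun y hy => (hv' y hy).continuousAt.continuousWithinAt
  have hq : ∀ y ∈ Ioc (0 : ℝ) (1 / 2), lam * s ≤ lam * (1 - W y) := by
    intro y hy
    have := hWs y hy
    gcongr
    linarith
  have hls : 0 < lam * s := mul_pos hlam hs
  set G : ℝ → ℝ := fun y => v y ^ 2 + v' y ^ 2 / (lam * (1 - W y)) with hGdef
  have hG : ∀ y ∈ Ioc (0 : ℝ) (1 / 2), HasDerivAt G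
      (v' y ^ 2 * (lam * W' y) / (lam * (1 - W y)) ^ 2) y := by
    intro y hy
    have hne : lam * (1 - W y) ≠ 0 := (hls.trans_le (hq y hy)).ne'
    refine (((hv y hy.1).pow 2).add (((hv' y hy.1).pow 2).div
      (((hW y hy.1).const_sub 1).const_mul lam) hne)).congr_deriv ?_
    have h1 : 1 - W y ≠ 0 := right_ne_zero_of_mul hne
    simp only [Pi.pow_apply]
    field_simp
    ring
  have hGmono : MonotoneOn G (Ioc 0 (1 / 2)) := by
    refine monotoneOn_of_hasDerivWithinAt_nonneg (convex_Ioc 0 (1 / 2))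
      (fun y hy => (hG y hy).continuousAt.continuousWithinAt)
      (fun y hy => (hG y (interior_subset hy)).hasDerivWithinAt) ?_
    intro y hy
    have := hW' y (interior_subset hy).1
    positivity
  have hvG : ∀ y ∈ Ioc (0 : ℝ) (1 / 2), v y ^ 2 ≤ G y := by
    intro y hy
    have := hls.trans_le (hq y hy)
    exact le_add_of_nonneg_right (by positivity)
  have hleft : ∫ y in Ioc (0 : ℝ) (1 / 4), v y ^ 2 ≤ G (1 / 4) * (1 / 4) := by
    have h1 := norm_setIntegral_le_of_norm_le_const (μ := volume) (s := Ioc (0 : ℝ) (1 / 4))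
      (f := fun y => v y ^ 2) (C := G (1 / 4)) (by simp) (by
        intro y hy
        have hy2 : y ∈ Ioc (0 : ℝ) (1 / 2) := ⟨hy.1, hy.2.trans (by norm_num)⟩
        rw [Real.norm_of_nonneg (sq_nonneg _)]
        exact (hvG y hy2).trans (hGmono hy2 (by norm_num) hy.2))
    refine (le_abs_self _).trans (h1.trans_eq ?_)
    simp [measureReal_def]
  set K := 1 + 2 / s + 4 / (lam * s) with hK
  have hsub : uIcc (1 / 4 : ℝ) (1 / 2) ⊆ Ioi (0 : ℝ) := by
    rw [uIcc_of_le (by norm_num)]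
    exact fun y hy => lt_of_lt_of_le (by norm_num) hy.1
  -- the cutoff `(y - 1/4) (1/2 - y)` makes the boundary terms vanish
  set F : ℝ → ℝ := fun y => ((y - 1 / 4) * (1 / 2 - y)) ^ 2 * (v y * v' y) with hFdef
  set F' : ℝ → ℝ := fun y =>
    2 * ((y - 1 / 4) * (1 / 2 - y)) * (3 / 4 - 2 * y) * (v y * v' y) +
      ((y - 1 / 4) * (1 / 2 - y)) ^ 2 * (v' y ^ 2 + lam * (W y - 1) * v y ^ 2) with hF'def
  have hF : ∀ y ∈ Ioi (0 : ℝ), HasDerivAt F (F' y) y := by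
    intro y hy
    have h1 : HasDerivAt (fun y : ℝ => (y - 1 / 4) * (1 / 2 - y)) (3 / 4 - 2 * y) y := by
      refine (((hasDerivAt_id y).sub_const (1 / 4)).mul
        ((hasDerivAt_id y).const_sub (1 / 2))).congr_deriv ?_
      simp
      ring
    refine ((h1.pow 2).mul ((hv y hy).mul (hv' y hy))).congr_deriv ?_
    simp only [hF'def, Pi.pow_apply, Pi.mul_apply, Nat.cast_ofNat, Nat.add_one_sub_one, pow_one]
    ring
  have hF'i : IntervalIntegrable F' volume (1 / 4) (1 / 2) := by
    refine ContinuousOn.intervalIntegrable (ContinuousOn.mono ?_ hsub)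
    fun_prop
  have hFint : ∫ y in (1 / 4 : ℝ)..(1 / 2), F' y = 0 := by
    rw [intervalIntegral.integral_eq_sub_of_hasDerivAt (fun y hy => hF y (hsub hy)) hF'i]
    simp [hFdef]
  have hvi : IntervalIntegrable (fun y => v y ^ 2) volume (1 / 4) (1 / 2) :=
    ContinuousOn.intervalIntegrable ((hvc.pow 2).mono hsub)
  have hpoly : ∫ y in (1 / 4 : ℝ)..(1 / 2), G (1 / 4) * ((y - 1 / 4) * (1 / 2 - y)) ^ 2 =
      G (1 / 4) * (1 / 30720) := by
    rw [intervalIntegral.integral_const_mul]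
    congr 1
    have h1 : ∀ y : ℝ, HasDerivAt (fun y : ℝ => (y - 1 / 4) ^ 3 / 48 - (y - 1 / 4) ^ 4 / 8
        + (y - 1 / 4) ^ 5 / 5) (((y - 1 / 4) * (1 / 2 - y)) ^ 2) y := by
      intro y
      have h2 := (hasDerivAt_id y).sub_const (1 / 4 : ℝ)
      refine ((((h2.pow 3).div_const 48).sub ((h2.pow 4).div_const 8)).add
        ((h2.pow 5).div_const 5)).congr_deriv ?_
      simp
      ring
    rw [intervalIntegral.integral_eq_sub_of_hasDerivAt (fun y _ => h1 y)
      (Continuous.intervalIntegrable (by fun_prop) _ _)]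
    norm_num
  have hpt : ∀ y ∈ Icc (1 / 4 : ℝ) (1 / 2), G (1 / 4) * ((y - 1 / 4) * (1 / 2 - y)) ^ 2 ≤
      2 / (lam * s) * F' y + K * v y ^ 2 := by
    intro y hy
    have hy0 : 0 < y := lt_of_lt_of_le (by norm_num) hy.1
    have hy2 : y ∈ Ioc (0 : ℝ) (1 / 2) := ⟨hy0, hy.2⟩
    set χ := (y - 1 / 4) * (1 / 2 - y) with hχ
    have hGy : G (1 / 4) ≤ v y ^ 2 + v' y ^ 2 / (lam * s) := by
      refine (hGmono (by norm_num) hy2 hy.1).trans ?_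
      have := hq y hy2
      simp only [hGdef]
      gcongr
    have hχ0 : 0 ≤ χ := mul_nonneg (by linarith [hy.1]) (by linarith [hy.2])
    have hχ1 : χ ≤ 1 := by nlinarith [hy.1, hy.2]
    have hχ2 : χ ^ 2 ≤ 1 := by nlinarith
    have hd2 : (3 / 4 - 2 * y) ^ 2 ≤ 1 := by nlinarith [hy.1, hy.2]
    have hWy := hW0 y hy0
    have hF'low : χ ^ 2 * v' y ^ 2 ≤ 2 * F' y + (2 * lam + 4) * v y ^ 2 := by
      have h1 : 0 ≤ (χ * v' y + 2 * (3 / 4 - 2 * y) * v y) ^ 2 := sq_nonneg _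
      have h2 : (3 / 4 - 2 * y) ^ 2 * v y ^ 2 ≤ 1 * v y ^ 2 := by gcongr
      have h3 : χ ^ 2 * (lam * (1 - W y) * v y ^ 2) ≤ 1 * (lam * 1 * v y ^ 2) := by
        have h4 : 0 ≤ 1 - W y := by linarith [hWs y hy2]
        gcongr
        linarith
      simp only [hF'def, ← hχ]
      nlinarith
    calc G (1 / 4) * χ ^ 2 ≤ (v y ^ 2 + v' y ^ 2 / (lam * s)) * χ ^ 2 := by gcongr
      _ = χ ^ 2 * v y ^ 2 + χ ^ 2 * v' y ^ 2 / (lam * s) := by ring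
      _ ≤ 1 * v y ^ 2 + (2 * F' y + (2 * lam + 4) * v y ^ 2) / (lam * s) := by gcongr
      _ = 2 / (lam * s) * F' y + K * v y ^ 2 := by
        rw [hK]
        field_simp
        ring
  have hmain := intervalIntegral.integral_mono_on (by norm_num)
    (Continuous.intervalIntegrable (by fun_prop) _ _)
    ((hF'i.const_mul _).add (hvi.const_mul _)) hpt
  rw [hpoly, intervalIntegral.integral_add (hF'i.const_mul _) (hvi.const_mul _),
    intervalIntegral.integral_const_mul, intervalIntegral.integral_const_mul, hFint] at hmain
  linarith

/-- Most of the mass of a square-integrable solution of `v'' = lam (W - 1) v` lies on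
`(1/4, 2]`. -/
theorem integral_Ioi_zero_le {δ lam s : ℝ} (hδ : 0 < δ) (hlam : δ ^ 2 ≤ lam) (hs : 0 < s)
    {W W' v v' : ℝ → ℝ} (hW0 : ∀ y ∈ Ioi (0 : ℝ), 0 ≤ W y)
    (hWs : ∀ y ∈ Ioc (0 : ℝ) (1 / 2), W y ≤ 1 - s)
    (hW1 : ∀ y, 1 ≤ y → 1 ≤ W y) (hW2 : ∀ y, 2 ≤ y → 1 + s ≤ W y)
    (hW : ∀ y ∈ Ioi (0 : ℝ), HasDerivAt W (W' y) y)
    (hW' : ∀ y ∈ Ioi (0 : ℝ), 0 ≤ W' y)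
    (hv : ∀ y ∈ Ioi (0 : ℝ), HasDerivAt v (v' y) y)
    (hv' : ∀ y ∈ Ioi (0 : ℝ), HasDerivAt v' (lam * (W y - 1) * v y) y)
    (hint : IntegrableOn (fun y => v y ^ 2) (Ioi 0)) :
    ∫ y in Ioi (0 : ℝ), v y ^ 2 ≤
      (7680 * (1 + 2 / s + 4 / (δ ^ 2 * s)) + 1 + (δ ^ 2 * s)⁻¹) *
        ∫ y in Ioc (1 / 4 : ℝ) 2, v y ^ 2 := by
  have hδ2 : 0 < δ ^ 2 := by positivity
  have hlam0 : 0 < lam := hδ2.trans_le hlam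
  have hWc : ContinuousOn W (Ioi 0) := fun y hy => (hW y hy).continuousAt.continuousWithinAt
  have hin := integral_Ioc_zero_quarter_le hlam0 hs hW0 hWs hW hW' hv hv'
  have hout := integral_Ioi_two_le hlam0 hs hW1 hW2 hWc hv hv' hint
  have hmid : IntegrableOn (fun y => v y ^ 2) (Ioc (1 / 4) 2) :=
    hint.mono_set fun y hy => lt_trans (by norm_num) hy.1
  set I := ∫ y in Ioc (1 / 4 : ℝ) 2, v y ^ 2 with hI
  have hI0 : 0 ≤ I := integral_nonneg fun y => sq_nonneg _
  have hle : ∀ {p q : ℝ}, 1 / 4 ≤ p → p ≤ q → q ≤ 2 → ∫ y in p..q, v y ^ 2 ≤ I := by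
    intro p q hp hpq hq
    rw [intervalIntegral.integral_of_le hpq]
    exact setIntegral_mono_set hmid (Eventually.of_forall fun y => sq_nonneg _)
      (Ioc_subset_Ioc hp hq).eventuallyLE
  have hsplit : ∫ y in Ioi (0 : ℝ), v y ^ 2 =
      (∫ y in Ioc (0 : ℝ) (1 / 4), v y ^ 2) + I + ∫ y in Ioi (2 : ℝ), v y ^ 2 := by
    rw [← Ioc_union_Ioi_eq_Ioi (by norm_num : (0 : ℝ) ≤ 1 / 4),
      setIntegral_union (Ioc_disjoint_Ioi le_rfl) measurableSet_Ioi
        (hint.mono_set Ioc_subset_Ioi_self)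
        (hint.mono_set (Ioi_subset_Ioi (by norm_num))),
      ← Ioc_union_Ioi_eq_Ioi (by norm_num : (1 / 4 : ℝ) ≤ 2),
      setIntegral_union (Ioc_disjoint_Ioi le_rfl) measurableSet_Ioi hmid
        (hint.mono_set (Ioi_subset_Ioi (by norm_num))), add_assoc]
  have hin' : ∫ y in Ioc (0 : ℝ) (1 / 4), v y ^ 2 ≤
      7680 * (1 + 2 / s + 4 / (δ ^ 2 * s)) * I := by
    refine hin.trans ?_
    refine (mul_le_mul_of_nonneg_left
      (hle le_rfl (by norm_num : (1 / 4 : ℝ) ≤ 1 / 2) (by norm_num)) (by positivity)).trans ?_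
    gcongr
  have hout' : ∫ y in Ioi (2 : ℝ), v y ^ 2 ≤ (δ ^ 2 * s)⁻¹ * I := by
    refine hout.trans ?_
    refine (mul_le_mul_of_nonneg_left
      (hle (by norm_num) (by norm_num : (1 : ℝ) ≤ 2) le_rfl) (by positivity)).trans ?_
    gcongr
  rw [hsplit]
  linarith

/-- Derivative of `x ↦ V x * x ^ (-p)` in terms of the logarithmic derivative of `V`. -/
theorem hasDerivAt_mul_rpow_neg {V : ℝ → ℝ} {d x : ℝ} (p : ℝ) (hx : 0 < x)
    (hV : HasDerivAt V d x) :
    HasDerivAt (fun x => V x * x ^ (-p)) (x ^ (-p - 1) * (x * d - p * V x)) x := by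
  refine (hV.mul (Real.hasDerivAt_rpow_const (Or.inl hx.ne'))).congr_deriv ?_
  rw [Real.rpow_sub_one hx.ne']
  field_simp
  ring

theorem HP1.mul_div_rpow_inv_le {κ : ℝ} {V V' : ℝ → ℝ} (hV : HP1 κ V V') {x y : ℝ}
    (hx : 0 < x) (hxy : x ≤ y) : V x * (y / x) ^ κ⁻¹ ≤ V y := by
  obtain ⟨-, hd, -, hb⟩ := hV
  have hD : ∀ z ∈ Ioi (0 : ℝ), HasDerivAt (fun x => V x * x ^ (-κ⁻¹))
      (z ^ (-κ⁻¹ - 1) * (z * V' z - κ⁻¹ * V z)) z :=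
    fun z hz => hasDerivAt_mul_rpow_neg _ hz (hd z hz)
  have hm : MonotoneOn (fun x => V x * x ^ (-κ⁻¹)) (Ioi 0) :=
    monotoneOn_of_hasDerivWithinAt_nonneg (convex_Ioi 0)
      (fun z hz => (hD z hz).continuousAt.continuousWithinAt)
      (fun z hz => (hD z (interior_subset hz)).hasDerivWithinAt)
      fun z hz => mul_nonneg (Real.rpow_nonneg (mem_Ioi.1 (interior_subset hz)).le _)
        (sub_nonneg.2 (hb z (interior_subset hz)).1)
  have hy : 0 < y := hx.trans_le hxy
  have h1 : V x * x ^ (-κ⁻¹) ≤ V y * y ^ (-κ⁻¹) := hm hx hy hxy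
  rw [Real.rpow_neg hx.le, Real.rpow_neg hy.le, ← div_eq_mul_inv, ← div_eq_mul_inv,
    le_div_iff₀ (Real.rpow_pos_of_pos hy _)] at h1
  rw [Real.div_rpow hy.le hx.le]
  exact (by ring_nf : _ = _).trans_le h1

theorem HP1.le_mul_div_rpow {κ : ℝ} {V V' : ℝ → ℝ} (hV : HP1 κ V V') {x y : ℝ}
    (hx : 0 < x) (hxy : x ≤ y) : V y ≤ V x * (y / x) ^ κ := by
  obtain ⟨-, hd, -, hb⟩ := hV
  have hD : ∀ z ∈ Ioi (0 : ℝ), HasDerivAt (fun x => V x * x ^ (-κ))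
      (z ^ (-κ - 1) * (z * V' z - κ * V z)) z :=
    fun z hz => hasDerivAt_mul_rpow_neg _ hz (hd z hz)
  have hm : AntitoneOn (fun x => V x * x ^ (-κ)) (Ioi 0) :=
    antitoneOn_of_hasDerivWithinAt_nonpos (convex_Ioi 0)
      (fun z hz => (hD z hz).continuousAt.continuousWithinAt)
      (fun z hz => (hD z (interior_subset hz)).hasDerivWithinAt)
      fun z hz => mul_nonpos_of_nonneg_of_nonpos
        (Real.rpow_nonneg (mem_Ioi.1 (interior_subset hz)).le _)
        (sub_nonpos.2 (hb z (interior_subset hz)).2)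
  have hy : 0 < y := hx.trans_le hxy
  have h1 : V y * y ^ (-κ) ≤ V x * x ^ (-κ) := hm hx hy hxy
  rw [Real.rpow_neg hx.le, Real.rpow_neg hy.le, ← div_eq_mul_inv, ← div_eq_mul_inv,
    div_le_iff₀ (Real.rpow_pos_of_pos hy _)] at h1
  rw [Real.div_rpow hy.le hx.le]
  exact h1.trans_eq (by ring_nf)

theorem HP1.deriv_pos {κ : ℝ} (hκ : 1 ≤ κ) {V V' : ℝ → ℝ} (hV : HP1 κ V V') {x : ℝ}
    (hx : 0 < x) : 0 < V' x := by
  have h1 : 0 < κ⁻¹ * V x := mul_pos (by positivity) (hV.1 x hx)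
  exact pos_of_mul_pos_right (h1.trans_le (hV.2.2.2 x hx).1) hx.le

theorem HP1.strictMonoOn_s12 {κ : ℝ} (hκ : 1 ≤ κ) {V V' : ℝ → ℝ} (hV : HP1 κ V V') :
    StrictMonoOn V (Ioi 0) :=
  strictMonoOn_of_hasDerivWithinAt_pos (convex_Ioi 0)
    (fun z hz => (hV.2.1 z hz).continuousAt.continuousWithinAt)
    (fun z hz => (hV.2.1 z (interior_subset hz)).hasDerivWithinAt)
    fun _ hz => hV.deriv_pos hκ (mem_Ioi.1 (interior_subset hz))

theorem HP1.exists_eq_s12 {κ : ℝ} (hκ : 1 ≤ κ) {V V' : ℝ → ℝ} (hV : HP1 κ V V') {E : ℝ}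
    (hE : 0 < E) : ∃ X, 0 < X ∧ V X = E := by
  have hκ0 : κ ≠ 0 := by positivity
  have hV1 : 0 < V 1 := hV.1 1 (mem_Ioi.2 one_pos)
  set r := (E / V 1) ^ κ with hr
  have hr0 : 0 < r := by positivity
  have hrκ : r ^ κ⁻¹ = E / V 1 := by
    rw [hr, Real.rpow_rpow_inv (by positivity) hκ0]
  have hVc : ContinuousOn V (Ioi 0) :=
    fun z hz => (hV.2.1 z hz).continuousAt.continuousWithinAt
  have hlo : V (min 1 r) ≤ E := by
    have hm : 0 < min 1 r := by positivity
    have h1 := hV.mul_div_rpow_inv_le hm (min_le_left 1 r)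
    have h2 : min 1 r ^ κ⁻¹ ≤ E / V 1 := by
      rw [← hrκ]
      exact Real.rpow_le_rpow hm.le (min_le_right _ _) (by positivity)
    rw [Real.div_rpow zero_le_one hm.le, Real.one_rpow, mul_one_div,
      div_le_iff₀ (Real.rpow_pos_of_pos hm _)] at h1
    rw [le_div_iff₀ hV1] at h2
    linarith
  have hhi : E ≤ V (max 1 r) := by
    have h1 := hV.mul_div_rpow_inv_le one_pos (le_max_left 1 r)
    have h2 : E / V 1 ≤ max 1 r ^ κ⁻¹ := by
      rw [← hrκ]
      exact Real.rpow_le_rpow hr0.le (le_max_right _ _) (by positivity)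
    rw [div_one] at h1
    rw [div_le_iff₀ hV1] at h2
    linarith
  obtain ⟨X, hX, hVX⟩ := isPreconnected_Ioi.intermediate_value
    (show min 1 r ∈ Ioi 0 from lt_min one_pos hr0)
    (show max 1 r ∈ Ioi 0 from mem_Ioi.2 (lt_max_of_lt_left one_pos)) hVc ⟨hlo, hhi⟩
  exact ⟨X, hX, hVX⟩

theorem HP1.sublevel_eq {κ : ℝ} (hκ : 1 ≤ κ) {V V' : ℝ → ℝ} (hV : HP1 κ V V') {X : ℝ}
    (hX : 0 < X) : {x : ℝ | 0 < x ∧ V x ≤ V X} = Ioc 0 X := by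
  ext x
  simp only [mem_ofPred_eq, mem_Ioc]
  exact and_congr_right fun hx => (hV.strictMonoOn_s12 hκ).le_iff_le hx hX

theorem min_rpow_le_rpow {m M z : ℝ} (b : ℝ) (hm : 0 < m) (hmz : m ≤ z) (hzM : z ≤ M) :
    min (m ^ b) (M ^ b) ≤ z ^ b := by
  rcases le_total 0 b with hb | hb
  · exact (min_le_left _ _).trans (Real.rpow_le_rpow hm.le hmz hb)
  · exact (min_le_right _ _).trans (Real.rpow_le_rpow_of_nonpos (hm.trans_le hmz) hzM hb)

/-- A fixed proportion of the mass of an `L²` solution of `-u'' + V u = V(X) u` lies at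
distance comparable to `X` from the origin. -/
theorem HP1.exists_integral_le {κ δ : ℝ} (hκ : 1 ≤ κ) (hδ : 0 < δ) :
    ∃ C : ℝ, 0 < C ∧ ∀ V V' u u' u'' : ℝ → ℝ, ∀ X : ℝ, HP1 κ V V' → 0 < X →
      δ ≤ Real.sqrt (V X) * X →
      (∀ x ∈ Ioi (0 : ℝ), HasDerivAt u (u' x) x) →
      (∀ x ∈ Ioi (0 : ℝ), HasDerivAt u' (u'' x) x) →
      (∀ x ∈ Ioi (0 : ℝ), -u'' x + V x * u x = V X * u x) →
      IntegrableOn (fun x => u x ^ 2) (Ioi 0) →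
      ∫ x in Ioi (0 : ℝ), u x ^ 2 ≤ C * ∫ x in Ioc (X / 4) (2 * X), u x ^ 2 := by
  set t : ℝ := 2 ^ κ⁻¹ with ht
  have ht1 : 1 < t := Real.one_lt_rpow one_lt_two (by positivity)
  have hs : 0 < 1 - t⁻¹ := sub_pos.2 (inv_lt_one_of_one_lt₀ ht1)
  set s := 1 - t⁻¹ with hs_def
  have hst : 1 + s ≤ t := by
    have h1 : t * t⁻¹ = 1 := mul_inv_cancel₀ (by positivity)
    nlinarith
  refine ⟨7680 * (1 + 2 / s + 4 / (δ ^ 2 * s)) + 1 + (δ ^ 2 * s)⁻¹, by positivity, ?_⟩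
  intro V V' u u' u'' X hV hX hδX hu hu' heq hint
  have hE : 0 < V X := hV.1 X hX
  have hXy : ∀ {y : ℝ}, y ∈ Ioi (0 : ℝ) → X * y ∈ Ioi (0 : ℝ) := fun hy => mul_pos hX hy
  have hlin : ∀ y : ℝ, HasDerivAt (fun y => X * y) X y := fun y => by
    simpa using (hasDerivAt_id y).const_mul X
  have hlam : δ ^ 2 ≤ V X * X ^ 2 := by
    have h1 := pow_le_pow_left₀ hδ.le hδX 2
    rwa [mul_pow, Real.sq_sqrt hE.le] at h1
  have hpt := integral_Ioi_zero_le (v := fun y => u (X * y)) (v' := fun y => X * u' (X * y))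
    (W := fun y => V (X * y) / V X) (W' := fun y => V' (X * y) * X / V X) hδ hlam hs
    ?_ ?_ ?_ ?_ ?_ ?_ ?_ ?_ ?_
  · rw [integral_comp_mul_left_Ioi (fun x => u x ^ 2) 0 hX, mul_zero,
      ← intervalIntegral.integral_of_le (by norm_num),
      intervalIntegral.integral_comp_mul_left (fun x => u x ^ 2) hX.ne',
      intervalIntegral.integral_of_le (by linarith), smul_eq_mul, smul_eq_mul,
      mul_left_comm, mul_one_div, mul_comm X 2] at hpt
    exact le_of_mul_le_mul_left hpt (inv_pos.2 hX)
  · intro y hy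
    exact div_nonneg (hV.1 _ (hXy hy)).le hE.le
  · intro y hy
    have h1 := hV.mul_div_rpow_inv_le (hXy hy.1) (by nlinarith [hy.2] : X * y ≤ X)
    have h2 : t ≤ (X / (X * y)) ^ κ⁻¹ := by
      refine Real.rpow_le_rpow zero_le_two ?_ (by positivity)
      rw [le_div_iff₀ (hXy hy.1)]
      nlinarith [hy.2]
    have h3 : V (X * y) * t ≤ V X :=
      (mul_le_mul_of_nonneg_left h2 (hV.1 _ (hXy hy.1)).le).trans h1
    rw [hs_def, sub_sub_cancel, div_le_iff₀ hE, inv_mul_eq_div, le_div_iff₀ (by positivity)]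
    exact h3
  · intro y hy
    rw [le_div_iff₀ hE, one_mul]
    exact (hV.strictMonoOn_s12 hκ).monotoneOn hX (hXy (zero_lt_one.trans_le hy)) (by nlinarith)
  · intro y hy
    have h1 := hV.mul_div_rpow_inv_le hX (by nlinarith : X ≤ X * y)
    rw [mul_div_cancel_left₀ _ hX.ne'] at h1
    have h2 : t ≤ y ^ κ⁻¹ := Real.rpow_le_rpow zero_le_two hy (by positivity)
    rw [le_div_iff₀ hE]
    nlinarith
  · intro y hy
    exact ((hV.2.1 _ (hXy hy)).comp y (hlin y)).div_const _
  · intro y hy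
    have := hV.deriv_pos hκ (hXy hy)
    positivity
  · intro y hy
    exact ((hu _ (hXy hy)).comp y (hlin y)).congr_deriv (mul_comm _ _)
  · intro y hy
    refine (((hu' _ (hXy hy)).comp y (hlin y)).const_mul X).congr_deriv ?_
    have h1 : u'' (X * y) = (V (X * y) - V X) * u (X * y) := by
      linarith [heq _ (hXy hy)]
    rw [h1]
    field_simp
  · have h1 := (integrableOn_Ioi_comp_mul_left_iff (fun x => u x ^ 2) 0 hX).2
    rw [mul_zero] at h1
    exact h1 hint

/-- Integral lower bound.  In the setup (`κ ≥ 1`, `V ∈ 𝓗𝒫₁(κ)`, `√E·|{V≤E}| ≥ δ`,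
`u ∈ C² ∩ L²` solving `−u″ + Vu = Eu` on `(0,∞)`): for all `a, b ∈ ℝ` there is
`c = c(a,b,κ,δ) > 0` with `∫₀^∞ xᵃV(x)ᵇu(x)²dx ≥ c|{V≤E}|ᵃEᵇ∫₀^∞u²`. -/
theorem integral_bounds_lower (a b κ : ℝ) (hκ : 1 ≤ κ) :
    ∀ δ : ℝ, 0 < δ →
      ∃ c : ℝ, 0 < c ∧
        ∀ V V' u u' u'' : ℝ → ℝ, ∀ E : ℝ,
          HP1 κ V V' → 0 < E →
          δ ≤ Real.sqrt E * (volume {x : ℝ | 0 < x ∧ V x ≤ E}).toReal →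
          (∀ x ∈ Ioi (0 : ℝ), HasDerivAt u (u' x) x) →
          (∀ x ∈ Ioi (0 : ℝ), HasDerivAt u' (u'' x) x) →
          ContinuousOn u'' (Ioi 0) →
          (∀ x ∈ Ioi (0 : ℝ), -u'' x + V x * u x = E * u x) →
          IntegrableOn (fun x => u x ^ 2) (Ioi 0) →
          ENNReal.ofReal
              (c * (volume {x : ℝ | 0 < x ∧ V x ≤ E}).toReal ^ a * E ^ b *
                ∫ t in Ioi (0 : ℝ), u t ^ 2) ≤
            ∫⁻ x in Ioi (0 : ℝ), ENNReal.ofReal (x ^ a * V x ^ b * u x ^ 2) := by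
  intro δ hδ
  obtain ⟨C, hC, hmass⟩ := HP1.exists_integral_le hκ hδ
  set A : ℝ := min ((1 / 4 : ℝ) ^ a) (2 ^ a) with hA
  set B : ℝ := min (((1 / 4 : ℝ) ^ κ) ^ b) (((2 : ℝ) ^ κ) ^ b) with hB
  have hA0 : 0 < A := by positivity
  have hB0 : 0 < B := by positivity
  refine ⟨A * B / C, by positivity, ?_⟩
  intro V V' u u' u'' E hV hE hδE hu hu' _ heq hint
  obtain ⟨X, hX, rfl⟩ := hV.exists_eq_s12 hκ hE
  rw [hV.sublevel_eq hκ hX, Real.volume_Ioc, sub_zero, ENNReal.toReal_ofReal hX.le] at hδE ⊢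
  have hJ := hmass V V' u u' u'' X hV hX hδE hu hu' heq hint
  have hsub : Ioc (X / 4) (2 * X) ⊆ Ioi 0 := fun x hx => lt_trans (by positivity) hx.1
  have hweight : ∀ x ∈ Ioc (X / 4) (2 * X), A * B * X ^ a * V X ^ b ≤ x ^ a * V x ^ b := by
    intro x hx
    have hx0 : 0 < x := hsub hx
    have hVx : 0 < V x := hV.1 x hx0
    have hxa : A ≤ (x / X) ^ a := by
      refine min_rpow_le_rpow a (by norm_num) ?_ ?_
      · rw [le_div_iff₀ hX]
        linarith [hx.1]
      · rw [div_le_iff₀ hX]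
        exact hx.2
    have hVb : B ≤ (V x / V X) ^ b := by
      refine min_rpow_le_rpow b (by positivity) ?_ ?_
      · have h1 : V X ≤ V (X / 4) * 4 ^ κ := by
          have h2 := hV.le_mul_div_rpow (by positivity : 0 < X / 4) (by linarith : X / 4 ≤ X)
          rwa [div_div_cancel₀ hX.ne'] at h2
        have h2 : V (X / 4) ≤ V x :=
          (hV.strictMonoOn_s12 hκ).monotoneOn (mem_Ioi.2 (by positivity)) hx0 hx.1.le
        rw [le_div_iff₀ hE, Real.div_rpow zero_le_one (by norm_num), Real.one_rpow,
          one_div_mul_eq_div,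
          div_le_iff₀ (by positivity)]
        exact h1.trans (by gcongr)
      · have h1 : V (2 * X) ≤ V X * 2 ^ κ := by
          have h2 := hV.le_mul_div_rpow hX (by linarith : X ≤ 2 * X)
          rwa [mul_div_cancel_right₀ _ hX.ne'] at h2
        have h2 : V x ≤ V (2 * X) :=
          (hV.strictMonoOn_s12 hκ).monotoneOn hx0 (mem_Ioi.2 (by positivity)) hx.2
        rw [div_le_iff₀ hE]
        linarith
    rw [Real.div_rpow hx0.le hX.le, le_div_iff₀ (by positivity)] at hxa
    rw [Real.div_rpow hVx.le hE.le, le_div_iff₀ (by positivity)] at hVb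
    calc A * B * X ^ a * V X ^ b = (A * X ^ a) * (B * V X ^ b) := by ring
      _ ≤ x ^ a * V x ^ b := by gcongr
  have hinti : IntegrableOn (fun x => A * B * X ^ a * V X ^ b * u x ^ 2) (Ioc (X / 4) (2 * X)) :=
    (hint.mono_set hsub).const_mul _
  calc ENNReal.ofReal (A * B / C * X ^ a * V X ^ b * ∫ t in Ioi (0 : ℝ), u t ^ 2)
      ≤ ENNReal.ofReal (∫ x in Ioc (X / 4) (2 * X), A * B * X ^ a * V X ^ b * u x ^ 2) := by
        refine ENNReal.ofReal_le_ofReal ?_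
        rw [integral_const_mul]
        refine (mul_le_mul_of_nonneg_left hJ (by positivity)).trans_eq ?_
        field_simp
    _ = ∫⁻ x in Ioc (X / 4) (2 * X), ENNReal.ofReal (A * B * X ^ a * V X ^ b * u x ^ 2) :=
        ofReal_integral_eq_lintegral_ofReal hinti (Eventually.of_forall fun x => by positivity)
    _ ≤ ∫⁻ x in Ioc (X / 4) (2 * X), ENNReal.ofReal (x ^ a * V x ^ b * u x ^ 2) := by
        refine setLIntegral_mono' measurableSet_Ioc fun x hx => ENNReal.ofReal_le_ofReal ?_
        exact mul_le_mul_of_nonneg_right (hweight x hx) (sq_nonneg _)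
    _ ≤ ∫⁻ x in Ioi (0 : ℝ), ENNReal.ofReal (x ^ a * V x ^ b * u x ^ 2) :=
        lintegral_mono_set hsub
end

section
/- Let V ∈ 𝒫, n ≥ 1, and E > 0. Suppose there exist nonzero, pairwise orthogonal functions ψ₁,…,ψ_n ∈ C²(ℝ;ℝ) ∩ L²(ℝ) with V·ψ_j ∈ L²(ℝ) and −ψ_j″ + Vψ_j = E_jψ_j on ℝ for some real numbers E_j ≤ E (j = 1,…,n). Then √E · |{x ∈ ℝ : V(x) < E}| ≥ π(n−1). (Taking E = E_n(V), the n-th eigenvalue of −d²/dx² + V, this yields the lower Bohr–Sommerfeld inequality √E_n · |{V < E_n}| ≥ π(n−1).) -/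
open MeasureTheory Filter

/-- `V ∈ 𝒫`: `V : ℝ → [0,∞)` is continuous with `V(0) = 0`, strictly increasing on `[0,∞)`,
strictly decreasing on `(−∞,0]`, and `V(x) → +∞` as `x → ±∞`. -/
def Pclass (V : ℝ → ℝ) : Prop :=
  Continuous V ∧ (∀ x, 0 ≤ V x) ∧ V 0 = 0 ∧
  StrictMonoOn V (Set.Ici 0) ∧ StrictAntiOn V (Set.Iic 0) ∧
  Tendsto V atTop atTop ∧ Tendsto V atBot atTop

/-- A nonnegative integrable differentiable function has points with nonpositive derivative
arbitrarily far to the right. -/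
lemma exists_ge_deriv_nonpos {v v' : ℝ → ℝ} (hv : ∀ x, HasDerivAt v (v' x) x)
    (h0 : ∀ x, 0 ≤ v x) (hi : Integrable v) (N : ℝ) : ∃ R, N ≤ R ∧ v' R ≤ 0 := by
  by_contra! h
  have hmono : StrictMonoOn v (Set.Ici N) := by
    apply strictMonoOn_of_deriv_pos (convex_Ici N)
    · exact fun x _ => (hv x).continuousAt.continuousWithinAt
    · intro x hx
      rw [interior_Ici] at hx
      rw [(hv x).deriv]
      exact h x hx.le
  have hpos : 0 < v (N + 1) :=
    (h0 N).trans_lt (hmono (by simp) (by simp) (by linarith))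
  have hconst : IntegrableOn (fun _ : ℝ => v (N + 1)) (Set.Ici (N + 1)) := by
    refine Integrable.mono' (hi.integrableOn (s := Set.Ici (N + 1)))
      aestronglyMeasurable_const ?_
    refine (ae_restrict_iff' measurableSet_Ici).2 (Eventually.of_forall fun x hx => ?_)
    rw [Real.norm_of_nonneg hpos.le]
    have hx' : N + 1 ≤ x := hx
    exact hmono.monotoneOn (by simp) (by simp; linarith) hx'
  rw [integrableOn_const_iff] at hconst
  simp [hpos.ne'] at hconst

/-- A nonnegative integrable differentiable function has points with nonnegative derivative
arbitrarily far to the left. -/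
lemma exists_le_deriv_nonneg {v v' : ℝ → ℝ} (hv : ∀ x, HasDerivAt v (v' x) x)
    (h0 : ∀ x, 0 ≤ v x) (hi : Integrable v) (N : ℝ) : ∃ R, R ≤ N ∧ 0 ≤ v' R := by
  obtain ⟨R, hR, hR'⟩ := exists_ge_deriv_nonpos (v := fun x => v (-x)) (v' := fun x => -v' (-x))
    (fun x => by simpa using! (hv (-x)).comp x (hasDerivAt_neg x))
    (fun x => h0 _) hi.comp_neg (-N)
  exact ⟨-R, by linarith, by linarith⟩

/-- Riccati comparison with `k tan (k (y - x))`: if `tan (k (y - ·)) * u` vanishes at both ends of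
an interval on which `|k (y - x)| < π / 2`, then `∫ (u'² - k² u²) ≥ 0` there. -/
lemma integral_sq_deriv_sub_nonneg_of_tan {u u' : ℝ → ℝ} (hu : ∀ x, HasDerivAt u (u' x) x)
    (hu' : Continuous u') {k y p q : ℝ} (hpq : p ≤ q)
    (hk : ∀ x ∈ Set.Icc p q, |k * (y - x)| < Real.pi / 2)
    (hp : Real.tan (k * (y - p)) * u p = 0) (hq : Real.tan (k * (y - q)) * u q = 0) :
    0 ≤ ∫ x in p..q, (u' x ^ 2 - k ^ 2 * u x ^ 2) := by
  have huc : Continuous u := continuous_iff_continuousAt.2 fun x => (hu x).continuousAt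
  have hcos : ∀ x ∈ Set.Icc p q, Real.cos (k * (y - x)) ≠ 0 := fun x hx =>
    (Real.cos_pos_of_mem_Ioo (abs_lt.1 (hk x hx))).ne'
  have hder : ∀ x ∈ Set.Icc p q, HasDerivAt (fun x => k * Real.tan (k * (y - x)) * u x ^ 2)
      (k * (1 / Real.cos (k * (y - x)) ^ 2 * (k * (-1))) * u x ^ 2
        + k * Real.tan (k * (y - x)) * (2 * u x * u' x)) x := by
    intro x hx
    have h1 : HasDerivAt (fun x => k * (y - x)) (k * (-1)) x :=
      ((hasDerivAt_id x).const_sub y).const_mul k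
    have h2 := ((Real.hasDerivAt_tan (hcos x hx)).comp x h1).const_mul k
    have h3 : HasDerivAt (fun x => u x ^ 2) (2 * u x * u' x) x := by
      simpa using! (hu x).pow 2
    exact h2.mul h3
  have key := intervalIntegral.sub_le_integral_of_hasDeriv_right_of_le hpq
    (fun x hx => (hder x hx).continuousAt.continuousWithinAt)
    (fun x hx => (hder x (Set.Ioo_subset_Icc_self hx)).hasDerivWithinAt)
    (φ := fun x => u' x ^ 2 - k ^ 2 * u x ^ 2)
    (Continuous.integrableOn_Icc (by fun_prop))
    (fun x hx => by
      have hc := hcos x (Set.Ioo_subset_Icc_self hx)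
      have ht : 1 / Real.cos (k * (y - x)) ^ 2 = 1 + Real.tan (k * (y - x)) ^ 2 := by
        rw [← Real.inv_one_add_tan_sq hc]; simp
      rw [ht]
      nlinarith [sq_nonneg (u' x - k * Real.tan (k * (y - x)) * u x)])
  have e1 : k * Real.tan (k * (y - q)) * u q ^ 2 = 0 := by
    linear_combination (k * u q) * hq
  have e2 : k * Real.tan (k * (y - p)) * u p ^ 2 = 0 := by
    linear_combination (k * u p) * hp
  simpa [e1, e2] using key

/-- A function vanishing at the midpoint of an interval of length less than `π / k` satisfies
`∫ (u'² - k² u²) ≥ 0` there. -/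
lemma integral_sq_deriv_sub_nonneg_of_midpoint {u u' : ℝ → ℝ} (hu : ∀ x, HasDerivAt u (u' x) x)
    (hu' : Continuous u') {k c h : ℝ} (hk : 0 ≤ k) (hh : 0 ≤ h) (hkh : k * h < Real.pi / 2)
    (hc : u c = 0) : 0 ≤ ∫ x in (c - h)..(c + h), (u' x ^ 2 - k ^ 2 * u x ^ 2) := by
  have huc : Continuous u := continuous_iff_continuousAt.2 fun x => (hu x).continuousAt
  have hcont : Continuous fun x => u' x ^ 2 - k ^ 2 * u x ^ 2 := by fun_prop
  rw [← intervalIntegral.integral_add_adjacent_intervals (b := c)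
    (hcont.intervalIntegrable _ _) (hcont.intervalIntegrable _ _)]
  have habs : ∀ z, |z| ≤ h → |k * z| < Real.pi / 2 := fun z hz => by
    rw [abs_mul, abs_of_nonneg hk]
    exact (mul_le_mul_of_nonneg_left hz hk).trans_lt hkh
  refine add_nonneg
    (integral_sq_deriv_sub_nonneg_of_tan (y := c - h) hu hu' (by linarith)
      (fun x hx => habs _ ?_) (by simp) (by simp [hc]))
    (integral_sq_deriv_sub_nonneg_of_tan (y := c + h) hu hu' (by linarith)
      (fun x hx => habs _ ?_) (by simp [hc]) (by simp))
  · rw [abs_le]; constructor <;> linarith [hx.1, hx.2]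
  · rw [abs_le]; constructor <;> linarith [hx.1, hx.2]

/-- Cut `[a, a + 2 m h]` into `m` cells of length `2 h < π / k`. A function vanishing at all the
midpoints satisfies `∫ (u'² - k² u²) ≥ 0`. -/
lemma integral_sq_deriv_sub_nonneg_of_midpoints {u u' : ℝ → ℝ} (hu : ∀ x, HasDerivAt u (u' x) x)
    (hu' : Continuous u') {k a h : ℝ} (hk : 0 ≤ k) (hh : 0 ≤ h) (hkh : k * h < Real.pi / 2)
    (m : ℕ) (hz : ∀ i < m, u (a + (2 * i + 1) * h) = 0) :
    0 ≤ ∫ x in a..(a + 2 * m * h), (u' x ^ 2 - k ^ 2 * u x ^ 2) := by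
  have huc : Continuous u := continuous_iff_continuousAt.2 fun x => (hu x).continuousAt
  have hcont : Continuous fun x => u' x ^ 2 - k ^ 2 * u x ^ 2 := by fun_prop
  induction m with
  | zero => simp
  | succ m ih =>
    rw [← intervalIntegral.integral_add_adjacent_intervals (b := a + 2 * m * h)
      (hcont.intervalIntegrable _ _) (hcont.intervalIntegrable _ _)]
    refine add_nonneg (ih fun i hi => hz i (by omega)) ?_
    have := integral_sq_deriv_sub_nonneg_of_midpoint hu hu' hk hh hkh (hz m (by omega))
    rwa [show a + (2 * m + 1) * h - h = a + 2 * m * h by ring,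
      show a + (2 * m + 1) * h + h = a + 2 * (m + 1 : ℕ) * h by push_cast; ring] at this

/-- If `√E |{V < E}| < B`, the well can be enlarged slightly to an interval `[a, b]`, with room to
spare in the energy. -/
lemma Pclass.exists_enlarged_well {V : ℝ → ℝ} (hV : Pclass V) {E : ℝ} (hE : 0 < E) {B : ℝ}
    (hB : ENNReal.ofReal (Real.sqrt E) * volume {x : ℝ | V x < E} < ENNReal.ofReal B) :
    ∃ a b k η : ℝ, a < b ∧ 0 < k ∧ 0 < η ∧ k * (b - a) < B ∧ E + η ≤ k ^ 2 ∧
      (∀ x ≤ a, E + η ≤ V x) ∧ ∀ x, b ≤ x → E + η ≤ V x := by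
  obtain ⟨hc, -, h0, hmono, hanti, htop, hbot⟩ := hV
  obtain ⟨b, hb, hbE⟩ : ∃ b, 0 ≤ b ∧ V b = E := by
    obtain ⟨N, hN, hN'⟩ := ((htop.eventually_ge_atTop E).and (eventually_ge_atTop 0)).exists
    obtain ⟨b, hb, hbE⟩ := intermediate_value_Icc hN' hc.continuousOn
      (show E ∈ Set.Icc (V 0) (V N) from ⟨by rw [h0]; exact hE.le, hN⟩)
    exact ⟨b, hb.1, hbE⟩
  obtain ⟨a, ha, haE⟩ : ∃ a, a ≤ 0 ∧ V a = E := by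
    obtain ⟨N, hN, hN'⟩ := ((hbot.eventually_ge_atTop E).and (eventually_le_atBot 0)).exists
    obtain ⟨a, ha, haE⟩ := intermediate_value_Icc' hN' hc.continuousOn
      (show E ∈ Set.Icc (V 0) (V N) from ⟨by rw [h0]; exact hE.le, hN⟩)
    exact ⟨a, ha.2, haE⟩
  have hsub : Set.Ioo a b ⊆ {x : ℝ | V x < E} := by
    intro x hx
    rcases le_total 0 x with h | h
    · exact hbE ▸ hmono h hb hx.2
    · exact haE ▸ hanti ha h hx.1
  have hlt : Real.sqrt E * (b - a) < B := by
    have h1 : ENNReal.ofReal (Real.sqrt E * (b - a)) < ENNReal.ofReal B := by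
      refine lt_of_le_of_lt ?_ hB
      rw [ENNReal.ofReal_mul (Real.sqrt_nonneg E), ← Real.volume_Ioo]
      gcongr
    exact (ENNReal.ofReal_lt_ofReal_iff_of_nonneg
      (mul_nonneg (Real.sqrt_nonneg E) (by linarith))).1 h1
  obtain ⟨s, hs, hsB⟩ : ∃ s : ℝ, 0 < s ∧ (Real.sqrt E + s) * (b - a + 2 * s) < B := by
    have hcont : Continuous fun s : ℝ => (Real.sqrt E + s) * (b - a + 2 * s) := by fun_prop
    have hev := (hcont.tendsto 0).eventually_lt_const (u := B) (by simpa using hlt)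
    obtain ⟨s, hsB, hs⟩ :=
      ((hev.filter_mono nhdsWithin_le_nhds).and (self_mem_nhdsWithin (s := Set.Ioi 0))).exists
    exact ⟨s, hs, hsB⟩
  have hVb : E < V (b + s) := hbE ▸ hmono hb (show 0 ≤ b + s by linarith) (by linarith)
  have hVa : E < V (a - s) := haE ▸ hanti (show a - s ≤ 0 by linarith) ha (by linarith)
  have hk : E < (Real.sqrt E + s) ^ 2 := by
    nlinarith [Real.sq_sqrt hE.le, Real.sqrt_nonneg E]
  have hm : ∃ η > 0, η ≤ V (b + s) - E ∧ η ≤ V (a - s) - E ∧ η ≤ (Real.sqrt E + s) ^ 2 - E :=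
    ⟨min (min (V (b + s) - E) (V (a - s) - E)) ((Real.sqrt E + s) ^ 2 - E), by
      simp [hVa, hVb, hk], by simp, by simp, by simp⟩
  obtain ⟨η, hη, h1, h2, h3⟩ := hm
  refine ⟨a - s, b + s, Real.sqrt E + s, η, by linarith, by positivity, hη, ?_, by linarith,
    fun x hx => ?_, fun x hx => ?_⟩
  · rwa [show b + s - (a - s) = b - a + 2 * s by ring]
  · have := hanti.antitoneOn (show x ≤ 0 by linarith) (show a - s ≤ 0 by linarith) hx
    linarith
  · have := hmono.monotoneOn (show 0 ≤ b + s by linarith) (show 0 ≤ x by linarith) hx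
    linarith

/-- More functions than points: some nontrivial linear combination vanishes at all the points. -/
lemma exists_ne_zero_sum_mul_eq_zero {n m : ℕ} (hmn : m < n) (ψ : Fin n → ℝ → ℝ)
    (z : ℕ → ℝ) : ∃ c : Fin n → ℝ, c ≠ 0 ∧ ∀ i < m, ∑ j, c j * ψ j (z i) = 0 := by
  let A : Matrix (Fin m) (Fin n) ℝ := fun i j => ψ j (z i)
  have hker : LinearMap.ker (Matrix.mulVecLin A) ≠ ⊥ :=
    LinearMap.ker_ne_bot_of_finrank_lt (by simpa using hmn)
  obtain ⟨c, hc, hc0⟩ := (Submodule.ne_bot_iff _).1 hker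
  refine ⟨c, hc0, fun i hi => ?_⟩
  have hrow : ∑ j, ψ j (z i) * c j = 0 := congrFun (LinearMap.mem_ker.1 hc) ⟨i, hi⟩
  simpa only [mul_comm] using hrow

/-- Products of square-integrable continuous real functions are integrable. -/
lemma integrable_mul_of_sq {f g : ℝ → ℝ} (hf : Continuous f) (hg : Continuous g)
    (hf2 : Integrable fun x => f x ^ 2) (hg2 : Integrable fun x => g x ^ 2) :
    Integrable fun x => f x * g x := by
  refine (hf2.add hg2).mono' (hf.mul hg).aestronglyMeasurable (Eventually.of_forall fun x => ?_)
  simp only [Pi.add_apply, Real.norm_eq_abs, abs_le]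
  constructor <;> nlinarith [sq_nonneg (f x + g x), sq_nonneg (f x - g x), sq_nonneg (f x),
    sq_nonneg (g x)]

/-- On an interval containing the well, the quadratic form of `-d²/dx² + V - E - η` is nonnegative
on functions vanishing at the midpoints of the cells. -/
lemma integral_energy_nonneg {V u u' : ℝ → ℝ} (hVc : Continuous V) (hV0 : ∀ x, 0 ≤ V x)
    (hu : ∀ x, HasDerivAt u (u' x) x) (hu' : Continuous u') {a b k F : ℝ} (hab : a ≤ b)
    (hkF : F ≤ k ^ 2) (hVa : ∀ x ≤ a, F ≤ V x) (hVb : ∀ x, b ≤ x → F ≤ V x)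
    (hin : 0 ≤ ∫ x in a..b, (u' x ^ 2 - k ^ 2 * u x ^ 2)) {p q : ℝ} (hp : p ≤ a) (hq : b ≤ q) :
    0 ≤ ∫ x in p..q, (u' x ^ 2 + (V x - F) * u x ^ 2) := by
  have huc : Continuous u := continuous_iff_continuousAt.2 fun x => (hu x).continuousAt
  have hcont : Continuous fun x => u' x ^ 2 + (V x - F) * u x ^ 2 := by fun_prop
  have hcont' : Continuous fun x => u' x ^ 2 - k ^ 2 * u x ^ 2 := by fun_prop
  rw [← intervalIntegral.integral_add_adjacent_intervals (b := b)
      (hcont.intervalIntegrable _ _) (hcont.intervalIntegrable _ _),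
    ← intervalIntegral.integral_add_adjacent_intervals (b := a)
      (hcont.intervalIntegrable _ _) (hcont.intervalIntegrable _ _)]
  refine add_nonneg (add_nonneg ?_ (hin.trans ?_)) ?_
  · refine intervalIntegral.integral_nonneg hp fun x hx => ?_
    have := mul_nonneg (sub_nonneg.2 (hVa x hx.2)) (sq_nonneg (u x))
    positivity
  · refine intervalIntegral.integral_mono_on hab (hcont'.intervalIntegrable _ _)
      (hcont.intervalIntegrable _ _) fun x _ => ?_
    nlinarith [mul_nonneg (hV0 x) (sq_nonneg (u x)),
      mul_nonneg (sub_nonneg.2 hkF) (sq_nonneg (u x))]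
  · refine intervalIntegral.integral_nonneg hq fun x hx => ?_
    have := mul_nonneg (sub_nonneg.2 (hVb x hx.1)) (sq_nonneg (u x))
    positivity

/-- A function with integrable square satisfies `∫ (u'² + u u'') ≤ 0` on suitable arbitrarily
large intervals. -/
lemma exists_integral_sq_add_mul_nonpos {u u' u'' : ℝ → ℝ} (hu : ∀ x, HasDerivAt u (u' x) x)
    (hu' : ∀ x, HasDerivAt u' (u'' x) x) (hu'' : Continuous u'')
    (hL2 : Integrable fun x => u x ^ 2) (A B : ℝ) :
    ∃ p q, p ≤ A ∧ B ≤ q ∧ ∫ x in p..q, (u' x ^ 2 + u x * u'' x) ≤ 0 := by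
  have huc : Continuous u := continuous_iff_continuousAt.2 fun x => (hu x).continuousAt
  have huc' : Continuous u' := continuous_iff_continuousAt.2 fun x => (hu' x).continuousAt
  have hsq : ∀ x, HasDerivAt (fun x => u x ^ 2) (2 * u x * u' x) x := fun x => by
    simpa using! (hu x).pow 2
  obtain ⟨p, hp, hp'⟩ := exists_le_deriv_nonneg hsq (fun x => sq_nonneg _) hL2 A
  obtain ⟨q, hq, hq'⟩ := exists_ge_deriv_nonpos hsq (fun x => sq_nonneg _) hL2 B
  refine ⟨p, q, hp, hq, ?_⟩
  have hd : ∀ x, HasDerivAt (fun x => u x * u' x) (u' x ^ 2 + u x * u'' x) x := fun x => by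
    simpa [sq] using! (hu x).mul (hu' x)
  have hcont : Continuous fun x => u' x ^ 2 + u x * u'' x := by fun_prop
  rw [intervalIntegral.integral_eq_sub_of_hasDerivAt (fun x _ => hd x)
    (hcont.intervalIntegrable _ _)]
  linarith

/-- Orthogonal expansion of `∫ (∑ cᵢ ψᵢ) (∑ dⱼ ψⱼ)`. -/
lemma integral_sum_mul_sum_of_orthogonal {n : ℕ} {ψ : Fin n → ℝ → ℝ}
    (hint : ∀ i j, Integrable fun x => ψ i x * ψ j x)
    (horth : ∀ i j, i ≠ j → ∫ x : ℝ, ψ i x * ψ j x = 0) (c d : Fin n → ℝ) :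
    Integrable (fun x => (∑ j, c j * ψ j x) * ∑ j, d j * ψ j x) ∧
      ∫ x, (∑ j, c j * ψ j x) * ∑ j, d j * ψ j x = ∑ j, c j * d j * ∫ x, ψ j x ^ 2 := by
  have hexp : (fun x => (∑ j, c j * ψ j x) * ∑ j, d j * ψ j x) =
      fun x => ∑ i, ∑ j, c i * d j * (ψ i x * ψ j x) := by
    funext x
    rw [Finset.sum_mul_sum]
    exact Finset.sum_congr rfl fun i _ => Finset.sum_congr rfl fun j _ => by ring
  have hi : ∀ i j, Integrable fun x => c i * d j * (ψ i x * ψ j x) :=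
    fun i j => (hint i j).const_mul _
  rw [hexp]
  refine ⟨integrable_finsetSum _ fun i _ => integrable_finsetSum _ fun j _ => hi i j, ?_⟩
  rw [integral_finsetSum _ fun i _ => integrable_finsetSum _ fun j _ => hi i j]
  refine Finset.sum_congr rfl fun i _ => ?_
  rw [integral_finsetSum _ fun j _ => hi i j, Finset.sum_eq_single i]
  · rw [integral_const_mul]
    simp only [sq]
  · intro j _ hj
    rw [integral_const_mul, horth i j hj.symm, mul_zero]
  · simp

/-- Lower Bohr–Sommerfeld inequality.  Let `V ∈ 𝒫`, `n ≥ 1`, `E > 0`, and suppose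
`ψ₁, …, ψ_n ∈ C²(ℝ) ∩ L²(ℝ)` are nonzero and pairwise orthogonal, with `V·ψ_j ∈ L²(ℝ)` and
`−ψ_j″ + Vψ_j = E_jψ_j` for some `E_j ≤ E`.  Then `√E·|{V < E}| ≥ π(n−1)`. -/
theorem lower_bohr_sommerfeld
    (V : ℝ → ℝ) (hV : Pclass V) (n : ℕ) (hn : 1 ≤ n) (E : ℝ) (hE : 0 < E)
    (ψ ψ' ψ'' : Fin n → ℝ → ℝ) (Ej : Fin n → ℝ)
    (hne : ∀ j, ∃ x, ψ j x ≠ 0)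
    (horth : ∀ i j, i ≠ j → ∫ x : ℝ, ψ i x * ψ j x = 0)
    (hd : ∀ j, ∀ x : ℝ, HasDerivAt (ψ j) (ψ' j x) x)
    (hd' : ∀ j, ∀ x : ℝ, HasDerivAt (ψ' j) (ψ'' j x) x)
    (hc : ∀ j, Continuous (ψ'' j))
    (hL2 : ∀ j, Integrable (fun x => ψ j x ^ 2))
    (hVL2 : ∀ j, Integrable (fun x => (V x * ψ j x) ^ 2))
    (heq : ∀ j, ∀ x : ℝ, -ψ'' j x + V x * ψ j x = Ej j * ψ j x)
    (hEj : ∀ j, Ej j ≤ E) :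
    ENNReal.ofReal (Real.pi * (n - 1)) ≤
      ENNReal.ofReal (Real.sqrt E) * volume {x : ℝ | V x < E} := by
  by_contra! hlt
  obtain ⟨a, b, k, η, hab, hk, hη, hkB, hkE, hVa, hVb⟩ := hV.exists_enlarged_well hE hlt
  obtain ⟨m, rfl⟩ : ∃ m, n = m + 1 := ⟨n - 1, by omega⟩
  have hm : (0 : ℝ) < m := by
    have h1 : 0 < Real.pi * ((m + 1 : ℕ) - 1 : ℝ) :=
      (mul_pos hk (sub_pos.2 hab)).trans hkB
    have h2 := pos_of_mul_pos_right h1 Real.pi_pos.le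
    push_cast at h2
    linarith
  obtain ⟨h, rfl⟩ : ∃ h, b = a + 2 * m * h := ⟨(b - a) / (2 * m), by field_simp; ring⟩
  have hh : 0 < h := by
    have h1 : 0 < 2 * m * h := by linarith
    exact pos_of_mul_pos_right h1 (by positivity)
  have hkh : k * h < Real.pi / 2 := by
    push_cast at hkB
    have h1 : m * (2 * (k * h)) < m * Real.pi := by linarith
    linarith [lt_of_mul_lt_mul_left h1 hm.le]
  obtain ⟨c, hc0, hcz⟩ := exists_ne_zero_sum_mul_eq_zero (Nat.lt_succ_self m) ψ
    (fun i => a + (2 * i + 1) * h)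
  have hψ : ∀ j, Continuous (ψ j) := fun j =>
    continuous_iff_continuousAt.2 fun x => (hd j x).continuousAt
  have hψ' : ∀ j, Continuous (ψ' j) := fun j =>
    continuous_iff_continuousAt.2 fun x => (hd' j x).continuousAt
  have hint : ∀ i j, Integrable fun x => ψ i x * ψ j x := fun i j =>
    integrable_mul_of_sq (hψ i) (hψ j) (hL2 i) (hL2 j)
  have hnorm : ∀ j, 0 < ∫ x, ψ j x ^ 2 := fun j => by
    obtain ⟨x, hx⟩ := hne j
    exact integral_pos_of_integrable_nonneg_nonzero ((hψ j).pow 2) (hL2 j)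
      (fun y => sq_nonneg (ψ j y)) (pow_ne_zero 2 hx)
  let u : ℝ → ℝ := fun x => ∑ j, c j * ψ j x
  let u' : ℝ → ℝ := fun x => ∑ j, c j * ψ' j x
  let u'' : ℝ → ℝ := fun x => ∑ j, c j * ψ'' j x
  let w : ℝ → ℝ := fun x => ∑ j, c j * (E + η - Ej j) * ψ j x
  have hu : ∀ x, HasDerivAt u (u' x) x := fun x =>
    HasDerivAt.fun_sum fun j _ => (hd j x).const_mul (c j)
  have hu' : ∀ x, HasDerivAt u' (u'' x) x := fun x =>
    HasDerivAt.fun_sum fun j _ => (hd' j x).const_mul (c j)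
  have huc : Continuous u := by fun_prop
  have huc' : Continuous u' := by fun_prop
  have huc'' : Continuous u'' := by fun_prop
  have hwc : Continuous w := by fun_prop
  have hode : ∀ x, u'' x = (V x - (E + η)) * u x + w x := fun x => by
    simp only [u, u'', w, Finset.mul_sum, ← Finset.sum_add_distrib]
    refine Finset.sum_congr rfl fun j _ => ?_
    linear_combination (-c j) * heq j x
  have huL2 : Integrable fun x => u x ^ 2 := by
    simpa only [sq] using (integral_sum_mul_sum_of_orthogonal hint horth c c).1
  obtain ⟨hwi, hwint⟩ := integral_sum_mul_sum_of_orthogonal hint horth c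
    (fun j => c j * (E + η - Ej j))
  have hpos : 0 < ∫ x, u x * w x := by
    change 0 < ∫ x, (∑ j, c j * ψ j x) * ∑ j, c j * (E + η - Ej j) * ψ j x
    rw [hwint]
    have hterm : ∀ j, c j * (c j * (E + η - Ej j)) * ∫ x, ψ j x ^ 2
        = c j ^ 2 * ((E + η - Ej j) * ∫ x, ψ j x ^ 2) := fun j => by ring
    simp only [hterm]
    have hfac : ∀ j, 0 < (E + η - Ej j) * ∫ x, ψ j x ^ 2 := fun j =>
      mul_pos (by linarith [hEj j]) (hnorm j)
    obtain ⟨j, hj⟩ := Function.ne_iff.1 hc0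
    have hj' : c j ≠ 0 := hj
    exact Finset.sum_pos' (fun i _ => mul_nonneg (sq_nonneg _) (hfac i).le)
      ⟨j, Finset.mem_univ j, mul_pos (by positivity) (hfac j)⟩
  have hin := integral_sq_deriv_sub_nonneg_of_midpoints hu huc' hk.le hh.le hkh m hcz
  have hex : ∀ N : ℕ, ∃ p q : ℝ, p ≤ -N ∧ N ≤ q ∧ ∫ x in p..q, u x * w x ≤ 0 := by
    intro N
    obtain ⟨p, q, hp, hq, hpq⟩ := exists_integral_sq_add_mul_nonpos hu hu' huc'' huL2
      (min a (-N)) (max (a + 2 * m * h) N)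
    refine ⟨p, q, hp.trans (min_le_right _ _), (le_max_right _ _).trans hq, ?_⟩
    have hen := integral_energy_nonneg hV.1 hV.2.1 hu huc' hab.le hkE hVa hVb hin
      (hp.trans (min_le_left _ _)) ((le_max_left _ _).trans hq)
    have hVc := hV.1
    have hsplit : ∫ x in p..q, (u' x ^ 2 + u x * u'' x) =
        (∫ x in p..q, (u' x ^ 2 + (V x - (E + η)) * u x ^ 2)) + ∫ x in p..q, u x * w x := by
      rw [← intervalIntegral.integral_add (Continuous.intervalIntegrable (by fun_prop) _ _)
        (Continuous.intervalIntegrable (by fun_prop) _ _)]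
      refine intervalIntegral.integral_congr fun x _ => ?_
      simp only [hode]
      ring
    linarith
  choose p q hp hq hpq using hex
  have hlim := intervalIntegral_tendsto_integral hwi
    (tendsto_atBot_mono hp (tendsto_neg_atTop_atBot.comp tendsto_natCast_atTop_atTop))
    (tendsto_atTop_mono hq tendsto_natCast_atTop_atTop)
  exact absurd (le_of_tendsto hlim (Eventually.of_forall hpq)) (not_le.2 hpos)
end
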